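/- arXiv:1507.01072 — 3 statements merged into one kernel-verified Lean document; each statement's English description precedes it below -/
import Mathlib

section
/- Let M be a unital C*-algebra with a faithful tracial state τ, let n ≥ 2, and let p₁, …, pₙ ∈ M be projections with pᵢ pⱼ = 0 for i ≠ j and p₁ + ⋯ + pₙ = 1. Set λ = exp(2πi/n) and u = Σ_{j=1}^n λ^{j−1} pⱼ (a unitary element of M). Let x ∈ M with ‖x‖ ≤ 1 and suppose that the family (u^{i−1} x u^{−(i−1)})_{i=1,…,n} is L-free with respect to τ. Then ‖Σ_{j=1}^n pⱼ x pⱼ‖ ≤ 2√(n−1)/n. -/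
open scoped BigOperators ComplexOrder

section Defs

variable {A : Type*} [Ring A] [StarRing A] [Algebra ℂ A]

/-- `τ` is a (ℂ-linear) tracial state on the unital star ℂ-algebra `A`. -/
def IsTracialState (τ : A → ℂ) : Prop :=
  (∀ (c : ℂ) (x y : A), τ (c • x + y) = c * τ x + τ y) ∧
  τ 1 = 1 ∧ (∀ x : A, 0 ≤ τ (star x * x)) ∧ (∀ x y : A, τ (x * y) = τ (y * x))

/-- `τ` is faithful. -/
def IsFaithful (τ : A → ℂ) : Prop := ∀ x : A, τ (star x * x) = 0 → x = 0

def IsProjection (p : A) : Prop := star p = p ∧ p * p = p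

def IsUnitary (u : A) : Prop := star u * u = 1 ∧ u * star u = 1

/-- The alternating word `x_{i 0} (x_{i 1})* x_{i 2} (x_{i 3})* ⋯`. -/
def LWord {n m : ℕ} (x : Fin n → A) (i : Fin m → Fin n) : A :=
  (List.ofFn fun s : Fin m => if (s : ℕ) % 2 = 0 then x (i s) else star (x (i s))).prod

/-- The alternating word `(x_{i 0})* x_{i 1} (x_{i 2})* x_{i 3} ⋯`. -/
def LWordStar {n m : ℕ} (x : Fin n → A) (i : Fin m → Fin n) : A :=
  (List.ofFn fun s : Fin m => if (s : ℕ) % 2 = 0 then star (x (i s)) else x (i s)).prod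

/-- L-freeness of a finite family with respect to `τ`. -/
def IsLFree {n : ℕ} (τ : A → ℂ) (x : Fin n → A) : Prop :=
  ∀ (k : ℕ), 1 ≤ k → ∀ i : Fin (2 * k) → Fin n,
    (∀ s t : Fin (2 * k), (t : ℕ) = (s : ℕ) + 1 → i s ≠ i t) →
    τ (LWord x i) = 0 ∧ τ (LWordStar x i) = 0

/-- Integer powers of a unitary: negative powers are powers of the adjoint. -/
def zpowU (u : A) (k : ℤ) : A := if 0 ≤ k then u ^ k.toNat else star u ^ (-k).toNat

/-- `v₁, …, v_m` are freely independent Haar unitaries with respect to `τ`. -/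
def AreHaarFree {m : ℕ} (τ : A → ℂ) (v : Fin m → A) : Prop :=
  ∀ (r : ℕ), 1 ≤ r → ∀ (i : Fin r → Fin m) (e : Fin r → ℤ),
    (∀ s, e s ≠ 0) → (∀ s t : Fin r, (t : ℕ) = (s : ℕ) + 1 → i s ≠ i t) →
    τ ((List.ofFn fun s : Fin r => zpowU (v (i s)) (e s)).prod) = 0

/-- `X` and `Y` are freely independent sets with respect to `τ`: every alternating
word with letters from `X` and `Y` has zero trace. -/
def FreeSets (τ : A → ℂ) (X Y : Set A) : Prop :=
  ∀ (m : ℕ), 1 ≤ m → ∀ z : Fin m → A,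
    ((∀ s : Fin m, if (s : ℕ) % 2 = 0 then z s ∈ X else z s ∈ Y) ∨
     (∀ s : Fin m, if (s : ℕ) % 2 = 0 then z s ∈ Y else z s ∈ X)) →
    τ ((List.ofFn z).prod) = 0

end Defs

section PavingKernel

variable {N : Type*} [Ring N] [StarRing N] {ι : Type*} [Fintype ι] [DecidableEq ι]

/-- Sum of reduced words of length `j` whose last letter is not `c`. -/
def pvZ (X : ι → N) : ℕ → ι → N
  | 0, _ => 1
  | j + 1, c => ∑ d, if d = c then 0 else pvZ X j d * X d

/-- Sum of reduced words of length `j`. -/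
def pvW (X : ι → N) : ℕ → N
  | 0 => 1
  | j + 1 => ∑ d, pvZ X j d * X d

def pvF (X : ι → N) (i j : ℕ) : N := ∑ c, pvZ X i c * X c * star (pvZ X j c)

def pvG (X : ι → N) (i j : ℕ) : N := ∑ c, pvZ X i c * star (pvZ X j c)

def pvT (X : ι → N) (i j : ℕ) : N := ∑ c, pvZ X i c * (1 - X c * X c) * star (pvZ X j c)

def pvC (X : ι → N) (m : ℕ) : ℕ → ℕ → N
  | 0, j => pvT X 0 j
  | i + 1, 0 => pvT X (i + 1) 0
  | i + 1, j + 1 => pvT X (i + 1) (j + 1) + m • pvC X m i j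

def pvC' (X : ι → N) (m : ℕ) : ℕ → ℕ → N
  | 0, _ => 0
  | _ + 1, 0 => 0
  | i + 1, j + 1 => pvC X m i j

def pvB (X : ι → N) (m : ℕ) (i j : ℕ) : N := pvW X i * star (pvW X j) + pvC' X m i j

def pvκ (m : ℕ) : ℕ → ℕ
  | 0 => m + 1
  | _ + 1 => m

variable (X : ι → N)

lemma pvC_eq (m i j : ℕ) : pvC X m i j = pvT X i j + m • pvC' X m i j := by
  cases i <;> cases j <;> simp [pvC, pvC']

lemma pvW_eq (j : ℕ) (c : ι) : pvW X (j + 1) = pvZ X (j + 1) c + pvZ X j c * X c := by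
  simp only [pvW, pvZ]
  rw [← Finset.sum_erase_add _ _ (Finset.mem_univ c)]
  congr 1
  rw [← Finset.sum_erase_add (a := c) _ _ (Finset.mem_univ c)]
  simp only [if_true, add_zero]
  apply Finset.sum_congr rfl
  intro d hd
  rw [if_neg (Finset.ne_of_mem_erase hd)]

lemma pvZ_sum (m : ℕ) (hm : Fintype.card ι = m + 1) (j : ℕ) :
    ∑ c, pvZ X j c = pvκ m j • pvW X j := by
  cases j with
  | zero => simp [pvZ, pvW, pvκ, hm]
  | succ j =>
    have h : ∑ c : ι, pvW X (j + 1) = ∑ c, pvZ X (j + 1) c + pvW X (j + 1) := by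
      conv_rhs => rw [pvW]
      rw [← Finset.sum_add_distrib]
      exact Finset.sum_congr rfl fun c _ => pvW_eq X j c
    rw [Finset.sum_const, Finset.card_univ, hm, add_smul, one_smul] at h
    simpa [pvκ] using (add_right_cancel h).symm


lemma pvF_shift (hX : ∀ c, star (X c) = X c) (i j : ℕ) : pvF X (i + 1) j = pvF X i (j + 1) := by
  simp only [pvF, pvZ, Finset.sum_mul, Finset.mul_sum, star_sum]
  rw [Finset.sum_comm]
  apply Finset.sum_congr rfl
  intro d _
  apply Finset.sum_congr rfl
  intro c _
  by_cases h : d = c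
  · simp [h]
  · simp [h, Ne.symm h, hX, mul_assoc]

lemma pvF_star (hX : ∀ c, star (X c) = X c) (i j : ℕ) : star (pvF X i j) = pvF X j i := by
  simp [pvF, star_sum, hX, mul_assoc]

lemma pvF_zero (i : ℕ) : pvF X i 0 = pvW X (i + 1) := by
  simp [pvF, pvZ, pvW]

lemma pvF_eq (hX : ∀ c, star (X c) = X c) (i j : ℕ) : pvF X i j = pvW X (i + j + 1) := by
  induction j generalizing i with
  | zero => exact pvF_zero X i
  | succ j ih => rw [← pvF_shift X hX, ih]; congr 1; ring

lemma pvW_star (hX : ∀ c, star (X c) = X c) (i : ℕ) : star (pvW X i) = pvW X i := by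
  cases i with
  | zero => simp [pvW]
  | succ i => rw [← pvF_zero, pvF_star X hX, pvF_zero, pvF_eq X hX]; simp

lemma pvWT (hX : ∀ c, star (X c) = X c) (i j : ℕ) :
    pvW X (i + 1) * star (pvW X (j + 1)) + pvT X i j = pvW X (i + j + 2) + pvG X i j := by
  have h1 : pvW X (i + 1) * star (pvW X (j + 1)) = pvF X i (j + 1) +
      ∑ c, pvZ X i c * (X c * X c) * star (pvZ X j c) := by
    conv_lhs => rw [show pvW X (i + 1) = ∑ d, pvZ X i d * X d from rfl]
    rw [Finset.sum_mul, pvF, ← Finset.sum_add_distrib]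
    apply Finset.sum_congr rfl
    intro c _
    rw [pvW_eq X j c]
    simp [hX, mul_add, mul_assoc]
  have h2 : pvT X i j = pvG X i j - ∑ c, pvZ X i c * (X c * X c) * star (pvZ X j c) := by
    rw [pvT, pvG, ← Finset.sum_sub_distrib]
    apply Finset.sum_congr rfl
    intro c _
    noncomm_ring
  rw [h1, h2, pvF_eq X hX, show i + (j + 1) + 1 = i + j + 2 by ring]
  abel

lemma pvG_succ (hX : ∀ c, star (X c) = X c) (m : ℕ) (hm : Fintype.card ι = m + 1) (i j : ℕ) :
    pvG X (i + 1) (j + 1) + pvW X (i + j + 2) =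
      m • (pvW X (i + 1) * star (pvW X (j + 1))) := by
  have h := pvZ_sum X m hm (i + 1)
  simp only [pvκ] at h
  rw [← smul_mul_assoc, ← h, Finset.sum_mul, show i + j + 2 = i + 1 + j + 1 by ring,
    ← pvF_eq X hX, pvF, pvG, ← Finset.sum_add_distrib]
  apply Finset.sum_congr rfl
  intro c _
  rw [pvW_eq X j c]
  simp [hX, mul_add, mul_assoc]

lemma pvB_zero_left (hX : ∀ c, star (X c) = X c) (m j : ℕ) : pvB X m 0 j = pvW X j := by
  rw [pvB, pvW_star X hX]
  simp [pvC', pvW]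

lemma pvB_zero_right (m i : ℕ) : pvB X m i 0 = pvW X i := by
  cases i <;> simp [pvB, pvC', pvW]

lemma pvB_succ (hX : ∀ c, star (X c) = X c) (m i j : ℕ) :
    pvB X m (i + 1) (j + 1) = pvW X (i + j + 2) + pvG X i j + m • pvC' X m i j := by
  rw [← pvWT X hX, pvB, pvC', pvC_eq]
  abel

lemma pvB_one_left (hX : ∀ c, star (X c) = X c) (m : ℕ) (hm : Fintype.card ι = m + 1) (j : ℕ) :
    pvB X m 1 (j + 1) = pvW X (j + 2) + pvκ m j • pvW X j := by
  have : pvG X 0 j = pvκ m j • pvW X j := by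
    rw [← pvW_star X hX j]
    rw [← star_nsmul, ← pvZ_sum X m hm, pvG, star_sum]
    simp [pvZ]
  have h := pvB_succ X hX m 0 j
  rw [h, this]
  simp [pvC']

lemma pvB_one_right (hX : ∀ c, star (X c) = X c) (m : ℕ) (hm : Fintype.card ι = m + 1) (j : ℕ) :
    pvB X m (j + 1) 1 = pvW X (j + 2) + pvκ m j • pvW X j := by
  have : pvG X j 0 = pvκ m j • pvW X j := by
    rw [← pvZ_sum X m hm, pvG]
    simp [pvZ]
  have h := pvB_succ X hX m j 0
  rw [h, this]
  cases j <;> simp [pvC']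

lemma pvB_succ_succ (hX : ∀ c, star (X c) = X c) (m : ℕ) (hm : Fintype.card ι = m + 1)
    (i j : ℕ) :
    pvB X m (i + 2) (j + 2) =
      pvW X (i + j + 4) - pvW X (i + j + 2) + m • pvB X m (i + 1) (j + 1) := by
  have h := pvB_succ X hX m (i + 1) (j + 1)
  have h2 := pvG_succ X hX m hm i j
  rw [show i + 1 + 1 = i + 2 by ring, show j + 1 + 1 = j + 2 by ring] at h
  rw [h, eq_sub_of_add_eq h2, show i + 1 + (j + 1) + 2 = i + j + 4 by ring]
  conv_rhs => rw [pvB]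
  rw [smul_add]
  abel

lemma pvB_symm (hX : ∀ c, star (X c) = X c) (m : ℕ) (hm : Fintype.card ι = m + 1)
    (i j : ℕ) : pvB X m i j = pvB X m j i := by
  induction i generalizing j with
  | zero => rw [pvB_zero_left X hX, pvB_zero_right]
  | succ i ih =>
    cases j with
    | zero => rw [pvB_zero_left X hX, pvB_zero_right]
    | succ j =>
      cases i with
      | zero => rw [zero_add, pvB_one_left X hX m hm, pvB_one_right X hX m hm]
      | succ i =>
        cases j with
        | zero => rw [zero_add, pvB_one_left X hX m hm, pvB_one_right X hX m hm]
        | succ j =>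
          rw [pvB_succ_succ X hX m hm, pvB_succ_succ X hX m hm, ih, add_comm i j]

lemma pvB_shift_zero (hX : ∀ c, star (X c) = X c) (m : ℕ) (hm : Fintype.card ι = m + 1)
    (j : ℕ) : pvB X m 1 (j + 1) = pvB X m 0 (j + 2) + pvκ m j • pvB X m 0 j := by
  rw [pvB_one_left X hX m hm, pvB_zero_left X hX, pvB_zero_left X hX]

lemma pvB_shift (hX : ∀ c, star (X c) = X c) (m : ℕ) (hm : Fintype.card ι = m + 1)
    (i j : ℕ) : pvB X m (i + 2) (j + 1) + pvκ m i • pvB X m i (j + 1) =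
      pvB X m (i + 1) (j + 2) + pvκ m j • pvB X m (i + 1) j := by
  have key : ∀ b : ℕ, pvB X m 2 (b + 2) + (m + 1) • pvB X m 0 (b + 2) =
      pvB X m 1 (b + 3) + m • pvB X m 1 (b + 1) := by
    intro b
    have h := pvB_succ_succ X hX m hm 0 b
    simp only [zero_add] at h
    rw [h, pvB_zero_left X hX, pvB_one_left X hX m hm (b + 2)]
    simp only [pvκ, add_smul, one_smul]
    abel
  cases i with
  | zero =>
    cases j with
    | zero =>
      simp only [zero_add, pvκ]
      rw [pvB_symm X hX m hm 2 1, pvB_symm X hX m hm 0 1]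
    | succ b => simpa [pvκ] using key b
  | succ a =>
    cases j with
    | zero =>
      have h := key a
      simp only [zero_add, pvκ]
      rw [pvB_symm X hX m hm _ 1, pvB_symm X hX m hm _ 1, pvB_symm X hX m hm _ 2,
        pvB_symm X hX m hm _ 0]
      exact h.symm
    | succ b =>
      simp only [pvκ]
      have h1 := pvB_succ_succ X hX m hm (a + 1) b
      have h2 := pvB_succ_succ X hX m hm a (b + 1)
      rw [show a + 1 + 2 = a + 3 by ring, show a + 1 + 1 = a + 2 by ring,
        show a + 1 + b = a + b + 1 by ring] at h1
      rw [show b + 1 + 2 = b + 3 by ring, show b + 1 + 1 = b + 2 by ring,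
        show a + (b + 1) = a + b + 1 by ring] at h2
      rw [show a + 1 + 2 = a + 3 by ring, show a + 1 + 1 = a + 2 by ring,
        show b + 1 + 2 = b + 3 by ring, show b + 1 + 1 = b + 2 by ring, h1, h2]
      abel

end PavingKernel

section PavingForm

/-- bilinear extension of a kernel -/
noncomputable def pvBil {N : Type*} [AddCommGroup N] [Module ℝ N] (k : ℕ → ℕ → N) :
    (ℕ →₀ ℝ) →ₗ[ℝ] (ℕ →₀ ℝ) →ₗ[ℝ] N :=
  Finsupp.linearCombination ℝ (fun i => Finsupp.linearCombination ℝ (k i))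

lemma pvBil_single {N : Type*} [AddCommGroup N] [Module ℝ N] (k : ℕ → ℕ → N) (i j : ℕ) :
    pvBil k (Finsupp.single i 1) (Finsupp.single j 1) = k i j := by
  simp [pvBil]

lemma pvBil_ext {N : Type*} [AddCommGroup N] [Module ℝ N]
    (f g : (ℕ →₀ ℝ) →ₗ[ℝ] (ℕ →₀ ℝ) →ₗ[ℝ] N)
    (h : ∀ i j, f (Finsupp.single i 1) (Finsupp.single j 1) =
      g (Finsupp.single i 1) (Finsupp.single j 1)) : f = g := by
  ext i j
  simpa using h i j

/-- left shift -/
noncomputable def pvS : (ℕ →₀ ℝ) →ₗ[ℝ] (ℕ →₀ ℝ) :=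
  Finsupp.linearCombination ℝ (fun i => match i with
    | 0 => 0
    | i + 1 => Finsupp.single i (1 : ℝ))

lemma pvS_apply (a : ℕ →₀ ℝ) (k : ℕ) : pvS a k = a (k + 1) := by
  induction a using Finsupp.induction_linear with
  | zero => simp
  | add f g hf hg => simp [hf, hg]
  | single i r => cases i <;> simp [pvS, Finsupp.single_apply]

/-- Jacobi operator -/
noncomputable def pvJ (m : ℕ) : (ℕ →₀ ℝ) →ₗ[ℝ] (ℕ →₀ ℝ) :=
  Finsupp.linearCombination ℝ (fun i => match i with
    | 0 => Finsupp.single 1 (1 : ℝ)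
    | i + 1 => Finsupp.single (i + 2) (1 : ℝ) + (pvκ m i : ℝ) • Finsupp.single i (1 : ℝ))

lemma pvJ_zero (m : ℕ) : pvJ m (Finsupp.single 0 1) = Finsupp.single 1 1 := by simp [pvJ]

lemma pvJ_succ (m i : ℕ) : pvJ m (Finsupp.single (i + 1) 1) =
    Finsupp.single (i + 2) (1 : ℝ) + (pvκ m i : ℝ) • Finsupp.single i (1 : ℝ) := by
  simp [pvJ]

variable {N : Type*} [Ring N] [StarRing N] [Algebra ℝ N] [StarModule ℝ N]
  {ι : Type*} [Fintype ι] [DecidableEq ι]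

lemma pvB_J (X : ι → N) (hX : ∀ c, star (X c) = X c) (m : ℕ) (hm : Fintype.card ι = m + 1)
    (a b : ℕ →₀ ℝ) :
    pvBil (pvB X m) (pvJ m a) b = pvBil (pvB X m) a (pvJ m b) := by
  have h : (pvBil (pvB X m)).comp (pvJ m) = (pvBil (pvB X m)).compl₂ (pvJ m) := by
    apply pvBil_ext
    intro i j
    simp only [LinearMap.comp_apply, LinearMap.compl₂_apply]
    cases i with
    | zero =>
      cases j with
      | zero =>
        rw [pvJ_zero, pvBil_single, pvBil_single]
        exact pvB_symm X hX m hm 1 0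
      | succ j =>
        rw [pvJ_zero, pvJ_succ, map_add, map_smul, pvBil_single, pvBil_single, pvBil_single,
          Nat.cast_smul_eq_nsmul]
        exact pvB_shift_zero X hX m hm j
    | succ i =>
      cases j with
      | zero =>
        rw [pvJ_zero, pvJ_succ, map_add, map_smul, LinearMap.add_apply, LinearMap.smul_apply,
          pvBil_single, pvBil_single, pvBil_single, Nat.cast_smul_eq_nsmul]
        have := pvB_shift_zero X hX m hm i
        rw [pvB_symm X hX m hm _ 0, pvB_symm X hX m hm i 0, ← this]
        exact pvB_symm X hX m hm _ _
      | succ j =>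
        rw [pvJ_succ, pvJ_succ, map_add, map_add, map_smul, map_smul, LinearMap.add_apply,
          LinearMap.smul_apply]
        simp only [pvBil_single, Nat.cast_smul_eq_nsmul]
        exact pvB_shift X hX m hm i j
  exact LinearMap.congr_fun₂ h a b

lemma pvB_bil_symm (X : ι → N) (hX : ∀ c, star (X c) = X c) (m : ℕ)
    (hm : Fintype.card ι = m + 1) (a b : ℕ →₀ ℝ) :
    pvBil (pvB X m) a b = pvBil (pvB X m) b a := by
  have h : pvBil (pvB X m) = (pvBil (pvB X m)).flip := by
    apply pvBil_ext
    intro i j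
    rw [LinearMap.flip_apply, pvBil_single, pvBil_single]
    exact pvB_symm X hX m hm _ _
  exact LinearMap.congr_fun₂ h a b

variable (N) in
/-- sums of hermitian squares -/
def pvCone : AddSubmonoid N := AddSubmonoid.closure {x | ∃ s, x = s * star s}

/-- the sesquilinear map `f a * d * (g b)^*` -/
noncomputable def pvSq (f : ℕ → N) (d : N) : (ℕ →₀ ℝ) →ₗ[ℝ] (ℕ →₀ ℝ) →ₗ[ℝ] N :=
  LinearMap.mk₂ ℝ (fun a b => Finsupp.linearCombination ℝ f a * d *
      star (Finsupp.linearCombination ℝ f b))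
    (by intros; simp [add_mul]) (by intros; simp)
    (by intros; simp [mul_add]) (by intros; simp [star_smul])

lemma pvSq_apply (f : ℕ → N) (d : N) (a b : ℕ →₀ ℝ) :
    pvSq f d a b = Finsupp.linearCombination ℝ f a * d *
      star (Finsupp.linearCombination ℝ f b) := rfl

lemma pvT_bil (X : ι → N) (a b : ℕ →₀ ℝ) :
    pvBil (pvT X) a b = ∑ c, pvSq (fun i => pvZ X i c) (1 - X c * X c) a b := by
  have h : pvBil (pvT X) = ∑ c, pvSq (fun i => pvZ X i c) (1 - X c * X c) := by
    apply pvBil_ext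
    intro i j
    simp [pvBil_single, LinearMap.sum_apply, pvSq_apply, pvT]
  rw [h]; simp [LinearMap.sum_apply]

lemma pvC_bil (X : ι → N) (m : ℕ) (a b : ℕ →₀ ℝ) :
    pvBil (pvC X m) a b = pvBil (pvT X) a b + m • pvBil (pvC X m) (pvS a) (pvS b) := by
  have h : pvBil (pvC X m) = pvBil (pvT X) +
      m • ((pvBil (pvC X m)).comp pvS).compl₂ pvS := by
    apply pvBil_ext
    intro i j
    simp only [LinearMap.add_apply, LinearMap.smul_apply, LinearMap.compl₂_apply,
      LinearMap.comp_apply, pvBil_single]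
    cases i with
    | zero => simp [pvS, pvC]
    | succ i =>
      cases j with
      | zero => simp [pvS, pvC]
      | succ j => simp [pvS, pvC, pvBil]
  conv_lhs => rw [h]
  simp

lemma pvB_bil (X : ι → N) (m : ℕ) (a b : ℕ →₀ ℝ) :
    pvBil (pvB X m) a b = pvSq (pvW X) 1 a b + pvBil (pvC X m) (pvS a) (pvS b) := by
  have h : pvBil (pvB X m) = pvSq (pvW X) 1 +
      ((pvBil (pvC X m)).comp pvS).compl₂ pvS := by
    apply pvBil_ext
    intro i j
    simp only [LinearMap.add_apply, LinearMap.compl₂_apply,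
      LinearMap.comp_apply, pvBil_single, pvSq_apply]
    cases i with
    | zero => simp [pvS, pvB, pvC']
    | succ i =>
      cases j with
      | zero => simp [pvS, pvB, pvC']
      | succ j => simp [pvS, pvB, pvC', pvBil]
  rw [h]
  simp

lemma pvC_pos (X S : ι → N) (hS : ∀ c, 1 - X c * X c = S c * star (S c)) (m : ℕ) (k : ℕ) :
    ∀ a : ℕ →₀ ℝ, (∀ i, k ≤ i → a i = 0) → pvBil (pvC X m) a a ∈ pvCone N := by
  induction k with
  | zero =>
    intro a ha
    have : a = 0 := by ext i; exact ha i (Nat.zero_le _)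
    simp [this, zero_mem]
  | succ k ih =>
    intro a ha
    rw [pvC_bil]
    refine add_mem ?_ (nsmul_mem (ih _ ?_) _)
    · rw [pvT_bil]
      refine sum_mem fun c _ => AddSubmonoid.subset_closure ?_
      refine ⟨Finsupp.linearCombination ℝ (fun i => pvZ X i c) a * S c, ?_⟩
      rw [pvSq_apply, hS, star_mul]
      simp only [mul_assoc]
    · intro i hi
      rw [pvS_apply]
      exact ha _ (by omega)

lemma pvB_pos (X S : ι → N) (hS : ∀ c, 1 - X c * X c = S c * star (S c)) (m : ℕ)
    (a : ℕ →₀ ℝ) : pvBil (pvB X m) a a ∈ pvCone N := by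
  rw [pvB_bil]
  refine add_mem (AddSubmonoid.subset_closure ⟨Finsupp.linearCombination ℝ (pvW X) a, ?_⟩) ?_
  · rw [pvSq_apply, mul_one]
  · obtain ⟨k, hk⟩ : ∃ k, ∀ i, k ≤ i → pvS a i = 0 := by
      refine ⟨(pvS a).support.sup id + 1, fun i hi => ?_⟩
      by_contra h
      have := Finset.le_sup (f := id) (Finsupp.mem_support_iff.mpr h)
      simp only [id] at this
      omega
    exact pvC_pos X S hS m k _ hk

lemma pvZ_word (X : ι → N) (τ : N →ₗ[ℝ] ℝ)
    (hred : ∀ l : List ι, l ≠ [] → l.IsChain (· ≠ ·) → τ ((l.map X).prod) = 0) (j : ℕ) :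
    ∀ (c : ι) (l : List ι), (c :: l).IsChain (· ≠ ·) →
      τ (pvZ X j c * ((c :: l).map X).prod) = 0 := by
  induction j with
  | zero =>
    intro c l hl
    rw [pvZ, one_mul]
    exact hred _ (by simp) hl
  | succ j ih =>
    intro c l hl
    rw [pvZ, Finset.sum_mul, map_sum]
    refine Finset.sum_eq_zero fun d _ => ?_
    by_cases h : d = c
    · simp [h]
    · rw [if_neg h, mul_assoc]
      have := ih d (c :: l) (List.isChain_cons_cons.mpr ⟨h, hl⟩)
      rwa [List.map_cons, List.prod_cons] at this

lemma pvW_trace (X : ι → N) (τ : N →ₗ[ℝ] ℝ)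
    (hred : ∀ l : List ι, l ≠ [] → l.IsChain (· ≠ ·) → τ ((l.map X).prod) = 0) (j : ℕ) :
    τ (pvW X (j + 1)) = 0 := by
  rw [pvW, map_sum]
  refine Finset.sum_eq_zero fun d _ => ?_
  have := pvZ_word X τ hred j d [] (by simp)
  simpa using this

/-- weight functional -/
noncomputable def pvw (s : ℝ) : ℕ → ℝ
  | 0 => 1 / 2
  | k + 1 => s ^ (k + 1)

lemma pvJ_bound (m : ℕ) (hm : 1 ≤ m) (k : ℕ) :
    (∀ i, 0 ≤ ((pvJ m)^[k] (Finsupp.single 0 1)) i) ∧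
    Finsupp.linearCombination ℝ (pvw (√m)) ((pvJ m)^[k] (Finsupp.single 0 1)) ≤
      (2 * √m) ^ k * (1 / 2) := by
  induction k with
  | zero => 
    constructor
    · intro i
      simp only [Function.iterate_zero, id, Finsupp.single_apply]
      split_ifs <;> norm_num
    · simp [pvw]
  | succ k ih =>
    obtain ⟨h1, h2⟩ := ih
    rw [Function.iterate_succ_apply']
    set a := (pvJ m)^[k] (Finsupp.single 0 1) with ha
    have hs : √(m : ℝ) ^ 2 = m := Real.sq_sqrt (by positivity)
    have hm' : (1 : ℝ) ≤ m := by exact_mod_cast hm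
    have hsum : a = a.sum fun i r => r • Finsupp.single i (1 : ℝ) := by
      conv_lhs => rw [← Finsupp.sum_single a]
      simp
    have e1 : pvJ m a = ∑ i ∈ a.support, a i • pvJ m (Finsupp.single i 1) := by
      conv_lhs => rw [hsum]
      simp only [Finsupp.sum, map_sum, map_smul]
    have e2 : Finsupp.linearCombination ℝ (pvw (√m)) a = ∑ i ∈ a.support, a i * pvw (√m) i := by
      rw [Finsupp.linearCombination_apply, Finsupp.sum]; rfl
    constructor
    · intro i
      rw [e1, Finsupp.finsetSum_apply]
      refine Finset.sum_nonneg fun j _ => ?_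
      refine mul_nonneg (h1 j) ?_
      cases j with
      | zero => rw [pvJ_zero, Finsupp.single_apply]; split_ifs <;> norm_num
      | succ j =>
        rw [pvJ_succ, Finsupp.add_apply, Finsupp.smul_apply, Finsupp.single_apply,
          Finsupp.single_apply]
        split_ifs <;> simp <;> positivity
    · have : Finsupp.linearCombination ℝ (pvw (√m)) (pvJ m a) ≤
          2 * √m * Finsupp.linearCombination ℝ (pvw (√m)) a := by
        rw [e1, e2, map_sum, Finset.mul_sum]
        refine Finset.sum_le_sum fun j _ => ?_
        rw [map_smul, smul_eq_mul, mul_left_comm]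
        refine mul_le_mul_of_nonneg_left ?_ (h1 j)
        rcases j with _ | _ | j
        · rw [pvJ_zero]; simp [pvw]; linarith
        · rw [pvJ_succ]
          simp [pvw, pvκ]
          nlinarith
        · rw [pvJ_succ]
          simp [pvw, pvκ]
          apply le_of_eq
          calc _ = √(m : ℝ) ^ (j + 3) + √(m : ℝ) ^ 2 * √(m : ℝ) ^ (j + 1) := by rw [hs]
            _ = _ := by ring
      calc _ ≤ _ := this
        _ ≤ 2 * √m * ((2 * √m) ^ k * (1 / 2)) := by gcongr
        _ = _ := by ring

lemma pvJ_bound0 (m : ℕ) (hm : 1 ≤ m) (k : ℕ) :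
    ((pvJ m)^[k] (Finsupp.single 0 1)) 0 ≤ (2 * √m) ^ k := by
  obtain ⟨h1, h2⟩ := pvJ_bound m hm k
  set a := (pvJ m)^[k] (Finsupp.single 0 1) with ha
  have hw : ∀ i, 0 ≤ pvw (√m) i := by
    intro i; cases i <;> simp [pvw]
  have : a 0 * (1 / 2) ≤ Finsupp.linearCombination ℝ (pvw (√m)) a := by
    rw [Finsupp.linearCombination_apply, Finsupp.sum]
    by_cases h : (0 : ℕ) ∈ a.support
    · exact Finset.single_le_sum (f := fun i => a i • pvw (√m) i)
        (fun i _ => mul_nonneg (h1 i) (hw i)) h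
    · rw [Finsupp.notMem_support_iff.mp h, zero_mul]
      exact Finset.sum_nonneg (fun i _ => mul_nonneg (h1 i) (hw i))
  linarith

/-- growth lemma for moment sequences -/
lemma pv_growth (μ : ℕ → ℝ) (r C : ℝ) (hr : 0 < r) (h0 : 0 ≤ μ 0)
    (hcs : ∀ k, μ k ^ 2 ≤ μ 0 * μ (2 * k)) (hb : ∀ k, μ (2 * k) ≤ C * r ^ (2 * k)) :
    μ 1 ≤ r * μ 0 := by
  by_contra! hlt
  rcases h0.eq_or_lt with h0 | h0
  · have := hcs 1
    rw [← h0] at this hlt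
    nlinarith
  set ρ := μ 1 / μ 0 with hρ
  have hρr : r < ρ := by rw [hρ, lt_div_iff₀ h0]; exact hlt
  have hρ0 : 0 < ρ := hr.trans hρr
  have key : ∀ k, ρ ^ (2 ^ k) * μ 0 ≤ μ (2 ^ k) := by
    intro k
    induction k with
    | zero => simp [hρ, h0.ne']
    | succ k ih =>
      have h1 := hcs (2 ^ k)
      rw [← pow_succ'] at h1
      have h2 : (ρ ^ (2 ^ k) * μ 0) ^ 2 ≤ μ 0 * μ (2 ^ (k + 1)) :=
        (pow_le_pow_left₀ (by positivity) ih 2).trans h1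
      have h3 : μ 0 * (ρ ^ (2 ^ (k + 1)) * μ 0) ≤ μ 0 * μ (2 ^ (k + 1)) := by
        calc _ = (ρ ^ (2 ^ k) * μ 0) ^ 2 := by rw [pow_succ 2 k, pow_mul]; ring
          _ ≤ _ := h2
      exact le_of_mul_le_mul_left h3 h0
  have hq : 1 < ρ / r := by rwa [one_lt_div hr]
  obtain ⟨k, hk⟩ := pow_unbounded_of_one_lt (C / μ 0) hq
  have h4 : (ρ / r) ^ k ≤ (ρ / r) ^ (2 ^ (k + 1)) :=
    pow_le_pow_right₀ hq.le (by
      have := (Nat.lt_two_pow_self (n := k + 1)); omega)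
  have hb' : ∀ k, μ (2 ^ (k + 1)) ≤ C * r ^ (2 ^ (k + 1)) := by
    intro k
    rw [pow_succ']
    exact hb (2 ^ k)
  have h5 := (key (k + 1)).trans (hb' k)
  have h6 : (ρ / r) ^ (2 ^ (k + 1)) ≤ C / μ 0 := by
    rw [div_pow, div_le_div_iff₀ (by positivity) h0]
    exact h5
  linarith

/-- Core algebraic estimate. -/
theorem pv_core (X S : ι → N) (hX : ∀ c, star (X c) = X c)
    (hS : ∀ c, 1 - X c * X c = S c * star (S c)) (m : ℕ) (hm1 : 1 ≤ m)
    (hm : Fintype.card ι = m + 1) (τ : N →ₗ[ℝ] ℝ) (hpos : ∀ s, 0 ≤ τ (s * star s))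
    (hred : ∀ l : List ι, l ≠ [] → l.IsChain (· ≠ ·) → τ ((l.map X).prod) = 0)
    (b : N) (K : ℝ) (hK : 0 ≤ K)
    (hb : ∀ s, τ (star b * (s * star s) * b) ≤ K * τ (s * star s)) :
    τ (star b * (∑ c, X c) * b) ≤ 2 * √m * τ (star b * b) := by
  let ψ : N →ₗ[ℝ] ℝ := τ ∘ₗ (LinearMap.mulRight ℝ b) ∘ₗ (LinearMap.mulLeft ℝ (star b))
  have hψ : ∀ y, ψ y = τ (star b * y * b) := fun y => rfl
  have hψpos : ∀ y ∈ pvCone N, 0 ≤ ψ y ∧ ψ y ≤ K * τ y := by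
    intro y hy
    induction hy using AddSubmonoid.closure_induction with
    | mem y hy =>
      obtain ⟨s, rfl⟩ := hy
      refine ⟨?_, hb s⟩
      rw [hψ]
      have := hpos (star b * s)
      simpa [mul_assoc] using this
    | zero => simp
    | add x y _ _ hx hy =>
      rw [map_add, map_add, mul_add]
      exact ⟨add_nonneg hx.1 hy.1, add_le_add hx.2 hy.2⟩
  let B := pvBil (pvB X m)
  have hBJ : ∀ k (a c : ℕ →₀ ℝ), B ((pvJ m)^[k] a) c = B a ((pvJ m)^[k] c) := by
    intro k
    induction k with
    | zero => intros; rfl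
    | succ k ih =>
      intro a c
      rw [Function.iterate_succ_apply, ih, Function.iterate_succ_apply']
      exact pvB_J X hX m hm _ _
  let e : ℕ →₀ ℝ := Finsupp.single 0 1
  let μ : ℕ → ℝ := fun k => ψ (B e ((pvJ m)^[k] e))
  have hμ2 : ∀ k, B ((pvJ m)^[k] e) ((pvJ m)^[k] e) = B e ((pvJ m)^[2 * k] e) := by
    intro k
    rw [hBJ, ← Function.iterate_add_apply, two_mul]
  have hBe : ∀ a, τ (B e a) = a 0 * τ 1 := by
    intro a
    induction a using Finsupp.induction_linear with
    | zero => simp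
    | add f g hf hg => rw [map_add, map_add, hf, hg, Finsupp.add_apply, add_mul]
    | single i r =>
      have h1 : (Finsupp.single i r : ℕ →₀ ℝ) = r • Finsupp.single i 1 := by simp
      rw [h1, map_smul, map_smul, pvBil_single, pvB_zero_left X hX]
      cases i with
      | zero => simp [pvW]
      | succ i => rw [pvW_trace X τ hred]; simp
  have hτ1 : 0 ≤ τ 1 := by simpa using hpos 1
  have hm0 : (0 : ℝ) < m := by exact_mod_cast hm1
  have main := pv_growth μ (2 * √m) (K * τ 1) (by positivity)
    (by
      have h := (hψpos _ (pvB_pos X S hS m e)).1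
      exact h)
    (by
      intro k
      -- discriminant argument
      have hq : ∀ t : ℝ, 0 ≤ μ 0 * (t * t) + (2 * μ k) * t + μ (2 * k) := by
        intro t
        have h := (hψpos _ (pvB_pos X S hS m (t • e + (pvJ m)^[k] e))).1
        have h2 : ψ (B (t • e + (pvJ m)^[k] e) (t • e + (pvJ m)^[k] e)) =
            μ 0 * (t * t) + (2 * μ k) * t + μ (2 * k) := by
          have h3 : B ((pvJ m)^[k] e) e = B e ((pvJ m)^[k] e) := hBJ k e e
          simp only [map_add, map_smul, LinearMap.add_apply, LinearMap.smul_apply, hμ2, h3,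
            smul_eq_mul]
          simp only [μ, Function.iterate_zero, id]
          ring
        rw [← h2]; exact h
      have := discrim_le_zero hq
      rw [discrim] at this
      nlinarith)
    (by
      intro k
      have h := (hψpos _ (pvB_pos X S hS m ((pvJ m)^[k] e))).2
      change ψ (B ((pvJ m)^[k] e) ((pvJ m)^[k] e)) ≤ K * τ (B ((pvJ m)^[k] e) ((pvJ m)^[k] e)) at h
      rw [hμ2, hBe] at h
      have h2 := pvJ_bound0 m hm1 (2 * k)
      calc μ (2 * k) ≤ _ := h
        _ ≤ K * ((2 * √m) ^ (2 * k) * τ 1) := by gcongr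
        _ = _ := by ring)
  have hμ0 : μ 0 = τ (star b * b) := by
    simp only [μ, Function.iterate_zero, id]
    change ψ (pvBil (pvB X m) (Finsupp.single 0 1) (Finsupp.single 0 1)) = _
    rw [pvBil_single, pvB_zero_right, hψ]; simp [pvW]
  have hμ1 : μ 1 = τ (star b * (∑ c, X c) * b) := by
    change ψ (pvBil (pvB X m) (Finsupp.single 0 1) (pvJ m (Finsupp.single 0 1))) = _
    rw [pvJ_zero, pvBil_single, pvB_zero_left X hX, hψ]; simp [pvW, pvZ]
  rw [hμ0, hμ1] at main
  exact main

end PavingForm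

section PavingWords

variable {A : Type*} [Ring A] [StarRing A] [Algebra ℂ A]

/-- alternating words along a list -/
def pvAlt {ι : Type*} (x : ι → A) : Bool → List ι → A
  | _, [] => 1
  | true, c :: l => x c * pvAlt x false l
  | false, c :: l => star (x c) * pvAlt x true l

lemma pvAlt_LWord {n : ℕ} (x : Fin n → A) (m : ℕ) : ∀ i : Fin m → Fin n,
    LWord x i = pvAlt x true (List.ofFn i) ∧ LWordStar x i = pvAlt x false (List.ofFn i) := by
  induction m with
  | zero => intro i; simp [LWord, LWordStar, pvAlt]
  | succ m ih =>
    intro i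
    obtain ⟨h1, h2⟩ := ih (fun s => i s.succ)
    have hp : ∀ s : ℕ, ((s + 1) % 2 = 0) ↔ ¬ (s % 2 = 0) := by intro s; omega
    simp only [List.ofFn_succ, pvAlt, ← h1, ← h2]
    simp only [LWord, LWordStar, List.ofFn_succ, List.prod_cons, Fin.val_zero, Fin.val_succ, hp,
      ite_not, Nat.zero_mod, if_true, and_self]

lemma pvAlt_LFree {n : ℕ} (τ : A → ℂ) (x : Fin n → A) (hL : IsLFree τ x) (l : List (Fin n))
    (hl : l ≠ []) (hc : l.IsChain (· ≠ ·)) (he : Even l.length) (e : Bool) :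
    τ (pvAlt x e l) = 0 := by
  obtain ⟨k, hk⟩ := he
  have hk' : 2 * k = l.length := by omega
  have hk1 : 1 ≤ k := by
    have := List.length_pos_of_ne_nil hl
    omega
  let i : Fin (2 * k) → Fin n := fun s => l.get (s.cast hk')
  have hi : List.ofFn i = l := by
    apply List.ext_getElem
    · simp [hk']
    · intro a h1 h2; simp [i]
  have h := hL k hk1 i (by
    intro s t hst
    have := List.isChain_iff_getElem.mp hc s (by have := t.2; omega)
    simpa [i, hst] using this)
  obtain ⟨a1, a2⟩ := pvAlt_LWord x _ i
  rw [hi] at a1 a2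
  rw [a1, a2] at h
  cases e
  · exact h.2
  · exact h.1

lemma pvAlt_matrix {ι : Type*} (x : ι → A) (l : List ι) :
    (l.map (fun c => (!![0, x c; star (x c), 0] : Matrix (Fin 2) (Fin 2) A))).prod =
      if Even l.length then !![pvAlt x true l, 0; 0, pvAlt x false l]
      else !![0, pvAlt x true l; pvAlt x false l, 0] := by
  induction l with
  | nil => simp [pvAlt, Matrix.one_fin_two]
  | cons c l ih =>
    rw [List.map_cons, List.prod_cons, ih, List.length_cons]
    by_cases h : Even l.length
    · rw [if_pos h, if_neg (by rw [Nat.even_add_one]; simpa using h)]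
      simp [pvAlt, Matrix.mul_fin_two]
    · rw [if_neg h, if_pos (by rw [Nat.even_add_one]; simpa using h)]
      simp [pvAlt, Matrix.mul_fin_two]

/-- real part of a tracial state -/
noncomputable def pvRe (τ : A → ℂ) (hτ : IsTracialState τ) : A →ₗ[ℝ] ℝ where
  toFun a := (τ a).re
  map_add' a b := by
    have := hτ.1 1 a b
    simp only [one_smul, one_mul] at this
    rw [this, Complex.add_re]
  map_smul' r a := by
    have h0 : τ 0 = 0 := by
      have := hτ.1 1 0 0
      simpa using this
    have := hτ.1 (r : ℂ) a 0
    rw [add_zero, h0, add_zero] at this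
    have e : ((r : ℂ) • a) = r • a := Complex.coe_smul r a
    rw [e] at this
    rw [this]; simp

lemma pvRe_apply (τ : A → ℂ) (hτ : IsTracialState τ) (a : A) : pvRe τ hτ a = (τ a).re := rfl

lemma pvRe_comm (τ : A → ℂ) (hτ : IsTracialState τ) (a b : A) :
    pvRe τ hτ (a * b) = pvRe τ hτ (b * a) := by
  rw [pvRe_apply, hτ.2.2.2, pvRe_apply]

lemma pvRe_nonneg (τ : A → ℂ) (hτ : IsTracialState τ) (a : A) :
    0 ≤ pvRe τ hτ (star a * a) := by
  have := hτ.2.2.1 a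
  exact (Complex.le_def.mp this).1

lemma pvRe_nonneg' (τ : A → ℂ) (hτ : IsTracialState τ) (a : A) :
    0 ≤ pvRe τ hτ (a * star a) := by
  rw [pvRe_comm]; exact pvRe_nonneg τ hτ a

lemma pvRe_faithful (τ : A → ℂ) (hτ : IsTracialState τ) (hf : IsFaithful τ) (a : A)
    (h : pvRe τ hτ (star a * a) ≤ 0) : a = 0 := by
  apply hf
  have h1 := Complex.le_def.mp (hτ.2.2.1 a)
  apply Complex.ext
  · exact le_antisymm h h1.1
  · exact h1.2.symm

lemma pvRe_star [StarModule ℂ A] (τ : A → ℂ) (hτ : IsTracialState τ) (a : A) :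
    pvRe τ hτ (star a) = pvRe τ hτ a := by
  have h := (Complex.le_def.mp (hτ.2.2.1 (1 + Complex.I • a))).2
  have h1 := (Complex.le_def.mp (hτ.2.2.1 a)).2
  have e : star (1 + Complex.I • a) * (1 + Complex.I • a) =
      Complex.I • a + ((-Complex.I) • star a + ((1 : ℂ) • 1 + star a * a)) := by
    simp only [star_add, star_one, star_smul, Complex.star_def, Complex.conj_I, one_smul,
      add_mul, mul_add, one_mul, mul_one, smul_mul_assoc, mul_smul_comm]
    have hI : Complex.I • (-Complex.I) • (star a * a) = star a * a := by
      rw [smul_smul]; simp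
    rw [smul_add, hI]
    abel
  rw [e, hτ.1, hτ.1, hτ.1, hτ.2.1] at h
  simp at h h1
  rw [pvRe_apply, pvRe_apply]
  linarith

end PavingWords

section PavingCStar

variable {M : Type*} [CStarAlgebra M] [PartialOrder M] [StarOrderedRing M]

lemma pv_sqrt (a : M) (ha : 0 ≤ a) : ∃ s : M, a = s * star s := by
  obtain ⟨s, hs⟩ := CStarAlgebra.nonneg_iff_eq_mul_star_self.mp ha
  exact ⟨s, hs⟩

lemma pv_one_sub (x : M) (hx : ‖x‖ ≤ 1) : ∃ s : M, 1 - x * star x = s * star s := by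
  apply pv_sqrt
  rw [sub_nonneg]
  have h1 : ‖x * star x‖ ≤ 1 := by
    rw [CStarRing.norm_self_mul_star]; nlinarith [norm_nonneg x]
  exact (CStarAlgebra.norm_le_one_iff_of_nonneg _ (mul_star_self_nonneg x)).mp h1

lemma pvRe_bound (τ : M → ℂ) (hτ : IsTracialState τ) (b s : M) :
    pvRe τ hτ (star b * s * star (star b * s)) ≤ ‖b‖ ^ 2 * pvRe τ hτ (s * star s) := by
  have h1 : 0 ≤ algebraMap ℝ M (‖b‖ ^ 2) - b * star b := by
    rw [sub_nonneg]
    have := IsSelfAdjoint.le_algebraMap_norm_self (a := b * star b) (.mul_star_self b)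
    rwa [CStarRing.norm_self_mul_star, ← sq] at this
  obtain ⟨d, hd⟩ := pv_sqrt _ h1
  have h2 := pvRe_nonneg τ hτ (star d * s)
  have h3 : star (star d * s) * (star d * s) = (‖b‖ ^ 2) • (star s * s) - star s * (b * star b) * s := by
    calc _ = star s * (d * star d) * s := by simp [mul_assoc]
      _ = _ := by rw [← hd, mul_sub, sub_mul, Algebra.algebraMap_eq_smul_one]; simp
  rw [h3, map_sub, map_smul, smul_eq_mul, pvRe_comm τ hτ (star s) s] at h2
  have h4 : pvRe τ hτ (star b * s * star (star b * s)) = pvRe τ hτ (star s * (b * star b) * s) := by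
    rw [pvRe_comm]; simp [mul_assoc]
  linarith

lemma pvRe_add_bound (τ : M → ℂ) (hτ : IsTracialState τ) (p q : M) :
    pvRe τ hτ ((p + q) * star (p + q)) ≤
      2 * pvRe τ hτ (p * star p) + 2 * pvRe τ hτ (q * star q) := by
  have h := pvRe_nonneg' τ hτ (p - q)
  have e : (p + q) * star (p + q) + (p - q) * star (p - q) =
      (2 : ℝ) • (p * star p) + (2 : ℝ) • (q * star q) := by
    simp only [star_add, star_sub, two_smul]
    noncomm_ring
  have := congrArg (pvRe τ hτ) e
  simp only [map_add, map_smul, smul_eq_mul] at this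
  linarith

lemma pv_norm_le (τ : M → ℂ) (hτ : IsTracialState τ) (hf : IsFaithful τ) (y : M) (r : ℝ)
    (hr : 0 ≤ r) (h : ∀ b, pvRe τ hτ (star b * (star y * y) * b) ≤ r ^ 2 * pvRe τ hτ (star b * b)) :
    ‖y‖ ≤ r := by
  set d : M := star y * y - algebraMap ℝ M (r ^ 2) with hd
  have hdsa : IsSelfAdjoint d := (IsSelfAdjoint.star_mul_self y).sub
    (IsSelfAdjoint.algebraMap M (.all _))
  have hf0 : 0 ≤ d⁺ := CFC.posPart_nonneg d
  have hdec := CFC.posPart_sub_negPart d hdsa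
  have hmul := CFC.posPart_mul_negPart d
  obtain ⟨g, hg⟩ := pv_sqrt _ hf0
  have hfsa : star (d⁺) = d⁺ := (IsSelfAdjoint.of_nonneg hf0).star_eq
  have h1 := h (d⁺)
  have h2 : star (d⁺) * d * d⁺ = star (star g * d⁺) * (star g * d⁺) := by
    calc star (d⁺) * d * d⁺ = d⁺ * (d⁺ - d⁻) * d⁺ := by rw [hdec, hfsa]
      _ = d⁺ * d⁺ * d⁺ := by rw [mul_sub, hmul, sub_zero]
      _ = d⁺ * (g * star g) * d⁺ := by rw [← hg]
      _ = _ := by simp [hfsa, mul_assoc]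
  have h3 : pvRe τ hτ (star (d⁺) * d * d⁺) ≤ 0 := by
    rw [hd, mul_sub, sub_mul, map_sub, ← hd, Algebra.algebraMap_eq_smul_one]
    simp only [mul_smul_comm, mul_one, smul_mul_assoc, map_smul, smul_eq_mul]
    linarith
  rw [h2] at h3
  have h4 := pvRe_faithful τ hτ hf _ h3
  have h5 : d⁺ = 0 := by
    have : star (d⁺) * d⁺ = 0 := by
      rw [hfsa]; nth_rewrite 1 [hg]; rw [mul_assoc, h4, mul_zero]
    exact (CStarRing.star_mul_self_eq_zero_iff _).mp this
  have h6 : d ≤ 0 := by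
    rw [← hdec, h5, zero_sub, neg_nonpos]; exact CFC.negPart_nonneg d
  have h7 : star y * y ≤ algebraMap ℝ M (r ^ 2) := by rwa [hd, sub_nonpos] at h6
  have h8 : ‖star y * y‖ ≤ r ^ 2 :=
    (CStarAlgebra.norm_le_iff_le_algebraMap _ (by positivity) (star_mul_self_nonneg y)).mpr h7
  rw [CStarRing.norm_star_mul_self, ← sq] at h8
  exact le_of_sq_le_sq h8 hr

theorem pv_LFree_norm (τ : M → ℂ) (hτ : IsTracialState τ) (hf : IsFaithful τ) (m : ℕ)
    (hm : 1 ≤ m) (x : Fin (m + 1) → M) (hx : ∀ i, ‖x i‖ ≤ 1) (hL : IsLFree τ x) :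
    ‖∑ i, x i‖ ≤ 2 * √m := by
  set y := ∑ i, x i with hy
  choose s hs using fun i => pv_one_sub (x i) (hx i)
  choose t ht using fun i => pv_one_sub (star (x i)) (by rw [norm_star]; exact hx i)
  let t0 := pvRe τ hτ
  let X : Fin (m + 1) → Matrix (Fin 2) (Fin 2) M := fun c => !![0, x c; star (x c), 0]
  let S : Fin (m + 1) → Matrix (Fin 2) (Fin 2) M := fun c => !![s c, 0; 0, t c]
  let T : Matrix (Fin 2) (Fin 2) M →ₗ[ℝ] ℝ :=
    { toFun := fun a => t0 (a 0 0) + t0 (a 1 1)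
      map_add' := by intro a b; simp; ring
      map_smul' := by intro r a; simp; ring }
  have hT : ∀ a, T a = t0 (a 0 0) + t0 (a 1 1) := fun _ => rfl
  have hX : ∀ c, star (X c) = X c := by
    intro c
    ext i j
    fin_cases i <;> fin_cases j <;> simp [X, Matrix.star_apply]
  have hS : ∀ c, 1 - X c * X c = S c * star (S c) := by
    intro c
    have h1 := hs c
    have h2 := ht c
    rw [star_star] at h2
    ext i j
    fin_cases i <;> fin_cases j <;>
      simp [X, S, Matrix.mul_apply, Fin.sum_univ_two, Matrix.star_apply, ← h1, ← h2]
  have hpos : ∀ a, 0 ≤ T (a * star a) := by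
    intro a
    rw [hT]
    simp only [Matrix.mul_apply, Fin.sum_univ_two, Matrix.star_apply, map_add]
    have := fun i j => pvRe_nonneg' τ hτ (a i j)
    linarith [this 0 0, this 0 1, this 1 0, this 1 1]
  have hred : ∀ l : List (Fin (m + 1)), l ≠ [] → l.IsChain (· ≠ ·) →
      T ((l.map X).prod) = 0 := by
    intro l hl hc
    rw [pvAlt_matrix, hT]
    by_cases he : Even l.length
    · rw [if_pos he]
      simp [t0, pvRe_apply, pvAlt_LFree τ x hL l hl hc he]
    · rw [if_neg he]
      simp
  have hsumX : ∑ c, X c = !![0, y; star y, 0] := by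
    ext i j
    rw [Matrix.sum_apply]
    fin_cases i <;> fin_cases j <;> simp [X, hy]
  have hm0 : (0 : ℝ) < m := by exact_mod_cast hm
  have main : ∀ b1 b2 : M, 2 * t0 (star b1 * y * b2) ≤
      2 * √m * (t0 (star b1 * b1) + t0 (star b2 * b2)) := by
    intro b1 b2
    have h := pv_core X S hX hS m hm (by simp) T hpos hred !![b1, 0; b2, 0]
      (2 * (‖b1‖ ^ 2 + ‖b2‖ ^ 2)) (by positivity) (by
        intro a
        have e1 : star !![b1, 0; b2, 0] * (a * star a) * !![b1, 0; b2, 0] =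
          (star !![b1, 0; b2, 0] * a) * star (star !![b1, 0; b2, 0] * a) := by
          simp [mul_assoc]
        have e2 : ∀ j, (star !![b1, 0; b2, 0] * a) 0 j = star b1 * a 0 j + star b2 * a 1 j := by
          intro j; simp [Matrix.mul_apply, Fin.sum_univ_two, Matrix.star_apply]
        have e3 : ∀ j, (star !![b1, 0; b2, 0] * a) 1 j = 0 := by
          intro j; simp [Matrix.mul_apply, Fin.sum_univ_two, Matrix.star_apply]
        rw [e1, hT, hT, Matrix.mul_apply, Matrix.mul_apply, Matrix.mul_apply, Matrix.mul_apply]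
        simp only [Fin.sum_univ_two, Matrix.star_apply, map_add, e2, e3, zero_mul, map_zero,
          add_zero]
        have k1 := fun j => pvRe_add_bound τ hτ (star b1 * a 0 j) (star b2 * a 1 j)
        have k2 := fun j => pvRe_bound τ hτ b1 (a 0 j)
        have k3 := fun j => pvRe_bound τ hτ b2 (a 1 j)
        have k4 := fun i j => pvRe_nonneg' τ hτ (a i j)
        have k5 := fun i j => mul_nonneg (sq_nonneg ‖b1‖) (k4 i j)
        have k6 := fun i j => mul_nonneg (sq_nonneg ‖b2‖) (k4 i j)
        have k10 := k1 0
        have k11 := k1 1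
        simp only [t0] at *
        linarith [k2 0, k2 1, k3 0, k3 1, k5 1 0, k5 1 1, k6 0 0, k6 0 1])
    rw [hsumX, hT, hT] at h
    simp only [Matrix.mul_apply, Fin.sum_univ_two, Matrix.star_apply] at h
    simp at h
    have e : t0 (star b2 * star y * b1) = t0 (star b1 * y * b2) := by
      rw [← pvRe_star τ hτ (star b1 * y * b2)]; simp [t0, mul_assoc]
    linarith
  apply pv_norm_le τ hτ hf y _ (by positivity)
  intro b
  set r := 2 * √(m : ℝ) with hr
  have hr0 : 0 < r := by positivity
  have h := main (y * b) (r • b)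
  have e1 : star (y * b) * y * (r • b) = r • (star b * (star y * y) * b) := by
    simp [mul_assoc]
  have e2 : star (y * b) * (y * b) = star b * (star y * y) * b := by simp [mul_assoc]
  have e3 : star (r • b) * (r • b) = r ^ 2 • (star b * b) := by
    simp [star_smul, smul_smul, sq]
  rw [e1, e2, e3, map_smul, map_smul, smul_eq_mul, smul_eq_mul] at h
  have h2 : r * t0 (star b * (star y * y) * b) ≤ r * (r ^ 2 * t0 (star b * b)) := by linarith
  exact le_of_mul_le_mul_left h2 hr0

end PavingCStar

section PavingFourier

variable {M : Type*} [Ring M] [Algebra ℂ M] {n : ℕ}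

lemma pv_pow (p : Fin n → M) (hid : ∀ j, p j * p j = p j)
    (horth : ∀ i j : Fin n, i ≠ j → p i * p j = 0) (hsum : ∑ j, p j = 1) (c : Fin n → ℂ) (k : ℕ) :
    (∑ j, c j • p j) ^ k = ∑ j, c j ^ k • p j := by
  induction k with
  | zero => simp [hsum]
  | succ k ih =>
    rw [pow_succ, ih, Finset.sum_mul]
    refine Finset.sum_congr rfl fun i _ => ?_
    rw [Finset.mul_sum, Finset.sum_eq_single i]
    · rw [smul_mul_smul_comm, hid, pow_succ]
    · intro j _ hj
      rw [smul_mul_smul_comm, horth i j hj.symm, smul_zero]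
    · simp

lemma pv_fourier (hn : n ≠ 0) (p : Fin n → M) (x : M) (z w : ℂ) (hz : IsPrimitiveRoot z n)
    (hw : z * w = 1) :
    ∑ i : Fin n, (∑ j : Fin n, ((z ^ (j : ℕ)) ^ (i : ℕ)) • p j) * x *
      (∑ j : Fin n, ((w ^ (j : ℕ)) ^ (i : ℕ)) • p j) = (n : ℂ) • ∑ j, p j * x * p j := by
  have hz0 : z ≠ 0 := hz.ne_zero hn
  have hwz : w = z⁻¹ := by rw [eq_comm]; exact inv_eq_of_mul_eq_one_right hw
  have key : ∀ j k : Fin n, ∑ i : Fin n, ((z ^ (j : ℕ) * w ^ (k : ℕ)) ^ (i : ℕ)) =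
      if j = k then (n : ℂ) else 0 := by
    intro j k
    split_ifs with h
    · subst h
      rw [← mul_pow, hw]; simp
    · rw [Fin.sum_univ_eq_sum_range (fun i => (z ^ (j : ℕ) * w ^ (k : ℕ)) ^ i) n]
      have h1 : (z ^ (j : ℕ) * w ^ (k : ℕ)) ≠ 1 := by
        intro h1
        apply h
        have h2 : z ^ (j : ℕ) = z ^ (k : ℕ) := by
          rw [hwz, inv_pow] at h1
          exact (mul_inv_eq_one₀ (pow_ne_zero _ hz0)).mp h1
        exact Fin.ext (hz.pow_inj j.2 k.2 h2)
      have h3 : (z ^ (j : ℕ) * w ^ (k : ℕ)) ^ n = 1 := by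
        rw [mul_pow, ← pow_mul, ← pow_mul, mul_comm, mul_comm (k : ℕ), mul_comm (j : ℕ), pow_mul,
          pow_mul, hz.pow_eq_one, hwz, inv_pow, hz.pow_eq_one]
        simp
      rw [geom_sum_eq h1, h3]; simp
  have e : ∀ i : Fin n, (∑ j : Fin n, ((z ^ (j : ℕ)) ^ (i : ℕ)) • p j) * x *
      (∑ j : Fin n, ((w ^ (j : ℕ)) ^ (i : ℕ)) • p j) =
      ∑ j : Fin n, ∑ k : Fin n, ((z ^ (j : ℕ) * w ^ (k : ℕ)) ^ (i : ℕ)) • (p j * x * p k) := by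
    intro i
    rw [Finset.sum_mul, Finset.sum_mul]
    refine Finset.sum_congr rfl fun j _ => ?_
    rw [Finset.mul_sum]
    refine Finset.sum_congr rfl fun k _ => ?_
    rw [smul_mul_assoc, smul_mul_smul_comm, mul_pow]
  simp only [e]
  rw [Finset.sum_comm, Finset.smul_sum]
  refine Finset.sum_congr rfl fun j _ => ?_
  rw [Finset.sum_comm]
  simp only [← Finset.sum_smul, key]
  simp

end PavingFourier


/-- Optimal paving estimate from L-freeness of the conjugates
`u^{i-1} x u^{-(i-1)}`, where `u = Σ_j λ^{j-1} p_j`, `λ = exp(2πi/n)`. -/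
theorem optimal_paving_of_LFree_conjugates
    {M : Type*} [NormedRing M] [StarRing M] [CStarRing M] [NormedAlgebra ℂ M]
    [StarModule ℂ M] [CompleteSpace M]
    (τ : M → ℂ) (hτ : IsTracialState τ) (hτf : IsFaithful τ)
    (n : ℕ) (hn : 2 ≤ n)
    (p : Fin n → M) (hproj : ∀ j, IsProjection (p j))
    (horth : ∀ i j : Fin n, i ≠ j → p i * p j = 0)
    (hsum : ∑ j, p j = 1)
    (u : M)
    (hu : u = ∑ j : Fin n, (Complex.exp (2 * Real.pi * Complex.I / n)) ^ (j : ℕ) • p j)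
    (x : M) (hx : ‖x‖ ≤ 1)
    (hL : IsLFree τ (fun i : Fin n => u ^ (i : ℕ) * x * (star u) ^ (i : ℕ))) :
    ‖∑ j, p j * x * p j‖ ≤ 2 * Real.sqrt ((n : ℝ) - 1) / n := by
  obtain ⟨m, rfl⟩ : ∃ m, n = m + 1 := ⟨n - 1, by omega⟩
  have hm : 1 ≤ m := by omega
  set z : ℂ := Complex.exp (2 * Real.pi * Complex.I / ((m + 1 : ℕ) : ℂ)) with hzdef
  have hz : IsPrimitiveRoot z (m + 1) := Complex.isPrimitiveRoot_exp (m + 1) (by omega)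
  have hnz : ‖z‖ = 1 := hz.norm'_eq_one (by omega)
  have hw : z * star z = 1 := by
    rw [Complex.star_def, Complex.mul_conj, Complex.normSq_eq_norm_sq, hnz]; simp
  have hid : ∀ j, p j * p j = p j := fun j => (hproj j).2
  have hstar : star u = ∑ j : Fin (m + 1), (star z) ^ (j : ℕ) • p j := by
    rw [hu, star_sum]
    refine Finset.sum_congr rfl fun j _ => ?_
    rw [star_smul, (hproj j).1, star_pow]
  have hmul : ∀ a b : Fin (m + 1) → ℂ, (∀ j, a j * b j = 1) →
      (∑ j, a j • p j) * (∑ j, b j • p j) = 1 := by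
    intro a b hab
    rw [Finset.sum_mul, ← hsum]
    refine Finset.sum_congr rfl fun i _ => ?_
    rw [Finset.mul_sum, Finset.sum_eq_single i]
    · rw [smul_mul_smul_comm, hid, hab, one_smul]
    · intro j _ hj
      rw [smul_mul_smul_comm, horth i j hj.symm, smul_zero]
    · simp
  have huu : u ∈ unitary M := by
    rw [Unitary.mem_iff]
    constructor
    · rw [hstar, hu]
      exact hmul _ _ fun j => by rw [← mul_pow, mul_comm, hw, one_pow]
    · rw [hstar, hu]
      exact hmul _ _ fun j => by rw [← mul_pow, hw, one_pow]
  have hnorm : ∀ i : Fin (m + 1), ‖u ^ (i : ℕ) * x * (star u) ^ (i : ℕ)‖ ≤ 1 := by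
    intro i
    have h1 : u ^ (i : ℕ) ∈ unitary M := pow_mem huu _
    have h2 : (star u) ^ (i : ℕ) ∈ unitary M := pow_mem (Unitary.star_mem huu) _
    rw [CStarRing.norm_mul_mem_unitary _ h2, CStarRing.norm_mem_unitary_mul _ h1]
    exact hx
  have hF := pv_fourier (by omega) p x z (star z) hz hw
  have hsumeq : ∑ i : Fin (m + 1), u ^ (i : ℕ) * x * (star u) ^ (i : ℕ) =
      ((m + 1 : ℕ) : ℂ) • ∑ j, p j * x * p j := by
    rw [← hF]
    refine Finset.sum_congr rfl fun i _ => ?_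
    rw [hstar, hu, pv_pow p hid horth hsum, pv_pow p hid horth hsum]
  letI : CStarAlgebra M := {}
  letI : PartialOrder M := CStarAlgebra.spectralOrder M
  haveI : StarOrderedRing M := CStarAlgebra.spectralOrderedRing M
  have main := pv_LFree_norm τ hτ hτf m hm _ hnorm hL
  rw [hsumeq, norm_smul, Complex.norm_natCast] at main
  have hpos : (0 : ℝ) < ((m + 1 : ℕ) : ℝ) := by positivity
  rw [le_div_iff₀ hpos, mul_comm]
  have e : (((m + 1 : ℕ) : ℝ) - 1) = m := by push_cast; ring
  rw [e]
  exact main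
end

section
/- Let M be a unital C*-algebra with a faithful tracial state τ and let x ∈ M with ‖x‖ ≤ 1. Suppose that for every n ≥ 1 there exist projections p₁, …, pₙ ∈ M with pᵢ pⱼ = 0 for i ≠ j and p₁ + ⋯ + pₙ = 1 such that, setting λ = exp(2πi/n) and u = Σ_{j=1}^n λ^{j−1} pⱼ, the family (u^{i−1} x u^{−(i−1)})_{i=1,…,n} is L-free with respect to τ. Then for every ε > 0 there exist a natural number n with n < 4ε⁻² + 1 and projections p₁, …, pₙ ∈ M with pᵢ pⱼ = 0 for i ≠ j and p₁ + ⋯ + pₙ = 1 such that ‖Σ_{i=1}^n pᵢ x pᵢ‖ ≤ ε. -/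
open scoped BigOperators ComplexOrder

section PartOne
set_option linter.unusedSectionVars false
variable {N : Type*} [CStarAlgebra N] [PartialOrder N] [StarOrderedRing N] (T : N →ₚ[ℂ] ℂ)

/-- The tracial 2-norm. -/
noncomputable def n2 (y : N) : ℝ := ‖T.toPreGNS y‖

lemma n2_nonneg (y : N) : 0 ≤ n2 T y := norm_nonneg _

lemma n2_sq (y : N) : n2 T y ^ 2 = (T (star y * y)).re := by
  have := T.preGNS_norm_sq (T.toPreGNS y)
  simp only [T.ofPreGNS_toPreGNS] at this
  rw [← this, n2, ← Complex.ofReal_pow, Complex.ofReal_re]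

lemma n2_add_le (a b : N) : n2 T (a + b) ≤ n2 T a + n2 T b := by
  simp only [n2, map_add]; exact norm_add_le _ _

lemma n2_sum_le {ι : Type*} (s : Finset ι) (f : ι → N) :
    n2 T (∑ i ∈ s, f i) ≤ ∑ i ∈ s, n2 T (f i) := by
  simp only [n2, map_sum]; exact norm_sum_le _ _

lemma n2_smul (c : ℂ) (a : N) : n2 T (c • a) = ‖c‖ * n2 T a := by
  simp only [n2, map_smul]; exact norm_smul _ _

lemma n2_rsmul (c : ℝ) (a : N) : n2 T (c • a) = |c| * n2 T a := by
  have := n2_smul T (c : ℂ) a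
  simpa using this

lemma n2_cs (a b : N) : ‖T (star a * b)‖ ≤ n2 T a * n2 T b := by
  have := norm_inner_le_norm (𝕜 := ℂ) (T.toPreGNS a) (T.toPreGNS b)
  rw [T.preGNS_inner_def] at this
  simpa [n2] using this

lemma n2_mul_left (a b : N) : n2 T (a * b) ≤ ‖a‖ * n2 T b := by
  have h := (T.leftMulMapPreGNS a).le_of_opNorm_le (c := ‖a‖)
    (LinearMap.mkContinuous_norm_le _ (norm_nonneg _) _) (T.toPreGNS b)
  simpa [n2] using h

variable (htr : ∀ x y : N, T (x * y) = T (y * x))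

include htr in
lemma n2_star (a : N) : n2 T (star a) = n2 T a := by
  have : n2 T (star a) ^ 2 = n2 T a ^ 2 := by
    rw [n2_sq, n2_sq, star_star, htr]
  exact (sq_eq_sq₀ (n2_nonneg T _) (n2_nonneg T _)).1 this

include htr in
lemma n2_mul_right (a b : N) : n2 T (a * b) ≤ n2 T a * ‖b‖ := by
  rw [← n2_star T htr, star_mul, mul_comm (n2 T a)]
  refine (n2_mul_left T _ _).trans ?_
  rw [n2_star T htr, norm_star]

variable {n : ℕ}

/-- Sum of all reduced words of length `k+1` ending in the letter `i`. -/
noncomputable def Sw (X : Fin n → N) : ℕ → Fin n → N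
  | 0, i => X i
  | k + 1, i => (∑ j ∈ Finset.univ.erase i, Sw X k j) * X i

lemma Sw_functional (X : Fin n → N) (k : ℕ) : ∀ (φ : N →ₗ[ℂ] ℂ) (j : Fin n),
    (∀ l : List (Fin n), List.IsChain (· ≠ ·) (l ++ [j]) → φ (((l ++ [j]).map X).prod) = 0) →
    φ (Sw X k j) = 0 := by
  induction k with
  | zero => intro φ j h; simpa [Sw] using h [] (by simp)
  | succ k ih =>
    intro φ j h
    rw [Sw, Finset.sum_mul, map_sum]
    refine Finset.sum_eq_zero fun i hi => ?_
    have := ih (φ ∘ₗ LinearMap.mulRight ℂ (X j)) i ?_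
    · simpa using this
    · intro l hl
      have := h (l ++ [i]) (by
        rw [List.isChain_append]
        refine ⟨hl, by simp, ?_⟩
        simpa using Finset.ne_of_mem_erase hi)
      simpa [mul_assoc] using this

variable (X : Fin n → N) (hX : ∀ i, IsSelfAdjoint (X i))
  (hw : ∀ l : List (Fin n), l ≠ [] → List.IsChain (· ≠ ·) l → T ((l.map X).prod) = 0)

include hX in
lemma star_word (l : List (Fin n)) : star ((l.map X).prod) = ((l.reverse).map X).prod := by
  induction l with
  | nil => simp
  | cons a l ih => simp [ih, (hX a).star_eq]

include hX hw in
lemma Sw_orth (k : ℕ) (i j : Fin n) (hij : i ≠ j) : T (Sw X k i * star (Sw X k j)) = 0 := by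
  have := Sw_functional X k (T.toLinearMap ∘ₗ LinearMap.mulRight ℂ (star (Sw X k j))) i ?_
  · simpa using this
  intro l hl
  have h2 := Sw_functional X k
    (T.toLinearMap ∘ₗ LinearMap.mulRight ℂ (star (((l ++ [i]).map X).prod))) j ?_
  · have h3 : star (T (Sw X k j * star (((l ++ [i]).map X).prod))) = 0 := by
      have : T (Sw X k j * star (((l ++ [i]).map X).prod)) = 0 := by simpa [mul_assoc] using h2
      rw [this, star_zero]
    rw [← map_star] at h3
    simpa using h3
  intro l' hl'
  have h4 := hw ((l' ++ [j]) ++ (l ++ [i]).reverse) (by simp) (by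
    rw [List.isChain_append]
    refine ⟨hl', ?_, ?_⟩
    · rw [List.isChain_reverse]
      refine hl.imp fun a b h => h.symm
    · simpa using hij.symm)
  simpa [star_word X hX, mul_assoc, (hX i).star_eq] using h4

include htr hX hw in
lemma n2_sum_Sw (k : ℕ) (s : Finset (Fin n)) :
    n2 T (∑ i ∈ s, Sw X k i) ^ 2 = ∑ i ∈ s, n2 T (Sw X k i) ^ 2 := by
  rw [n2_sq, htr, star_sum, Finset.sum_mul_sum, map_sum, Complex.re_sum]
  refine Finset.sum_congr rfl fun i hi => ?_
  rw [map_sum, Finset.sum_eq_single i, n2_sq, htr]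
  · intro j _ hj
    exact Sw_orth T X hX hw k i j hj.symm
  · intro h; exact absurd hi h

variable (hX1 : ∀ i, ‖X i‖ ≤ 1) (hT1 : T 1 = 1)

include hT1 in
lemma n2_one : n2 T 1 = 1 := by
  have : n2 T 1 ^ 2 = 1 := by rw [n2_sq]; simp [hT1]
  have := n2_nonneg T 1
  nlinarith

include htr hX hw hX1 hT1 in
lemma sum_Sw_sq (hn : 1 ≤ n) (k : ℕ) :
    ∑ i, n2 T (Sw X k i) ^ 2 ≤ n * ((n : ℝ) - 1) ^ k := by
  have hn' : (1 : ℝ) ≤ n := by exact_mod_cast hn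
  induction k with
  | zero =>
    have : ∀ i ∈ (Finset.univ : Finset (Fin n)), n2 T (Sw X 0 i) ^ 2 ≤ 1 := by
      intro i _
      have h1 : n2 T (Sw X 0 i) ≤ 1 := by
        have := n2_mul_left T (X i) 1
        rw [n2_one T hT1, mul_one, mul_one] at this
        exact this.trans (hX1 i)
      have := n2_nonneg T (Sw X 0 i)
      nlinarith
    simpa using Finset.sum_le_sum this
  | succ k ih =>
    have h1 : ∀ i ∈ (Finset.univ : Finset (Fin n)), n2 T (Sw X (k+1) i) ^ 2 ≤
        (∑ j, n2 T (Sw X k j) ^ 2) - n2 T (Sw X k i) ^ 2 := by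
      intro i _
      rw [← Finset.sum_erase_eq_sub (Finset.mem_univ i), ← n2_sum_Sw T htr X hX hw]
      have := n2_mul_right T htr (∑ j ∈ Finset.univ.erase i, Sw X k j) (X i)
      have h0 := n2_nonneg T (∑ j ∈ Finset.univ.erase i, Sw X k j)
      refine pow_le_pow_left₀ (n2_nonneg T _) (this.trans ?_) 2
      nlinarith [hX1 i]
    refine (Finset.sum_le_sum h1).trans ?_
    rw [Finset.sum_sub_distrib]
    simp only [Finset.sum_const, Finset.card_univ, Fintype.card_fin, nsmul_eq_mul]
    rw [pow_succ]
    nlinarith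

/-- Truncated generating series of reduced words. -/
noncomputable def Wt (X : Fin n → N) (t : ℝ) (m : ℕ) : N :=
  1 + ∑ k ∈ Finset.range m, t ^ (k + 1) • ∑ i, Sw X k i

/-- Truncated series of reduced words ending in `i`. -/
noncomputable def St (X : Fin n → N) (t : ℝ) (m : ℕ) (i : Fin n) : N :=
  ∑ k ∈ Finset.range m, t ^ (k + 1) • Sw X k i

lemma Wt_eq (t : ℝ) (m : ℕ) : Wt X t m = 1 + ∑ i, St X t m i := by
  simp only [Wt, St, Finset.smul_sum]
  rw [Finset.sum_comm]

lemma St_rec (t : ℝ) (m : ℕ) (i : Fin n) :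
    St X t (m + 1) i = (Wt X t m - St X t m i) * (t • X i) := by
  have : Wt X t m - St X t m i = 1 + ∑ k ∈ Finset.range m, t ^ (k + 1) •
      ∑ j ∈ Finset.univ.erase i, Sw X k j := by
    simp only [Wt, St, add_sub_assoc, ← Finset.sum_sub_distrib, ← smul_sub,
      Finset.sum_erase_eq_sub (Finset.mem_univ i)]
  rw [this, St, Finset.sum_range_succ', add_mul, Finset.sum_mul, add_comm]
  congr 1
  · simp [Sw]
  · refine Finset.sum_congr rfl fun k _ => ?_
    rw [Sw, smul_mul_smul_comm, ← pow_succ]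

lemma St_succ (t : ℝ) (m : ℕ) (i : Fin n) :
    St X t (m + 1) i = St X t m i + t ^ (m + 1) • Sw X m i := by
  rw [St, Finset.sum_range_succ, St]

/-- the resolvent-type element -/
noncomputable def gg (X : Fin n → N) (t : ℝ) : N :=
  1 - (n : N) + ∑ i, Ring.inverse (1 + t • X i)

lemma Wt_gg (t : ℝ) (hu : ∀ i, IsUnit (1 + t • X i)) (m : ℕ) :
    Wt X t m * gg X t = 1 - ∑ i, t ^ (m + 1) • (Sw X m i * Ring.inverse (1 + t • X i)) := by
  have h1 : ∀ i, Wt X t m * Ring.inverse (1 + t • X i) =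
      Wt X t m - St X t m i - t ^ (m + 1) • (Sw X m i * Ring.inverse (1 + t • X i)) := by
    intro i
    have h2 := St_rec X t m i
    rw [St_succ] at h2
    have h3 : Wt X t m = (Wt X t m - St X t m i) * (1 + t • X i) - t ^ (m + 1) • Sw X m i := by
      rw [mul_add, ← h2, mul_one]; abel
    conv_lhs => rw [h3]
    rw [sub_mul, mul_assoc, Ring.mul_inverse_cancel _ (hu i), mul_one, smul_mul_assoc]
  rw [gg, mul_add, Finset.mul_sum]
  simp only [h1, Finset.sum_sub_distrib, Finset.sum_const, Finset.card_univ, Fintype.card_fin,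
    nsmul_eq_mul]
  have := Wt_eq X t m
  have h5 : ∑ i, St X t m i = Wt X t m - 1 := by rw [this]; abel
  rw [h5, mul_sub, mul_one, (Nat.cast_commute n (Wt X t m)).eq]
  abel

end PartOne

section PartTwo
set_option linter.unusedSectionVars false
variable {N : Type*} [CStarAlgebra N] [PartialOrder N] [StarOrderedRing N] (T : N →ₚ[ℂ] ℂ)
  (htr : ∀ x y : N, T (x * y) = T (y * x)) {n : ℕ}
  (X : Fin n → N) (hX : ∀ i, IsSelfAdjoint (X i))
  (hw : ∀ l : List (Fin n), l ≠ [] → List.IsChain (· ≠ ·) l → T ((l.map X).prod) = 0)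
  (hX1 : ∀ i, ‖X i‖ ≤ 1) (hT1 : T 1 = 1)

include hX1 in
lemma isUnit_one_add_smul (t : ℝ) (h0 : 0 ≤ t) (h1 : t < 1) (i : Fin n) :
    IsUnit (1 + t • X i) := by
  have h : ‖-(t • X i)‖ < 1 := by
    rw [norm_neg, norm_smul, Real.norm_of_nonneg h0]
    nlinarith [hX1 i, norm_nonneg (X i)]
  have := (Units.oneSub _ h).isUnit
  simpa using this

include htr hX hw hX1 hT1 in
lemma pow_mul_n2_sum (hn : 1 ≤ n) (t : ℝ) (h0 : 0 ≤ t) (ht : t ^ 2 * n ≤ 1) (k : ℕ)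
    (s : Finset (Fin n)) :
    t ^ (k + 1) * n2 T (∑ i ∈ s, Sw X k i) ≤ (√(((n : ℝ) - 1) / n)) ^ k := by
  have hn' : (1 : ℝ) ≤ n := by exact_mod_cast hn
  have hn2 := n2_nonneg T (∑ i ∈ s, Sw X k i)
  refine (sq_le_sq₀ (by positivity) (by positivity)).1 ?_
  rw [← pow_mul, mul_comm k 2, pow_mul, Real.sq_sqrt (div_nonneg (by linarith) (by linarith)),
    mul_pow, n2_sum_Sw T htr X hX hw]
  have h1 : ∑ i ∈ s, n2 T (Sw X k i) ^ 2 ≤ n * ((n : ℝ) - 1) ^ k :=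
    (Finset.sum_le_sum_of_subset_of_nonneg (Finset.subset_univ s)
      (fun i _ _ => sq_nonneg _)).trans (sum_Sw_sq T htr X hX hw hX1 hT1 hn k)
  have h2 : (t ^ (k + 1)) ^ 2 ≤ 1 / (n : ℝ) ^ (k + 1) := by
    rw [le_div_iff₀ (by positivity), ← pow_mul, mul_comm (k + 1) 2, pow_mul, ← mul_pow]
    exact pow_le_one₀ (by positivity) ht
  calc _ ≤ 1 / (n : ℝ) ^ (k + 1) * (n * ((n : ℝ) - 1) ^ k) := by
        refine mul_le_mul h2 h1 (Finset.sum_nonneg fun i _ => sq_nonneg _) (by positivity)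
    _ = _ := by rw [div_pow, pow_succ]; field_simp

include htr hX hw hX1 hT1 in
lemma n2_Wt_le (hn : 1 ≤ n) (t : ℝ) (h0 : 0 ≤ t) (ht : t ^ 2 * n ≤ 1) (m : ℕ) :
    n2 T (Wt X t m) ≤ 1 + (1 - √(((n : ℝ) - 1) / n))⁻¹ := by
  have hn' : (1 : ℝ) ≤ n := by exact_mod_cast hn
  have hr : √(((n : ℝ) - 1) / n) < 1 := by
    rw [Real.sqrt_lt' one_pos, div_lt_iff₀ (by linarith)]; linarith
  refine (n2_add_le T _ _).trans ?_
  rw [n2_one T hT1]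
  gcongr
  refine (n2_sum_le T _ _).trans ?_
  have : ∀ k ∈ Finset.range m, n2 T (t ^ (k + 1) • ∑ i, Sw X k i) ≤
      (√(((n : ℝ) - 1) / n)) ^ k := by
    intro k _
    rw [n2_rsmul, abs_of_nonneg (by positivity)]
    exact pow_mul_n2_sum T htr X hX hw hX1 hT1 hn t h0 ht k _
  refine (Finset.sum_le_sum this).trans ?_
  rw [← tsum_geometric_of_lt_one (Real.sqrt_nonneg _) hr]
  exact (summable_geometric_of_lt_one (Real.sqrt_nonneg _) hr).sum_le_tsum _
    (fun i _ => by positivity)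

include hX in
lemma gg_sa (t : ℝ) : IsSelfAdjoint (gg X t) := by
  rw [gg, IsSelfAdjoint, star_add, star_sub, star_sum]
  simp [← Ring.inverse_star, (hX _).star_eq]

include htr hX hw hX1 hT1 in
/-- The key L2 bound. -/
lemma n2_cfc_le (hn : 1 ≤ n) (t : ℝ) (h0 : 0 ≤ t) (h1 : t < 1) (ht : t ^ 2 * n ≤ 1)
    (k : ℝ → ℝ) (hk : Continuous k) (D : ℝ) (hD : ∀ s, |s * k s| ≤ D) :
    n2 T (cfc k (gg X t)) ≤ (1 + (1 - √(((n : ℝ) - 1) / n))⁻¹) * D := by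
  have hn' : (1 : ℝ) ≤ n := by exact_mod_cast hn
  have hr : √(((n : ℝ) - 1) / n) < 1 := by
    rw [Real.sqrt_lt' one_pos, div_lt_iff₀ (by linarith)]; linarith
  set ρ := √(((n : ℝ) - 1) / n) with hρ
  have hρ0 : 0 ≤ ρ := Real.sqrt_nonneg _
  have hsa := gg_sa X hX t
  have hD0 : 0 ≤ D := (abs_nonneg _).trans (hD 0)
  have hgk : ‖gg X t * cfc k (gg X t)‖ ≤ D := by
    conv_lhs => rw [← cfc_id' ℝ (gg X t), cfc_id' ℝ (gg X t)]
    nth_rewrite 1 [← cfc_id' ℝ (gg X t)]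
    rw [← cfc_mul (fun x => x) k (gg X t)]
    exact norm_cfc_le hD0 fun s _ => hD s
  have key : ∀ m : ℕ, n2 T (cfc k (gg X t)) ≤ (1 + (1 - ρ)⁻¹) * D +
      ρ ^ m * ((∑ i, ‖Ring.inverse (1 + t • X i)‖) * ‖cfc k (gg X t)‖) := by
    intro m
    have h2 := Wt_gg X t (isUnit_one_add_smul X hX1 t h0 h1) m
    have h3 : cfc k (gg X t) = Wt X t m * (gg X t * cfc k (gg X t)) +
      (∑ i, t ^ (m + 1) • (Sw X m i * Ring.inverse (1 + t • X i))) * cfc k (gg X t) := by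
      rw [← mul_assoc, h2]; noncomm_ring
    conv_lhs => rw [h3]
    refine (n2_add_le T _ _).trans (add_le_add ?_ ?_)
    · refine (n2_mul_right T htr _ _).trans ?_
      exact mul_le_mul (n2_Wt_le T htr X hX hw hX1 hT1 hn t h0 ht m) hgk (norm_nonneg _)
        (by have : 0 < 1 - ρ := by linarith
            positivity)
    · refine (n2_mul_right T htr _ _).trans ?_
      rw [← mul_assoc]
      refine mul_le_mul_of_nonneg_right ?_ (norm_nonneg _)
      refine (n2_sum_le T _ _).trans ?_
      rw [Finset.mul_sum]
      refine Finset.sum_le_sum fun i _ => ?_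
      rw [n2_rsmul, abs_of_nonneg (by positivity)]
      have h4 := pow_mul_n2_sum T htr X hX hw hX1 hT1 hn t h0 ht m {i}
      rw [Finset.sum_singleton] at h4
      calc _ ≤ t ^ (m + 1) * (n2 T (Sw X m i) * ‖Ring.inverse (1 + t • X i)‖) := by
            gcongr; exact n2_mul_right T htr _ _
        _ = (t ^ (m + 1) * n2 T (Sw X m i)) * ‖Ring.inverse (1 + t • X i)‖ := by ring
        _ ≤ _ := by gcongr
  refine ge_of_tendsto' (x := Filter.atTop) ?_ key
  have := (tendsto_pow_atTop_nhds_zero_of_lt_one hρ0 hr).mul_const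
    ((∑ i, ‖Ring.inverse (1 + t • X i)‖) * ‖cfc k (gg X t)‖)
  simpa using this.const_add ((1 + (1 - ρ)⁻¹) * D)

/-- derivative of `gg` -/
noncomputable def gg' (X : Fin n → N) (t : ℝ) : N :=
  ∑ i, -(Ring.inverse (1 + t • X i) * X i * Ring.inverse (1 + t • X i))

include hX1 in
lemma hasDerivAt_gg (t : ℝ) (h0 : 0 ≤ t) (h1 : t < 1) : HasDerivAt (gg X) (gg' X t) t := by
  unfold gg gg'
  refine HasDerivAt.const_add _ ?_
  refine HasDerivAt.fun_sum fun i _ => ?_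
  obtain ⟨u, hu⟩ := isUnit_one_add_smul X hX1 t h0 h1 i
  have h2 : HasDerivAt (fun s : ℝ => 1 + s • X i) (X i) t := by
    simpa using ((hasDerivAt_id t).smul_const (X i)).const_add 1
  have h3 := hasFDerivAt_ringInverse (𝕜 := ℝ) u
  rw [hu] at h3
  have h4 := h3.comp_hasDerivAt t h2
  refine HasDerivAt.congr_deriv (f := fun s : ℝ => Ring.inverse (1 + s • X i)) h4 ?_
  rw [← hu]; simp

include hX1 in
lemma continuousOn_gg' : ContinuousOn (gg' X) (Set.Ico 0 1) := by
  unfold gg'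
  refine continuousOn_finsetSum _ fun i _ => ?_
  have : ContinuousOn (fun t : ℝ => Ring.inverse (1 + t • X i)) (Set.Ico 0 1) := by
    intro t ht
    obtain ⟨u, hu⟩ := isUnit_one_add_smul X hX1 t ht.1 ht.2 i
    refine ContinuousAt.continuousWithinAt ?_
    have h2 : ContinuousAt (fun t : ℝ => 1 + t • X i) t := by fun_prop
    refine ContinuousAt.comp (f := fun t : ℝ => 1 + t • X i) (g := Ring.inverse) ?_ h2
    rw [← hu]
    exact NormedRing.inverse_continuousAt u
  exact ((this.mul continuousOn_const).mul this).neg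

include htr in
lemma hasDerivAt_trace_poly (g : ℝ → N) (g' : N) (t : ℝ) (hg : HasDerivAt g g' t)
    (q : Polynomial ℝ) :
    HasDerivAt (fun s => T (Polynomial.aeval (g s) q))
      (T (Polynomial.aeval (g t) q.derivative * g')) t := by
  induction q using Polynomial.induction_on' with
  | add p q hp hq =>
    simp only [map_add, add_mul]
    exact hp.add hq
  | monomial k a =>
    have h1 := hg.fun_pow' k
    let L : N →L[ℝ] ℂ := ((⟨T.toLinearMap, map_continuous T⟩ : N →L[ℂ] ℂ)).restrictScalars ℝ
    have hL : ∀ y, L y = T y := fun _ => rfl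
    have h2 := (L.hasFDerivAt.comp_hasDerivAt t h1).const_smul a
    have h3 : ∀ y : N, T (a • y) = a • T y := fun y => by
      rw [← hL, ← hL, map_smul]
    have hf : (fun s => T (Polynomial.aeval (g s) (Polynomial.monomial k a))) =
        (a • ⇑L ∘ fun x => g x ^ k) := by
      ext s
      rw [Polynomial.aeval_monomial, ← Algebra.smul_def, h3]
      rfl
    rw [hf]
    refine h2.congr_deriv (Eq.symm ?_)
    · rw [map_sum, Polynomial.derivative_monomial, Polynomial.aeval_monomial]
      have h5 : ∀ i ∈ Finset.range k, L (g t ^ (k.pred - i) * g' * g t ^ i) =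
          T (g t ^ (k - 1) * g') := by
        intro i hi
        have := Finset.mem_range.1 hi
        rw [hL, htr, ← mul_assoc, ← pow_add]
        congr 3
        simp only [Nat.pred_eq_sub_one]; omega
      rw [Finset.sum_congr rfl h5]
      rw [← Algebra.smul_def, smul_mul_assoc, mul_smul, h3, Finset.sum_const, Finset.card_range,
        Nat.cast_smul_eq_nsmul, map_nsmul]

lemma exists_poly_antideriv (p : Polynomial ℝ) :
    ∃ q : Polynomial ℝ, q.derivative = p ∧ q.eval 0 = 0 := by
  suffices h : ∃ q : Polynomial ℝ, q.derivative = p by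
    obtain ⟨q, hq⟩ := h
    exact ⟨q - Polynomial.C (q.eval 0), by simp [hq], by simp⟩
  induction p using Polynomial.induction_on' with
  | add p q hp hq =>
    obtain ⟨a, ha⟩ := hp
    obtain ⟨b, hb⟩ := hq
    exact ⟨a + b, by simp [ha, hb]⟩
  | monomial k a =>
    refine ⟨Polynomial.monomial (k + 1) (a / (k + 1)), ?_⟩
    rw [Polynomial.derivative_monomial]
    congr 1
    push_cast
    field_simp

end PartTwo

section PartThree
set_option linter.unusedSectionVars false
variable {N : Type*} [CStarAlgebra N] [PartialOrder N] [StarOrderedRing N] (T : N →ₚ[ℂ] ℂ)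
  (htr : ∀ x y : N, T (x * y) = T (y * x)) {n : ℕ}
  (X : Fin n → N) (hX : ∀ i, IsSelfAdjoint (X i))
  (hw : ∀ l : List (Fin n), l ≠ [] → List.IsChain (· ≠ ·) l → T ((l.map X).prod) = 0)
  (hX1 : ∀ i, ‖X i‖ ≤ 1) (hT1 : T 1 = 1)

include hT1 in
lemma norm_T_le (y : N) : ‖T y‖ ≤ ‖y‖ := by
  have h1 := n2_cs T 1 y
  have h2 := n2_mul_left T y 1
  rw [n2_one T hT1, mul_one] at h2
  rw [n2_one T hT1, star_one, one_mul, one_mul] at h1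
  rw [mul_one] at h2
  exact h1.trans h2

include hT1 in
lemma nontrivial_of_trace : Nontrivial N := by
  refine ⟨0, 1, fun h => ?_⟩
  rw [← h, map_zero] at hT1
  exact zero_ne_one hT1

include hT1 in
lemma abs_le_of_mem_spectrum (g : N) (R : ℝ) (hR : ‖g‖ ≤ R) (s : ℝ) (hs : s ∈ spectrum ℝ g) :
    s ∈ Set.Icc (-R) R := by
  have := nontrivial_of_trace T hT1
  have h := (spectrum.norm_le_norm_of_mem hs).trans hR
  rw [Real.norm_eq_abs] at h
  exact abs_le.1 h

/-- Poisson kernel approximation. -/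
lemma poly_approx (R η : ℝ) (hR : 0 ≤ R) (hη : 0 < η) : ∃ q : Polynomial ℝ,
    (∀ s ∈ Set.Icc (-R) R, |q.derivative.eval s - η / (s ^ 2 + η ^ 2)| ≤ η) ∧
    (∀ s ∈ Set.Icc (-R) R, |q.eval s - Real.arctan (s / η)| ≤ η * R) := by
  have hpos : ∀ s : ℝ, 0 < s ^ 2 + η ^ 2 := fun s => by positivity
  obtain ⟨p, hp⟩ := exists_polynomial_near_of_continuousOn (-R) R
    (fun s => η / (s ^ 2 + η ^ 2))
    (Continuous.continuousOn (by
      refine Continuous.div (by fun_prop) (by fun_prop) fun s => (hpos s).ne')) η hη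
  obtain ⟨q, hq, hq0⟩ := exists_poly_antideriv p
  have h1 : ∀ s ∈ Set.Icc (-R) R, |q.derivative.eval s - η / (s ^ 2 + η ^ 2)| ≤ η := by
    intro s hs; rw [hq]; exact (hp s hs).le
  refine ⟨q, h1, fun s hs => ?_⟩
  have hd : ∀ x ∈ Set.Icc (-R) R, HasDerivWithinAt (fun s => q.eval s - Real.arctan (s / η))
      (q.derivative.eval x - η / (x ^ 2 + η ^ 2)) (Set.Icc (-R) R) x := by
    intro x _
    refine HasDerivAt.hasDerivWithinAt ?_
    refine (q.hasDerivAt x).sub ?_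
    have := ((hasDerivAt_id x).div_const η).arctan
    refine this.congr_deriv ?_
    simp only [id]
    have := hpos x
    field_simp
    ring
  have := Convex.norm_image_sub_le_of_norm_hasDerivWithin_le (C := η) hd
    (fun x hx => by rw [Real.norm_eq_abs]; exact h1 x hx) (convex_Icc _ _)
    (show (0 : ℝ) ∈ Set.Icc (-R) R from ⟨by linarith, hR⟩) hs
  simp only [hq0, zero_div, Real.arctan_zero, sub_zero, Real.norm_eq_abs] at this
  refine this.trans ?_
  have : |s| ≤ R := abs_le.2 hs
  gcongr

include htr hX hw hX1 hT1 in
lemma deriv_bound (hn : 1 ≤ n) (t : ℝ) (h0 : 0 ≤ t) (h1 : t < 1) (ht : t ^ 2 * n ≤ 1)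
    (R η : ℝ) (hη : 0 < η) (hR : ‖gg X t‖ ≤ R) (q : Polynomial ℝ)
    (hq : ∀ s ∈ Set.Icc (-R) R, |q.derivative.eval s - η / (s ^ 2 + η ^ 2)| ≤ η)
    (y : N) (K : ℝ) (hy : ‖y‖ ≤ K) :
    ‖T (Polynomial.aeval (gg X t) q.derivative * y)‖ ≤
      ((1 + (1 - √(((n : ℝ) - 1) / n))⁻¹) ^ 2 + 1) * K * η := by
  have hpos : ∀ s : ℝ, 0 < s ^ 2 + η ^ 2 := fun s => by positivity
  set C := 1 + (1 - √(((n : ℝ) - 1) / n))⁻¹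
  have hK : 0 ≤ K := (norm_nonneg y).trans hy
  have hsa := gg_sa X hX t
  set g := gg X t with hg
  let f : ℝ → ℝ := fun s => η / (s ^ 2 + η ^ 2)
  have hf : Continuous f :=
    Continuous.div (by fun_prop) (by fun_prop) fun s => (hpos s).ne'
  let k : ℝ → ℝ := fun s => √(f s)
  have hk : Continuous k := by fun_prop
  have hk2 : ∀ s, k s * k s = f s := fun s => Real.mul_self_sqrt (div_nonneg hη.le (hpos s).le)
  have hkD : ∀ s, |s * k s| ≤ √η := by
    intro s
    rw [Real.le_sqrt (abs_nonneg _) hη.le, sq_abs, mul_pow, sq (k s), hk2]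
    simp only [f]
    rw [mul_div_assoc', div_le_iff₀ (hpos s)]
    nlinarith [mul_pos hη (pow_pos hη 2)]
  have hb := n2_cfc_le T htr X hX hw hX1 hT1 hn t h0 h1 ht k hk _ hkD
  rw [← hg] at hb
  have hdec : Polynomial.aeval g q.derivative = cfc k g * cfc k g +
      cfc (fun s => q.derivative.eval s - f s) g := by
    have hc1 : Continuous fun s => q.derivative.eval s - f s := q.derivative.continuous.sub hf
    rw [← cfc_mul k k g hk.continuousOn hk.continuousOn,
      ← cfc_add g (fun x => k x * k x) (fun s => q.derivative.eval s - f s)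
        (hk.mul hk).continuousOn hc1.continuousOn, ← cfc_polynomial q.derivative g]
    congr 1
    ext s
    rw [hk2]; ring
  have he : ‖cfc (fun s => q.derivative.eval s - f s) g‖ ≤ η :=
    norm_cfc_le hη.le fun s hs => hq s (abs_le_of_mem_spectrum T hT1 g R hR s hs)
  have hksa : star (cfc k g) = cfc k g := (cfc_predicate k g : IsSelfAdjoint _).star_eq
  rw [hdec, add_mul, map_add]
  refine (norm_add_le _ _).trans ?_
  have hA : ‖T (cfc k g * cfc k g * y)‖ ≤ C ^ 2 * K * η := by
    have h3 := n2_cs T (cfc k g) (cfc k g * y)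
    rw [hksa, ← mul_assoc] at h3
    refine h3.trans ?_
    have h4 := n2_mul_right T htr (cfc k g) y
    have h5 := n2_nonneg T (cfc k g)
    have h6 : n2 T (cfc k g) ^ 2 ≤ (C * √η) ^ 2 := pow_le_pow_left₀ h5 hb 2
    rw [mul_pow, Real.sq_sqrt hη.le] at h6
    calc _ ≤ n2 T (cfc k g) * (n2 T (cfc k g) * K) := by
          gcongr
          exact h4.trans (by gcongr)
      _ = n2 T (cfc k g) ^ 2 * K := by ring
      _ ≤ (C ^ 2 * η) * K := by gcongr
      _ = _ := by ring
  have hB : ‖T (cfc (fun s => q.derivative.eval s - f s) g * y)‖ ≤ η * K := by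
    refine (norm_T_le T hT1 _).trans ((norm_mul_le _ _).trans ?_)
    gcongr
  linarith

variable (hfaith : ∀ y, T (star y * y) = 0 → y = 0)

include htr hX hw hX1 hT1 hfaith in
theorem gg_nonneg (hn : 1 ≤ n) (t : ℝ) (h0 : 0 ≤ t) (h1 : t < 1) (ht : t ^ 2 * n ≤ 1) :
    0 ≤ gg X t := by
  have hsub : Set.Icc 0 t ⊆ Set.Ico (0 : ℝ) 1 := fun s hs => ⟨hs.1, hs.2.trans_lt h1⟩
  obtain ⟨K, hK⟩ := isCompact_Icc.exists_bound_of_continuousOn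
    ((continuousOn_gg' X hX1).mono hsub)
  have hcg : ContinuousOn (gg X) (Set.Icc 0 t) := fun s hs =>
    (hasDerivAt_gg X hX1 s hs.1 (hsub hs).2).continuousAt.continuousWithinAt
  obtain ⟨R0, hR0⟩ := isCompact_Icc.exists_bound_of_continuousOn hcg
  set R := max R0 1 with hRdef
  have hR : ∀ s ∈ Set.Icc 0 t, ‖gg X s‖ ≤ R := fun s hs => (hR0 s hs).trans (le_max_left _ _)
  have hR1 : 1 ≤ R := le_max_right _ _
  have htm : t ∈ Set.Icc 0 t := ⟨h0, le_rfl⟩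
  set C := ((1 + (1 - √(((n : ℝ) - 1) / n))⁻¹) ^ 2 + 1) * K with hC
  have hsa := gg_sa X hX t
  set g := gg X t with hg
  let k : ℝ → ℝ := fun s => √(max (-s) 0)
  have hk : Continuous k := by fun_prop
  have hk2 : ∀ s, k s * k s = max (-s) 0 := fun s => Real.mul_self_sqrt (le_max_right _ _)
  have hksa : star (cfc k g) = cfc k g := (cfc_predicate k g : IsSelfAdjoint _).star_eq
  have hkk : star (cfc k g) * cfc k g = cfc (fun s : ℝ => max (-s) 0) g := by
    rw [hksa, ← cfc_mul k k g hk.continuousOn hk.continuousOn]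
    congr 1; ext s; exact hk2 s
  have hg0 : gg X 0 = 1 := by simp [gg]
  have hTr : ∀ (a : ℝ) (y : N), T (a • y) = a * T y := fun a y => by
    simp
  -- main estimate
  have main : ∀ η : ℝ, 0 < η → (Real.pi / (2 * R)) * (T (star (cfc k g) * cfc k g)).re ≤
      η * (1 + 2 * R + C * t) := by
    intro η hη
    obtain ⟨q, hq1, hq2⟩ := poly_approx R η (by linarith) hη
    have hmvt := norm_image_sub_le_of_norm_deriv_le_segment' (a := 0) (b := t) (C := C * η)
      (f := fun s => T (Polynomial.aeval (gg X s) q))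
      (fun s hs => (hasDerivAt_trace_poly T htr (gg X) _ s
        (hasDerivAt_gg X hX1 s hs.1 (hsub hs).2) q).hasDerivWithinAt)
      (fun s hs => deriv_bound T htr X hX hw hX1 hT1 hn s hs.1 (hs.2.trans h1)
        (by nlinarith [hs.1, hs.2, pow_le_pow_left₀ hs.1 hs.2.le 2, (Nat.cast_nonneg n : (0:ℝ) ≤ n)])
        R η hη (hR s ⟨hs.1, hs.2.le⟩) q hq1 _ K (hK s ⟨hs.1, hs.2.le⟩)) t htm
    simp only [hg0, sub_zero] at hmvt
    rw [← hg] at hmvt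
    have hq1' : T (Polynomial.aeval (1 : N) q) = (q.eval 1 : ℝ) := by
      have : (Polynomial.aeval (1 : N) q) = (q.eval 1 : ℝ) • (1 : N) := by
        have := Polynomial.aeval_algebraMap_apply N (1 : ℝ) q
        rw [map_one] at this
        rw [this, Algebra.algebraMap_eq_smul_one]; simp [Polynomial.aeval_def]
      rw [this, hTr, hT1, mul_one]
    have hre : q.eval 1 - (T (Polynomial.aeval g q)).re ≤ C * η * t := by
      have h5 := (Complex.abs_re_le_norm _).trans hmvt
      rw [hq1', Complex.sub_re, Complex.ofReal_re] at h5
      linarith [(abs_le.1 h5).1]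
    have ha1 := (abs_le.1 (hq2 1 ⟨by linarith, hR1⟩)).1
    have harc : Real.pi / 2 - Real.arctan (1 / η) ≤ η := by
      rw [one_div, Real.arctan_inv_of_pos hη]
      have := Real.le_tan (Real.arctan_nonneg.2 hη.le) (Real.arctan_lt_pi_div_two η)
      rw [Real.tan_arctan] at this
      linarith
    -- positivity
    have hpos : 0 ≤ cfc (fun s => (Real.pi / 2 + η * R) - q.eval s -
        (Real.pi / (2 * R)) * max (-s) 0) g := by
      refine cfc_nonneg fun s hs => ?_
      have hs' := abs_le_of_mem_spectrum T hT1 g R (hR t htm) s hs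
      have h6 := (abs_le.1 (hq2 s hs')).2
      have hp := Real.pi_pos
      rcases le_total 0 s with h | h
      · rw [max_eq_right (by linarith)]
        have := Real.arctan_lt_pi_div_two (s / η)
        linarith
      · rw [max_eq_left (by linarith)]
        have h7 : Real.arctan (s / η) ≤ 0 := by
          rw [← Real.arctan_zero]
          exact Real.arctan_mono (div_nonpos_of_nonpos_of_nonneg h hη.le)
        have h8 : Real.pi / (2 * R) * (-s) ≤ Real.pi / 2 := by
          rw [div_mul_eq_mul_div, div_le_div_iff₀ (by linarith) (by norm_num)]
          nlinarith [hs'.1]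
        linarith
    have hexp : cfc (fun s => (Real.pi / 2 + η * R) - q.eval s -
        (Real.pi / (2 * R)) * max (-s) 0) g = (Real.pi / 2 + η * R) • (1 : N) -
        Polynomial.aeval g q - (Real.pi / (2 * R)) • (star (cfc k g) * cfc k g) := by
      rw [hkk, ← cfc_const_mul (Real.pi / (2 * R)) (fun s : ℝ => max (-s) 0) g,
        ← Algebra.algebraMap_eq_smul_one, ← cfc_const (Real.pi / 2 + η * R) g,
        ← cfc_polynomial q g,
        ← cfc_sub (fun _ => Real.pi / 2 + η * R) (fun s => q.eval s) g (by fun_prop) (by fun_prop),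
        ← cfc_sub _ _ g (by fun_prop) (by fun_prop)]
    rw [hexp] at hpos
    have h9 := (Complex.le_def.1 (T.map_nonneg hpos)).1
    rw [map_sub, map_sub, hTr, hTr, hT1] at h9
    simp only [Complex.sub_re, Complex.re_ofReal_mul, Complex.zero_re, Complex.one_re] at h9
    nlinarith
  have hTnn : 0 ≤ T (star (cfc k g) * cfc k g) := T.map_nonneg (star_mul_self_nonneg _)
  have hTle : (T (star (cfc k g) * cfc k g)).re ≤ 0 := by
    have hpR : 0 < Real.pi / (2 * R) := div_pos Real.pi_pos (by linarith)
    have hlim : (Real.pi / (2 * R)) * (T (star (cfc k g) * cfc k g)).re ≤ 0 := by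
      have hc : Filter.Tendsto (fun η : ℝ => η * (1 + 2 * R + C * t)) (nhdsWithin 0 (Set.Ioi 0))
          (nhds 0) := by
        have : Filter.Tendsto (fun η : ℝ => η * (1 + 2 * R + C * t)) (nhds 0)
            (nhds (0 * (1 + 2 * R + C * t))) := Continuous.tendsto (by fun_prop) 0
        rw [zero_mul] at this
        exact this.mono_left nhdsWithin_le_nhds
      exact ge_of_tendsto hc (Filter.eventually_of_mem self_mem_nhdsWithin fun η hη => main η hη)
    by_contra! hcon
    have := mul_pos hpR hcon
    linarith
  have hT0 : T (star (cfc k g) * cfc k g) = 0 := by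
    have h := Complex.le_def.1 hTnn
    refine Complex.ext (le_antisymm hTle h.1) h.2.symm
  have hk0 := hfaith _ hT0
  rw [hk0, mul_zero] at hkk
  have hgdec : g = cfc (fun s : ℝ => max s 0) g - cfc (fun s : ℝ => max (-s) 0) g := by
    rw [← cfc_sub _ _ g (by fun_prop) (by fun_prop)]
    conv_lhs => rw [← cfc_id' ℝ g]
    congr 1; ext s
    rcases le_total 0 s with h | h
    · rw [max_eq_left h, max_eq_right (by linarith), sub_zero]
    · rw [max_eq_right h, max_eq_left (by linarith)]; ring
  rw [hgdec, ← hkk, sub_zero]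
  exact cfc_nonneg fun s _ => le_max_right _ _

end PartThree

section PartFour
set_option linter.unusedSectionVars false
variable {N : Type*} [CStarAlgebra N] [PartialOrder N] [StarOrderedRing N] (T : N →ₚ[ℂ] ℂ)
  (htr : ∀ x y : N, T (x * y) = T (y * x)) {n : ℕ}

lemma one_add_smul_nonneg (x : N) (hx : IsSelfAdjoint x) (hx1 : ‖x‖ ≤ 1) (t : ℝ) (h0 : 0 ≤ t)
    (h1 : t ≤ 1) : 0 ≤ 1 + t • x := by
  have h := hx.neg_algebraMap_norm_le_self
  have h2 : t • (-(algebraMap ℝ N ‖x‖)) ≤ t • x := smul_le_smul_of_nonneg_left h h0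
  have h3 : 0 ≤ (1 - t * ‖x‖) • (1 : N) :=
    smul_nonneg (by nlinarith [norm_nonneg x]) zero_le_one
  have h4 : t • (-(algebraMap ℝ N ‖x‖)) = - ((t * ‖x‖) • (1 : N)) := by
    rw [Algebra.algebraMap_eq_smul_one, smul_neg, smul_smul]
  rw [h4] at h2
  rw [sub_smul, one_smul] at h3
  calc (0 : N) ≤ 1 - (t * ‖x‖) • (1 : N) := h3
    _ = 1 + -((t * ‖x‖) • (1 : N)) := by abel
    _ ≤ _ := by gcongr

lemma inverse_le (x : N) (hx : IsSelfAdjoint x) (hx1 : ‖x‖ ≤ 1) (t : ℝ) (h0 : 0 ≤ t)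
    (h1 : t < 1) (hu : IsUnit (1 + t • x)) :
    (1 - t ^ 2) • Ring.inverse (1 + t • x) ≤ 1 - t • x := by
  obtain ⟨u, hu⟩ := hu
  rw [← hu, Ring.inverse_unit]
  set r : N := ((u⁻¹ : Nˣ) : N)
  have hus : star (u : N) = u := by rw [hu]; simp [hx.star_eq]
  have hur : (u : N) * r = 1 := Units.mul_inv u
  have hru : r * (u : N) = 1 := Units.inv_mul u
  have hrs : star r = r := by
    have h0 : star r * (u : N) = 1 := by
      have := congrArg star hur
      rwa [star_mul, hus, star_one] at this
    have h : r = star r := by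
      calc r = (star r * (u : N)) * r := by rw [h0, one_mul]
        _ = star r := by rw [mul_assoc, hur, mul_one]
    exact h.symm
  have hA : 0 ≤ 1 + (1 : ℝ) • x := one_add_smul_nonneg x hx hx1 1 zero_le_one le_rfl
  have hB : 0 ≤ 1 + (1 : ℝ) • (-x) :=
    one_add_smul_nonneg (-x) hx.neg (by simpa using hx1) 1 zero_le_one le_rfl
  have hC : 0 ≤ 1 + t • x := one_add_smul_nonneg x hx hx1 t h0 h1.le
  rw [one_smul] at hA hB
  have cAB : Commute (1 + x) (1 + -x) := by
    unfold Commute SemiconjBy; noncomm_ring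
  have hAB := Commute.mul_nonneg hA hB cAB
  have c1 : Commute x (1 + t • x) := by
    refine (Commute.one_right x).add_right ((Commute.refl x).smul_right t)
  have cABC : Commute ((1 + x) * (1 + -x)) (1 + t • x) :=
    Commute.mul_left ((Commute.one_left _).add_left c1) ((Commute.one_left _).add_left c1.neg_left)
  have hABC := Commute.mul_nonneg hAB hC cABC
  have hfin := star_left_conjugate_nonneg (smul_nonneg (sq_nonneg t) hABC) r
  rw [hrs, ← hu] at hfin
  have key : t ^ 2 • ((1 + x) * (1 + -x) * (u : N)) = u * (1 - t • x) * u - (1 - t ^ 2) • (u : N) := by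
    have e : (u : N) * (1 - t • x) = (1 - t ^ 2) • 1 + t ^ 2 • ((1 + x) * (1 + -x)) := by
      rw [hu]
      simp only [mul_sub, add_mul, mul_add, mul_neg, mul_one, one_mul, smul_mul_assoc, mul_smul_comm, smul_smul, smul_add, smul_neg, sub_smul, one_smul]
      rw [sq]; abel
    rw [e, add_mul ((1 - t ^ 2) • (1 : N)), smul_mul_assoc, one_mul (u : N), smul_mul_assoc]; abel
  rw [key] at hfin
  have e2 : r * (u * (1 - t • x) * u - (1 - t ^ 2) • (u : N)) * r
      = (1 - t • x) - (1 - t ^ 2) • r := by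
    calc _ = (r * u) * (1 - t • x) * (u * r) - (1 - t ^ 2) • ((r * u) * r) := by
          simp only [mul_sub, sub_mul, mul_smul_comm, smul_mul_assoc, mul_assoc]
      _ = _ := by rw [hru, hur]; simp
  rw [e2] at hfin
  exact sub_nonneg.1 hfin

lemma sum_le_two_sqrt (X : Fin n → N) (hX : ∀ i, IsSelfAdjoint (X i))
    (hX1 : ∀ i, ‖X i‖ ≤ 1) (hn : 2 ≤ n)
    (hg : ∀ t : ℝ, 0 ≤ t → t < 1 → t ^ 2 * n ≤ 1 → 0 ≤ gg X t) :
    ∑ i, X i ≤ (2 * Real.sqrt n) • (1 : N) := by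
  have hn' : (2 : ℝ) ≤ n := by exact_mod_cast hn
  set q := Real.sqrt n with hq
  have hqq : q ^ 2 = n := Real.sq_sqrt (by linarith)
  have hq0 : 0 ≤ q := Real.sqrt_nonneg _
  have hq1 : 1 < q := by nlinarith
  set t := q⁻¹ with ht
  have ht0 : 0 < t := inv_pos.2 (by linarith)
  have htq : t * q = 1 := inv_mul_cancel₀ (by linarith)
  have ht1 : t < 1 := inv_lt_one_of_one_lt₀ hq1
  have htn : t ^ 2 * n = 1 := by rw [← hqq, ← mul_pow, htq, one_pow]
  have h := hg t ht0.le ht1 htn.le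
  have hc : 0 ≤ 1 - t ^ 2 := by nlinarith
  have h2 : (1 - t ^ 2) • ∑ i, Ring.inverse (1 + t • X i) ≤ ∑ i, (1 - t • X i) := by
    rw [Finset.smul_sum]
    exact Finset.sum_le_sum fun i _ => inverse_le (X i) (hX i) (hX1 i) t ht0.le ht1
      (isUnit_one_add_smul X hX1 t ht0.le ht1 i)
  have h3 := smul_nonneg hc h
  rw [gg, smul_add] at h3
  have h4 : 0 ≤ (1 - t ^ 2) • (1 - (n : N)) + ∑ i, (1 - t • X i) :=
    h3.trans (by gcongr)
  have h5 := smul_nonneg hq0 h4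
  have hnN : (n : N) = (n : ℝ) • (1 : N) := by
    rw [← Algebra.algebraMap_eq_smul_one]; simp
  have h6 : q • ((1 - t ^ 2) • (1 - (n : N)) + ∑ i, (1 - t • X i))
      = (q * (1 + n * t ^ 2 - t ^ 2)) • (1 : N) - ∑ i, X i := by
    rw [Finset.sum_sub_distrib, ← Finset.smul_sum, Finset.sum_const, Finset.card_univ,
      Fintype.card_fin, ← Nat.cast_smul_eq_nsmul ℝ, hnN]
    have : q • t • ∑ i, X i = ∑ i, X i := by rw [smul_smul, mul_comm, htq, one_smul]
    simp only [smul_add, smul_sub, this]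
    have e : (q * (1 + n * t ^ 2 - t ^ 2)) • (1 : N) = q • (1 - t^2) • (1 : N) -
      q • (1 - t^2) • (n : ℝ) • (1 : N) + q • (n : ℝ) • (1 : N) := by
      simp only [smul_smul, ← sub_smul, ← add_smul]
      congr 1; ring
    rw [e]; abel
  rw [h6] at h5
  refine (sub_nonneg.1 h5).trans (smul_le_smul_of_nonneg_right ?_ zero_le_one)
  nlinarith [mul_nonneg hq0 (sq_nonneg t)]

lemma norm_le_of_le_of_neg_le (a : N) (ha : IsSelfAdjoint a) (c : ℝ) (hc : 0 ≤ c)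
    (h1 : a ≤ c • (1 : N)) (h2 : -a ≤ c • (1 : N)) : ‖a‖ ≤ c := by
  rw [← Algebra.algebraMap_eq_smul_one] at h1 h2
  have hA := sub_nonneg.2 h1
  have hB := sub_nonneg.2 h2
  rw [sub_neg_eq_add] at hB
  have hcomm : Commute (algebraMap ℝ N c) a := Algebra.commutes c a
  have hAB := Commute.mul_nonneg hA hB
    (((Commute.refl _).add_right hcomm).sub_left (hcomm.symm.add_right (Commute.refl _)))
  have e : (algebraMap ℝ N c - a) * (algebraMap ℝ N c + a) = algebraMap ℝ N (c ^ 2) - star a * a := by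
    rw [ha.star_eq, sub_mul, mul_add, mul_add, ← hcomm.eq, pow_two, map_mul]; abel
  rw [e] at hAB
  have h3 := (CStarAlgebra.norm_le_iff_le_algebraMap (star a * a) (sq_nonneg c)
    (star_mul_self_nonneg a)).2 (sub_nonneg.1 hAB)
  rw [CStarRing.norm_star_mul_self] at h3
  nlinarith [norm_nonneg a]

include htr in
theorem norm_sum_le_sqrt (X : Fin n → N) (hX : ∀ i, IsSelfAdjoint (X i))
    (hw : ∀ l : List (Fin n), l ≠ [] → List.IsChain (· ≠ ·) l → T ((l.map X).prod) = 0)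
    (hX1 : ∀ i, ‖X i‖ ≤ 1) (hT1 : T 1 = 1) (hfaith : ∀ y, T (star y * y) = 0 → y = 0)
    (hn : 2 ≤ n) : ‖∑ i, X i‖ ≤ 2 * Real.sqrt n := by
  refine norm_le_of_le_of_neg_le _ (isSelfAdjoint_sum _ fun i _ => hX i) _ (by positivity) ?_ ?_
  · exact sum_le_two_sqrt X hX hX1 hn fun t h0 h1 ht =>
      gg_nonneg T htr X hX hw hX1 hT1 hfaith (by omega) t h0 h1 ht
  · rw [← Finset.sum_neg_distrib]
    refine sum_le_two_sqrt (fun i => -X i) (fun i => (hX i).neg) (fun i => by simpa using hX1 i) hn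
      fun t h0 h1 ht =>
      gg_nonneg T htr (fun i => -X i) (fun i => (hX i).neg) ?_ (fun i => by simpa using hX1 i)
        hT1 hfaith (by omega) t h0 h1 ht
    intro l hl hc
    have : (l.map fun i => -X i).prod = ((-1 : ℂ) ^ l.length) • (l.map X).prod := by
      clear hl hc
      induction l with
      | nil => simp
      | cons a l ih => 
        simp only [List.map_cons, List.prod_cons, ih, List.length_cons, pow_succ]
        simp [mul_smul]
    rw [this, map_smul, hw l hl hc, smul_zero]

end PartFour

section PartFive
set_option linter.unusedSectionVars false

/-- recursive alternating words -/
def altWord {M : Type*} [Ring M] [StarRing M] {n : ℕ} (x : Fin n → M) : Bool → List (Fin n) → M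
  | _, [] => 1
  | true, i :: l => x i * altWord x false l
  | false, i :: l => star (x i) * altWord x true l

lemma altWord_ofFn {M : Type*} [Ring M] [StarRing M] [Algebra ℂ M] {n : ℕ} (x : Fin n → M) :
    ∀ (m : ℕ) (i : Fin m → Fin n),
    altWord x true (List.ofFn i) = LWord x i ∧ altWord x false (List.ofFn i) = LWordStar x i := by
  intro m
  induction m with
  | zero => intro i; simp [altWord, LWord, LWordStar]
  | succ m ih =>
    intro i
    obtain ⟨h1, h2⟩ := ih (fun s => i s.succ)
    have hp : ∀ a : ℕ, (a + 1) % 2 = 0 ↔ ¬ (a % 2 = 0) := fun a => by omega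
    rw [List.ofFn_succ]
    unfold altWord
    rw [h1, h2]
    unfold LWord LWordStar
    rw [List.ofFn_succ, List.ofFn_succ, List.prod_cons, List.prod_cons]
    simp only [Fin.val_zero, Fin.val_succ, hp, ite_not]
    simp

variable {M : Type*} [CStarAlgebra M] [PartialOrder M] [StarOrderedRing M]

lemma exists_star_mul_of_nonneg {N : Type*} [CStarAlgebra N] [PartialOrder N] [StarOrderedRing N]
    (m : N) (hm : 0 ≤ m) : ∃ b, m = star b * b :=
  CStarAlgebra.nonneg_iff_eq_star_mul_self.1 hm

/-- off-diagonal self-adjoint dilation -/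
def dil (x : M) : CStarMatrix (Fin 2) (Fin 2) M := CStarMatrix.ofMatrix !![0, x; star x, 0]

@[simp] lemma dil_zero_zero (x : M) : dil x 0 0 = 0 := rfl
@[simp] lemma dil_zero_one (x : M) : dil x 0 1 = x := rfl
@[simp] lemma dil_one_zero (x : M) : dil x 1 0 = star x := rfl
@[simp] lemma dil_one_one (x : M) : dil x 1 1 = 0 := rfl

lemma dil_selfAdjoint (x : M) : IsSelfAdjoint (dil x) := by
  refine CStarMatrix.ext fun i j => ?_
  rw [CStarMatrix.star_apply]
  fin_cases i <;> fin_cases j <;> simp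

lemma dil_norm_le (x : M) (hx : ‖x‖ ≤ 1) : ‖dil x‖ ≤ 1 := by
  have key : ∀ y : M, ‖y‖ ≤ 1 → ∃ b : M, 1 - star y * y = star b * b := by
    intro y hy
    have h := CStarAlgebra.star_mul_le_algebraMap_norm_sq (a := y)
    have h2 : algebraMap ℝ M (‖y‖ ^ 2) ≤ 1 := by
      rw [← map_one (algebraMap ℝ M)]
      exact algebraMap_mono M (by nlinarith [norm_nonneg y])
    exact CStarAlgebra.nonneg_iff_eq_star_mul_self.1 (sub_nonneg.2 (h.trans h2))
  obtain ⟨b, hb⟩ := key x hx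
  obtain ⟨c, hc⟩ := key (star x) (by simpa using hx)
  rw [star_star] at hc
  have h1 : 1 - star (dil x) * dil x =
      star (CStarMatrix.ofMatrix !![c, 0; 0, b] : CStarMatrix (Fin 2) (Fin 2) M) *
        CStarMatrix.ofMatrix !![c, 0; 0, b] := by
    refine CStarMatrix.ext fun i j => ?_
    rw [(dil_selfAdjoint x).star_eq]
    fin_cases i <;> fin_cases j <;>
      simp [CStarMatrix.mul_apply, CStarMatrix.star_apply, Fin.sum_univ_two, hb, hc]
  have h2 : 0 ≤ 1 - star (dil x) * dil x := by rw [h1]; exact star_mul_self_nonneg _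
  have h3 := (CStarAlgebra.norm_le_iff_le_algebraMap (star (dil x) * dil x) zero_le_one
    (star_mul_self_nonneg _)).2 (by simpa using sub_nonneg.1 h2)
  rw [CStarRing.norm_star_mul_self] at h3
  nlinarith [norm_nonneg (dil x)]

lemma dil_word {n : ℕ} (x : Fin n → M) (l : List (Fin n)) :
    (l.map fun i => dil (x i)).prod 0 0 = (if l.length % 2 = 0 then altWord x true l else 0) ∧
    (l.map fun i => dil (x i)).prod 1 1 = (if l.length % 2 = 0 then altWord x false l else 0) ∧
    (l.map fun i => dil (x i)).prod 0 1 = (if l.length % 2 = 0 then 0 else altWord x true l) ∧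
    (l.map fun i => dil (x i)).prod 1 0 = (if l.length % 2 = 0 then 0 else altWord x false l) := by
  induction l with
  | nil => simp [altWord]
  | cons a l ih =>
    obtain ⟨h1, h2, h3, h4⟩ := ih
    have hp : (l.length + 1) % 2 = 0 ↔ ¬ (l.length % 2 = 0) := by omega
    simp only [List.map_cons, List.prod_cons, List.length_cons, hp, ite_not, altWord,
      CStarMatrix.mul_apply, Fin.sum_univ_two, h1, h2, h3, h4, dil_zero_zero, dil_zero_one,
      dil_one_zero, dil_one_one, zero_mul, mul_ite, mul_zero]
    split_ifs <;> simp

/-- linear map from a tracial state -/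
noncomputable def traceLin (τ : M → ℂ) (hτ : IsTracialState τ) : M →ₗ[ℂ] ℂ where
  toFun := τ
  map_add' x y := by simpa using hτ.1 1 x y
  map_smul' c x := by
    have h0 : τ 0 = 0 := by simpa using hτ.1 1 0 0
    simpa [h0] using hτ.1 c x 0

/-- the linear trace on two by two matrices -/
noncomputable def tr2 (τ : M → ℂ) (hτ : IsTracialState τ) :
    CStarMatrix (Fin 2) (Fin 2) M →ₗ[ℂ] ℂ where
  toFun m := (1 / 2 : ℂ) * (traceLin τ hτ (m 0 0) + traceLin τ hτ (m 1 1))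
  map_add' x y := by simp only [CStarMatrix.add_apply, map_add]; ring
  map_smul' c x := by simp only [CStarMatrix.smul_apply, map_smul, smul_eq_mul, RingHom.id_apply]; ring

lemma tr2_star_mul (τ : M → ℂ) (hτ : IsTracialState τ) (b : CStarMatrix (Fin 2) (Fin 2) M) :
    tr2 τ hτ (star b * b) = (1 / 2 : ℂ) * ((τ (star (b 0 0) * b 0 0) + τ (star (b 1 0) * b 1 0)) +
      (τ (star (b 0 1) * b 0 1) + τ (star (b 1 1) * b 1 1))) := by
  change (1 / 2 : ℂ) * (traceLin τ hτ _ + traceLin τ hτ _) = _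
  simp only [CStarMatrix.mul_apply, CStarMatrix.star_apply, Fin.sum_univ_two, map_add]
  rfl

/-- the positive trace on two by two matrices -/
noncomputable def tr2P (τ : M → ℂ) (hτ : IsTracialState τ) :
    CStarMatrix (Fin 2) (Fin 2) M →ₚ[ℂ] ℂ :=
  PositiveLinearMap.mk₀ (tr2 τ hτ) (by
    intro m hm
    obtain ⟨b, rfl⟩ : ∃ b, m = star b * b := exists_star_mul_of_nonneg m hm
    rw [tr2_star_mul]
    have h := hτ.2.2.1
    have h2 : (0 : ℂ) ≤ 1 / 2 := by
      rw [Complex.le_def]; norm_num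
    exact mul_nonneg h2 (add_nonneg (add_nonneg (h _) (h _)) (add_nonneg (h _) (h _))))

theorem norm_sum_le_of_lfree {n : ℕ} (τ : M → ℂ) (hτ : IsTracialState τ) (hτf : IsFaithful τ)
    (x : Fin n → M) (hx : ∀ i, ‖x i‖ ≤ 1) (hfree : IsLFree τ x) (hn : 2 ≤ n) :
    ‖∑ i, x i‖ ≤ 2 * Real.sqrt n := by
  have hT : ∀ m, tr2P τ hτ m = (1 / 2 : ℂ) * (τ (m 0 0) + τ (m 1 1)) := fun m => rfl
  have hadd : ∀ a b, τ (a + b) = τ a + τ b := (traceLin τ hτ).map_add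
  have hz : τ 0 = 0 := (traceLin τ hτ).map_zero
  have h1 : ‖∑ i, dil (x i)‖ ≤ 2 * Real.sqrt n := by
    refine norm_sum_le_sqrt (tr2P τ hτ) ?_ _ (fun i => dil_selfAdjoint _) ?_
      (fun i => dil_norm_le _ (hx i)) ?_ ?_ hn
    · intro a b
      simp only [hT, CStarMatrix.mul_apply, Fin.sum_univ_two, hadd]
      rw [hτ.2.2.2 (a 0 0), hτ.2.2.2 (a 0 1), hτ.2.2.2 (a 1 0), hτ.2.2.2 (a 1 1)]
      ring
    · intro l hl hc
      obtain ⟨h00, h11, -, -⟩ := dil_word x l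
      rw [hT, h00, h11]
      by_cases hpar : l.length % 2 = 0
      · rw [if_pos hpar, if_pos hpar]
        have hex : ∀ (m : ℕ) (l : List (Fin n)), l.length = m → ∃ i : Fin m → Fin n,
            l = List.ofFn i := by
          rintro _ l rfl
          exact ⟨l.get, (List.ofFn_get l).symm⟩
        obtain ⟨k, hk⟩ : ∃ k, l.length = 2 * k := ⟨l.length / 2, by omega⟩
        have hpos := List.length_pos_iff.2 hl
        obtain ⟨i, rfl⟩ := hex (2 * k) l hk
        obtain ⟨e1, e2⟩ := altWord_ofFn x _ i
        rw [e1, e2]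
        have := hfree k (by omega) i ?_
        · rw [this.1, this.2]; simp
        · rintro ⟨s, hs⟩ ⟨t, ht⟩ hst
          simp only at hst
          subst hst
          exact List.isChain_ofFn.1 hc s ht
      · rw [if_neg hpar, if_neg hpar]; simp [hz]
    · rw [hT]; simp [hτ.2.1]; norm_num
    · intro y hy
      change tr2 τ hτ _ = 0 at hy
      rw [tr2_star_mul] at hy
      have h := hτ.2.2.1
      have h3 := (mul_eq_zero.1 hy).resolve_left (by norm_num)
      rw [add_eq_zero_iff_of_nonneg (add_nonneg (h _) (h _)) (add_nonneg (h _) (h _)),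
        add_eq_zero_iff_of_nonneg (h _) (h _), add_eq_zero_iff_of_nonneg (h _) (h _)] at h3
      obtain ⟨⟨a, b⟩, c, d⟩ := h3
      refine CStarMatrix.ext fun i j => ?_
      fin_cases i <;> fin_cases j
      · exact hτf _ a
      · exact hτf _ c
      · exact hτf _ b
      · exact hτf _ d
  refine le_trans ?_ h1
  have h2 : ∑ i, x i = (∑ i, dil (x i)) 0 1 := by
    have : ∀ s : Finset (Fin n), (∑ i ∈ s, dil (x i)) 0 1 = ∑ i ∈ s, x i := by
      intro s
      induction s using Finset.induction_on with
      | empty => simp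
      | insert a s ha ih => rw [Finset.sum_insert ha, Finset.sum_insert ha, CStarMatrix.add_apply, ih]; simp
    exact (this _).symm
  rw [h2]
  exact CStarMatrix.norm_entry_le_norm

end PartFive

section PartSix

lemma proj_comb_pow {M : Type*} [Ring M] [Algebra ℂ M] {n : ℕ} (p : Fin n → M)
    (hpp : ∀ j, p j * p j = p j) (hort : ∀ i j : Fin n, i ≠ j → p i * p j = 0)
    (hsum : ∑ j, p j = 1) (a : Fin n → ℂ) (k : ℕ) :
    (∑ j, a j • p j) ^ k = ∑ j, (a j) ^ k • p j := by
  induction k with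
  | zero => simp [hsum]
  | succ k ih =>
    rw [pow_succ, ih, Finset.sum_mul]
    refine Finset.sum_congr rfl fun i _ => ?_
    rw [Finset.mul_sum, Finset.sum_eq_single i]
    · rw [smul_mul_smul_comm, hpp, pow_succ]
    · intro j _ hj
      rw [smul_mul_smul_comm, hort i j (Ne.symm hj), smul_zero]
    · simp

lemma root_sum {n : ℕ} (lam : ℂ) (hl : IsPrimitiveRoot lam n) (hs : star lam * lam = 1)
    (hn : 1 ≤ n) (i j : Fin n) :
    ∑ k : Fin n, ((lam ^ (i : ℕ)) ^ (k : ℕ) * ((star lam) ^ (j : ℕ)) ^ (k : ℕ)) =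
      if i = j then (n : ℂ) else 0 := by
  have hlam : lam ≠ 0 := by rintro rfl; simp at hs
  have hsl : star lam = lam⁻¹ := eq_inv_of_mul_eq_one_left hs
  simp_rw [← mul_pow]
  rw [Fin.sum_univ_eq_sum_range (fun k => (lam ^ (i : ℕ) * star lam ^ (j : ℕ)) ^ k) n]
  split_ifs with h
  · subst h
    rw [← mul_pow, mul_comm lam, hs]; simp
  · have hz : lam ^ (i : ℕ) * star lam ^ (j : ℕ) ≠ 1 := by
      intro h1
      apply h
      rw [hsl, inv_pow, mul_inv_eq_one₀ (pow_ne_zero _ hlam)] at h1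
      exact Fin.ext (hl.pow_inj i.2 j.2 h1)
    rw [geom_sum_eq hz]
    have : (lam ^ (i : ℕ) * star lam ^ (j : ℕ)) ^ n = 1 := by
      rw [mul_pow, ← pow_mul, ← pow_mul, mul_comm (i : ℕ), mul_comm (j : ℕ), pow_mul, pow_mul,
        ← star_pow, hl.pow_eq_one]; simp
    rw [this]; simp

lemma conj_sum {M : Type*} [Ring M] [StarRing M] [Algebra ℂ M] [StarModule ℂ M] {n : ℕ} (p : Fin n → M)
    (hps : ∀ j, star (p j) = p j)
    (hpp : ∀ j, p j * p j = p j) (hort : ∀ i j : Fin n, i ≠ j → p i * p j = 0)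
    (hsum : ∑ j, p j = 1) (lam : ℂ) (hl : IsPrimitiveRoot lam n) (hs : star lam * lam = 1)
    (hn : 1 ≤ n) (x : M) :
    ∑ k : Fin n, (∑ j : Fin n, lam ^ (j : ℕ) • p j) ^ (k : ℕ) * x *
      (star (∑ j : Fin n, lam ^ (j : ℕ) • p j)) ^ (k : ℕ) = (n : ℂ) • ∑ i, p i * x * p i := by
  have hst : star (∑ j : Fin n, lam ^ (j : ℕ) • p j) = ∑ j : Fin n, (star lam) ^ (j : ℕ) • p j := by
    rw [star_sum]
    refine Finset.sum_congr rfl fun j _ => ?_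
    rw [star_smul, hps, star_pow]
  rw [hst]
  simp_rw [proj_comb_pow p hpp hort hsum, Finset.sum_mul, Finset.mul_sum]
  rw [Finset.sum_comm, Finset.smul_sum]
  refine Finset.sum_congr rfl fun i _ => ?_
  rw [Finset.sum_comm]
  have : ∀ j : Fin n, ∑ k : Fin n, (lam ^ (i : ℕ)) ^ (k : ℕ) • p i * x *
      ((star lam) ^ (j : ℕ)) ^ (k : ℕ) • p j = (if i = j then (n : ℂ) else 0) • (p i * x * p j) := by
    intro j
    rw [← root_sum lam hl hs hn i j, Finset.sum_smul]
    refine Finset.sum_congr rfl fun k _ => ?_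
    rw [smul_mul_assoc, smul_mul_smul_comm]
  simp_rw [this]
  simp

lemma comb_unitary {M : Type*} [Ring M] [StarRing M] [Algebra ℂ M] [StarModule ℂ M] {n : ℕ} (p : Fin n → M)
    (hps : ∀ j, star (p j) = p j)
    (hpp : ∀ j, p j * p j = p j) (hort : ∀ i j : Fin n, i ≠ j → p i * p j = 0)
    (hsum : ∑ j, p j = 1) (lam : ℂ) (hs : star lam * lam = 1) :
    (∑ j : Fin n, lam ^ (j : ℕ) • p j) ∈ unitary M := by
  have hst : star (∑ j : Fin n, lam ^ (j : ℕ) • p j) = ∑ j : Fin n, (star lam) ^ (j : ℕ) • p j := by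
    rw [star_sum]
    refine Finset.sum_congr rfl fun j _ => ?_
    rw [star_smul, hps, star_pow]
  have key : ∀ a b : ℂ, a * b = 1 → (∑ j : Fin n, a ^ (j : ℕ) • p j) * (∑ j : Fin n, b ^ (j : ℕ) • p j) = 1 := by
    intro a b hab
    rw [Finset.sum_mul, ← hsum]
    refine Finset.sum_congr rfl fun i _ => ?_
    rw [Finset.mul_sum, Finset.sum_eq_single i]
    · rw [smul_mul_smul_comm, hpp, ← mul_pow, hab, one_pow, one_smul]
    · intro j _ hj
      rw [smul_mul_smul_comm, hort i j (Ne.symm hj), smul_zero]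
    · simp
  rw [Unitary.mem_iff, hst]
  exact ⟨key _ _ hs, key _ _ (by rw [mul_comm]; exact hs)⟩

end PartSix

/-- Paving size bound `n < 4ε⁻² + 1` for elements admitting
L-free systems of conjugates for every `n`. -/
theorem paving_size_lt_four_eps_sq
    {M : Type*} [NormedRing M] [StarRing M] [CStarRing M] [NormedAlgebra ℂ M]
    [StarModule ℂ M] [CompleteSpace M]
    (τ : M → ℂ) (hτ : IsTracialState τ) (hτf : IsFaithful τ)
    (x : M) (hx : ‖x‖ ≤ 1)
    (hyp : ∀ n : ℕ, 1 ≤ n → ∃ p : Fin n → M,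
      (∀ j, IsProjection (p j)) ∧
      (∀ i j : Fin n, i ≠ j → p i * p j = 0) ∧
      (∑ j, p j = 1) ∧
      IsLFree τ (fun i : Fin n =>
        (∑ j : Fin n, (Complex.exp (2 * Real.pi * Complex.I / n)) ^ (j : ℕ) • p j) ^ (i : ℕ)
          * x *
        (star (∑ j : Fin n, (Complex.exp (2 * Real.pi * Complex.I / n)) ^ (j : ℕ) • p j)) ^ (i : ℕ))) :
    ∀ ε : ℝ, 0 < ε → ∃ (n : ℕ) (p : Fin n → M),
      (n : ℝ) < 4 * ε⁻¹ ^ 2 + 1 ∧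
      (∀ j, IsProjection (p j)) ∧
      (∀ i j : Fin n, i ≠ j → p i * p j = 0) ∧
      (∑ j, p j = 1) ∧
      ‖∑ i, p i * x * p i‖ ≤ ε := by
  letI : CStarAlgebra M := { }
  letI := CStarAlgebra.spectralOrder M
  haveI := CStarAlgebra.spectralOrderedRing M
  haveI : Nontrivial M := by
    refine ⟨0, 1, fun h => ?_⟩
    have h0 : τ 0 = 0 := by simpa using hτ.1 1 0 0
    have := hτ.2.1
    rw [← h, h0] at this
    exact zero_ne_one this
  intro ε hε
  have hεi : 0 < ε⁻¹ := inv_pos.2 hε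
  have hpos : 0 < 4 * ε⁻¹ ^ 2 := by positivity
  set n := ⌈4 * ε⁻¹ ^ 2⌉₊ with hndef
  have hn1 : 1 ≤ n := Nat.ceil_pos.2 hpos
  have hnlt : (n : ℝ) < 4 * ε⁻¹ ^ 2 + 1 := Nat.ceil_lt_add_one hpos.le
  have hnge : 4 * ε⁻¹ ^ 2 ≤ (n : ℝ) := Nat.le_ceil _
  clear_value n
  have hee : ε * ε⁻¹ = 1 := mul_inv_cancel₀ hε.ne'
  have hnR : (1 : ℝ) ≤ n := by exact_mod_cast hn1
  set q := Real.sqrt n with hq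
  have hqq : q ^ 2 = n := Real.sq_sqrt (by linarith)
  have hq0 : 0 ≤ q := Real.sqrt_nonneg _
  have hq1 : 1 ≤ q := by nlinarith
  have hqe : 2 ≤ ε * q := by
    have h1 : 2 * ε⁻¹ ≤ q := by
      refine abs_le_of_sq_le_sq' ?_ hq0 |>.2
      rw [hqq, mul_pow]; linarith
    nlinarith
  obtain ⟨p, hp, hort, hsum, hfree⟩ := hyp n hn1
  refine ⟨n, p, hnlt, hp, hort, hsum, ?_⟩
  set lam := Complex.exp (2 * Real.pi * Complex.I / n) with hlam
  have hl : IsPrimitiveRoot lam n := Complex.isPrimitiveRoot_exp n (by omega)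
  have hs : star lam * lam = 1 := by
    have h1 : ‖lam‖ = 1 := hl.norm'_eq_one (by omega)
    have := Complex.conj_mul' lam
    rw [h1] at this
    simpa using this
  clear_value lam
  have hU := comb_unitary p (fun j => (hp j).1) (fun j => (hp j).2) hort hsum lam hs
  have hS := conj_sum p (fun j => (hp j).1) (fun j => (hp j).2) hort hsum lam hl hs hn1 x
  have hb : ‖(n : ℂ) • ∑ i, p i * x * p i‖ ≤ 2 * q := by
    rw [← hS]
    have hc : ∀ i : Fin n, ‖(∑ j : Fin n, lam ^ (j : ℕ) • p j) ^ (i : ℕ) * x *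
        (star (∑ j : Fin n, lam ^ (j : ℕ) • p j)) ^ (i : ℕ)‖ ≤ 1 := by
      intro i
      rw [CStarRing.norm_mul_mem_unitary _ (pow_mem (Unitary.star_mem hU) _),
        CStarRing.norm_mem_unitary_mul _ (pow_mem hU _)]
      exact hx
    rcases Nat.lt_or_ge n 2 with h | h
    · refine (norm_sum_le _ _).trans ((Finset.sum_le_sum fun i _ => hc i).trans ?_)
      have : (n : ℝ) ≤ 1 := by exact_mod_cast (by omega : n ≤ 1)
      simp only [Finset.sum_const, Finset.card_univ, Fintype.card_fin, nsmul_eq_mul, mul_one]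
      linarith
    · exact norm_sum_le_of_lfree τ hτ hτf _ hc hfree h
  rw [norm_smul, Complex.norm_natCast, ← hqq] at hb
  set S := ‖∑ i, p i * x * p i‖
  have h1 : q * S ≤ 2 := by
    by_contra! hcon
    nlinarith
  by_contra! hcon
  nlinarith
end

section
/- Let M be a unital C*-algebra with a faithful tracial state τ, let n ≥ 2, and let (x₁, …, xₙ) be an L-free family in M with ‖xᵢ‖ ≤ 1 for all i. Then ‖x₁ + x₂ + ⋯ + xₙ‖ ≤ 2√(n−1). -/
open scoped BigOperators ComplexOrder

/-- a faithful tracial (real part of a) state. -/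
structure RTr {B : Type*} [CStarAlgebra B] [PartialOrder B] [StarOrderedRing B]
    (ψ : B →ₗ[ℝ] ℝ) : Prop where
  one : ψ 1 = 1
  pos : ∀ a, 0 ≤ ψ (star a * a)
  faithful : ∀ a, ψ (star a * a) = 0 → a = 0
  comm : ∀ a b, ψ (a * b) = ψ (b * a)
  star : ∀ a, ψ (star a) = ψ a

namespace RTr

variable {B : Type*} [CStarAlgebra B] [PartialOrder B] [StarOrderedRing B] {ψ : B →ₗ[ℝ] ℝ}

/-- squared two-norm -/
noncomputable def N (ψ : B →ₗ[ℝ] ℝ) (a : B) : ℝ := ψ (Star.star a * a)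

theorem nonneg (h : RTr ψ) {a : B} (ha : 0 ≤ a) : 0 ≤ ψ a := by
  obtain ⟨b, rfl⟩ := CStarAlgebra.nonneg_iff_eq_star_mul_self.mp ha
  exact h.pos b

theorem eq_zero (h : RTr ψ) {a : B} (ha : 0 ≤ a) (h0 : ψ a = 0) : a = 0 := by
  obtain ⟨b, rfl⟩ := CStarAlgebra.nonneg_iff_eq_star_mul_self.mp ha
  rw [h.faithful b h0]; simp

theorem mono (h : RTr ψ) {a b : B} (hab : a ≤ b) : ψ a ≤ ψ b := by
  have := h.nonneg (sub_nonneg.2 hab)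
  rw [map_sub] at this; linarith

theorem N_nonneg (h : RTr ψ) (a : B) : 0 ≤ N ψ a := h.pos a

theorem nontriv (h : RTr ψ) : Nontrivial B := by
  refine ⟨0, 1, fun h01 => ?_⟩
  have := h.one
  rw [← h01, map_zero] at this
  exact zero_ne_one this

theorem N_mul_le (h : RTr ψ) (b a : B) : N ψ (b * a) ≤ ‖b‖ ^ 2 * N ψ a := by
  have h1 : Star.star a * (Star.star b * b) * a ≤ Star.star a * (algebraMap ℝ B (‖b‖ ^ 2)) * a :=
    star_left_conjugate_le_conjugate CStarAlgebra.star_mul_le_algebraMap_norm_sq a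
  have h2 := h.mono h1
  have h3 : Star.star a * (algebraMap ℝ B (‖b‖ ^ 2)) * a = (‖b‖ ^ 2) • (Star.star a * a) := by
    rw [Algebra.algebraMap_eq_smul_one]; simp
  rw [h3, map_smul] at h2
  simpa [N, mul_assoc] using h2

theorem N_add_le (h : RTr ψ) (a b : B) : N ψ (a + b) ≤ 2 * N ψ a + 2 * N ψ b := by
  have := h.pos (a - b)
  simp only [N, star_add, star_sub, mul_add, add_mul, mul_sub, sub_mul, map_add, map_sub] at *
  linarith

theorem N_smul (c : ℝ) (a : B) : N ψ (c • a) = c ^ 2 * N ψ a := by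
  simp only [N, star_smul, star_trivial, smul_mul_smul_comm, map_smul, smul_eq_mul]; ring

theorem sa_le (h : RTr ψ) {a : B} (ha : IsSelfAdjoint a) : ψ a ≤ ‖a‖ := by
  have := h.mono ha.le_algebraMap_norm_self
  rw [Algebra.algebraMap_eq_smul_one, map_smul, h.one] at this
  simpa using this

theorem le_norm (h : RTr ψ) (a : B) : ψ a ≤ ‖a‖ := by
  have h1 := h.sa_le (a := a + Star.star a) (by simp [IsSelfAdjoint, add_comm])
  rw [map_add, h.star] at h1
  have := norm_add_le a (Star.star a)
  rw [norm_star] at this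
  linarith

theorem abs_le_norm (h : RTr ψ) (a : B) : |ψ a| ≤ ‖a‖ := by
  refine abs_le.2 ⟨?_, h.le_norm a⟩
  have := h.le_norm (-a)
  rw [map_neg, norm_neg] at this; linarith

theorem cont (h : RTr ψ) : Continuous ψ :=
  (ψ.mkContinuous 1 (fun a => by simpa using h.abs_le_norm a)).continuous

/-- derivative of the trace of a polynomial -/
theorem hasDerivAt_pow (h : RTr ψ) {K : ℝ → B} {K' : B} {z : ℝ} (hK : HasDerivAt K K' z) (m : ℕ) :
    ∃ D, HasDerivAt (fun t => K t ^ (m + 1)) D z ∧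
      ∀ b, Commute b (K z) → ψ (b * D) = (m + 1) * ψ (b * K z ^ m * K') := by
  induction m with
  | zero => exact ⟨K', by simpa using hK, fun b _ => by simp⟩
  | succ m ih =>
    obtain ⟨D, hD, hb⟩ := ih
    refine ⟨D * K z + K z ^ (m + 1) * K', ?_, ?_⟩
    · simpa only [pow_succ _ (m + 1)] using hD.fun_mul hK
    · intro b hbc
      have h1 : ψ (b * (D * K z)) = ψ ((K z * b) * D) := by
        rw [← mul_assoc, h.comm, mul_assoc]
      have h2 : K z * b * K z ^ m * K' = b * K z ^ (m + 1) * K' := by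
        rw [← hbc.eq, pow_succ']; simp only [mul_assoc]
      rw [mul_add, map_add, h1, hb _ ((Commute.refl (K z)).mul_left hbc), h2]
      push_cast
      simp only [mul_assoc]; ring

theorem hasDerivAt_poly (h : RTr ψ) {K : ℝ → B} {K' : B} {z : ℝ} (hK : HasDerivAt K K' z)
    (g : Polynomial ℝ) :
    HasDerivAt (fun t => ψ (Polynomial.aeval (K t) g))
      (ψ (Polynomial.aeval (K z) (Polynomial.derivative g) * K')) z := by
  let L : B →L[ℝ] ℝ := ψ.mkContinuous 1 (fun a => by simpa using h.abs_le_norm a)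
  induction g using Polynomial.induction_on' with
  | add p q hp hq =>
    simpa [add_mul] using hp.fun_add hq
  | monomial n a =>
    cases n with
    | zero => simpa [Polynomial.aeval_monomial] using hasDerivAt_const z _
    | succ m =>
      obtain ⟨D, hD, hb⟩ := h.hasDerivAt_pow hK m
      have h1 : HasDerivAt (fun t => L (a • K t ^ (m + 1))) (L (a • D)) z :=
        L.hasFDerivAt.comp_hasDerivAt z (hD.const_smul a)
      have h2 : ψ D = (m + 1) * ψ (K z ^ m * K') := by
        simpa using hb 1 (Commute.one_left _)
      have h3 : L (a • D) = ψ (Polynomial.aeval (K z) (Polynomial.derivative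
          (Polynomial.monomial (m + 1) a)) * K') := by
        change ψ (a • D) = _
        rw [map_smul, h2, Polynomial.derivative_monomial, Polynomial.aeval_monomial,
          mul_assoc, ← Algebra.smul_def, map_smul]
        simp; ring
      rw [← h3]
      convert h1 using 2 with t
      rw [Polynomial.aeval_monomial, ← Algebra.smul_def]; rfl

theorem aeval_sa {K : B} (hK : IsSelfAdjoint K) (p : Polynomial ℝ) :
    IsSelfAdjoint (Polynomial.aeval K p) := by
  rw [← cfc_polynomial p K]; exact cfc_predicate _ _

theorem spec_abs_le {K : B} {R : ℝ} (hR : ‖K‖ ≤ R) {t : ℝ} (ht : t ∈ spectrum ℝ K) : |t| ≤ R := by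
  have : Nontrivial B := by
    by_contra hB
    rw [not_nontrivial_iff_subsingleton] at hB
    simp [spectrum.of_subsingleton] at ht
  exact (spectrum.norm_le_norm_of_mem ht).trans hR

theorem norm_aeval_le {K : B} (hK : IsSelfAdjoint K) (p : Polynomial ℝ) {R c : ℝ} (hc : 0 ≤ c)
    (hR : ‖K‖ ≤ R) (hp : ∀ t, |t| ≤ R → |p.eval t| ≤ c) : ‖Polynomial.aeval K p‖ ≤ c := by
  rw [← cfc_polynomial p K]
  exact norm_cfc_le hc fun t ht => hp t (spec_abs_le hR ht)

end RTr
section PolyStep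
open Polynomial

theorem exists_antideriv (p : ℝ[X]) : ∃ g : ℝ[X], derivative g = p := by
  induction p using Polynomial.induction_on' with
  | add p q hp hq =>
    obtain ⟨a, ha⟩ := hp
    obtain ⟨b, hb⟩ := hq
    exact ⟨a + b, by simp [ha, hb]⟩
  | monomial n a =>
    refine ⟨monomial (n + 1) (a / (n + 1)), ?_⟩
    rw [derivative_monomial]
    have : (n : ℝ) + 1 ≠ 0 := by positivity
    simp [this]

theorem bern_aux {u : ℝ} (h0 : 0 ≤ u) (h1 : u ≤ 1) (m : ℕ) : m * ((1 - u) ^ m * u) ≤ 1 := by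
  have h2 : 1 + (m : ℝ) * u ≤ (1 + u) ^ m := one_add_mul_le_pow (by linarith) m
  have h3 : 0 ≤ (1 - u) ^ m := pow_nonneg (by linarith) m
  have h4 : (1 - u) ^ m * (1 + u) ^ m ≤ 1 := by
    rw [← mul_pow]; exact pow_le_one₀ (by nlinarith) (by nlinarith)
  nlinarith [mul_le_mul_of_nonneg_left h2 h3]

theorem exists_step (R : ℝ) (hR : 1 ≤ R) (ε : ℝ) (hε : 0 < ε) :
    ∃ (s g : ℝ[X]) (κ : ℝ), 0 < κ ∧ derivative g = -(s ^ 2) ∧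
      (∀ t, |t| ≤ R → (s.eval t * t) ^ 2 ≤ ε * κ) ∧ g.eval 1 ≤ ε * κ ∧
      (∀ t, |t| ≤ R → 0 ≤ g.eval t) ∧ (∀ t, t ≤ 0 → κ ≤ g.eval t) := by
  obtain ⟨j, hj⟩ := exists_nat_gt (max 1 (2 * R ^ 2 / ε))
  have hj1 : (1 : ℝ) < j := (le_max_left _ _).trans_lt hj
  have hj2 : 2 * R ^ 2 < j * ε := by
    have := (le_max_right _ _).trans_lt hj
    rwa [div_lt_iff₀ hε] at this
  have hR0 : 0 < R := by linarith
  set s : ℝ[X] := (1 - C (R⁻¹ ^ 2) * X ^ 2) ^ (j ^ 2) with hs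
  have hse : ∀ t, s.eval t = (1 - (t / R) ^ 2) ^ (j ^ 2) := by
    intro t; simp [hs]; congr 1; field_simp
  have hse2 : ∀ t, s.eval t ^ 2 = (1 - (t / R) ^ 2) ^ (2 * j ^ 2) := by
    intro t; rw [hse, ← pow_mul, mul_comm]
  have hu : ∀ t, |t| ≤ R → (t / R) ^ 2 ≤ 1 := by
    intro t ht
    rw [sq_le_one_iff_abs_le_one, abs_div, abs_of_pos hR0]
    exact (div_le_one hR0).2 ht
  have hpt : ∀ t, |t| ≤ R → (s.eval t * t) ^ 2 ≤ R ^ 2 / (2 * j ^ 2) := by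
    intro t ht
    have := bern_aux (sq_nonneg (t / R)) (hu t ht) (2 * j ^ 2)
    rw [← hse2] at this
    push_cast at this
    rw [le_div_iff₀ (by positivity), mul_pow]
    have e : t ^ 2 = R ^ 2 * (t / R) ^ 2 := by field_simp
    rw [e]
    nlinarith [mul_le_mul_of_nonneg_left this (sq_nonneg R)]
  obtain ⟨g0, hg0⟩ := exists_antideriv (s ^ 2)
  set g : ℝ[X] := C (g0.eval R) - g0 with hg
  have hgd : derivative g = -(s ^ 2) := by simp [hg, hg0]
  have hgR : g.eval R = 0 := by simp [hg]
  have hder : ∀ t, HasDerivAt (fun t => g.eval t) (-(s.eval t ^ 2)) t := by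
    intro t
    have := g.hasDerivAt t
    rw [hgd] at this
    simpa using this
  have hanti : Antitone (fun t => g.eval t) := by
    apply antitone_of_deriv_nonpos g.differentiable
    intro t; rw [(hder t).deriv]; nlinarith [sq_nonneg (s.eval t)]
  set κ : ℝ := R / (4 * j) with hκ
  have hκ0 : 0 < κ := by positivity
  have hsmall : R ^ 3 / (2 * j ^ 2) ≤ ε * κ := by
    rw [hκ, div_le_iff₀ (by positivity)]
    have : ε * (R / (4 * j)) * (2 * j ^ 2) = R * (j * ε) / 2 := by field_simp; ring
    rw [this]; nlinarith
  refine ⟨s, g, κ, hκ0, hgd, ?_, ?_, ?_, ?_⟩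
  · intro t ht
    refine (hpt t ht).trans (le_trans ?_ hsmall)
    gcongr
    norm_num
  · set c : ℝ := R ^ 2 / (2 * j ^ 2) with hc
    have hc0 : 0 ≤ c := by positivity
    have hm : MonotoneOn (fun t => g.eval t + c * t) (Set.Icc 1 R) := by
      apply monotoneOn_of_deriv_nonneg (convex_Icc _ _)
      · fun_prop
      · fun_prop
      · intro t ht
        rw [interior_Icc] at ht
        have h1 := ((hder t).fun_add ((hasDerivAt_id t).const_mul c)).deriv
        simp only [id] at h1
        rw [h1]
        have h2 := hpt t (by rw [abs_of_pos (by linarith [ht.1])]; exact ht.2.le)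
        have h3 : s.eval t ^ 2 ≤ (s.eval t * t) ^ 2 := by
          rw [mul_pow]
          have : 1 ≤ t ^ 2 := by nlinarith [ht.1]
          nlinarith [sq_nonneg (s.eval t)]
        linarith
    have h1 := hm ⟨le_refl _, hR⟩ ⟨hR, le_refl _⟩ hR
    simp only [hgR] at h1
    have h2 : c * R = R ^ 3 / (2 * j ^ 2) := by rw [hc]; ring
    linarith
  · intro t ht
    have := hanti (le_of_abs_le ht)
    simpa [hgR] using this
  · intro t ht
    set δ : ℝ := R / (2 * j) with hδ
    have hδ0 : 0 < δ := by positivity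
    have hδR : δ ≤ R := by
      rw [hδ, div_le_iff₀ (by positivity)]; nlinarith
    have hm : AntitoneOn (fun t => g.eval t + (1 / 2) * t) (Set.Icc 0 δ) := by
      apply antitoneOn_of_deriv_nonpos (convex_Icc _ _)
      · fun_prop
      · fun_prop
      · intro t ht
        rw [interior_Icc] at ht
        have h1 := ((hder t).fun_add ((hasDerivAt_id t).const_mul (1 / 2))).deriv
        simp only [id] at h1
        rw [h1, hse2]
        have hsq : (t / R) ^ 2 ≤ 1 / (4 * j ^ 2) := by
          have : t / R ≤ 1 / (2 * j) := by
            rw [div_le_iff₀ hR0]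
            have := ht.2.le
            rw [hδ] at this
            calc t ≤ _ := this
              _ = _ := by ring
          calc (t / R) ^ 2 ≤ (1 / (2 * j)) ^ 2 := by
                gcongr
                exact div_nonneg ht.1.le hR0.le
            _ = _ := by ring
        have hb := one_add_mul_le_pow (a := -(t / R) ^ 2)
          (by have := hu t (by rw [abs_of_pos ht.1]; linarith [ht.2]); linarith) (2 * j ^ 2)
        rw [← sub_eq_add_neg] at hb
        push_cast at hb
        have h5 : (2 * (j : ℝ) ^ 2) * (t / R) ^ 2 ≤ 1 / 2 := by
          calc (2 * (j : ℝ) ^ 2) * (t / R) ^ 2 ≤ (2 * (j : ℝ) ^ 2) * (1 / (4 * j ^ 2)) := by gcongr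
            _ = 1 / 2 := by field_simp; norm_num
        linarith
    have h1 := hm ⟨le_refl _, hδ0.le⟩ ⟨hδ0.le, le_refl _⟩ hδ0.le
    have h2 := hanti ht
    have h3 := hanti hδR
    simp only [hgR] at h1 h2 h3
    have h4 : κ = 1 / 2 * δ := by rw [hκ, hδ]; field_simp; norm_num
    linarith

end PolyStep

namespace RTr
variable {B : Type*} [CStarAlgebra B] [PartialOrder B] [StarOrderedRing B] {ψ : B →ₗ[ℝ] ℝ}

theorem path_nonneg (h : RTr ψ) {K K' : ℝ → B} {a R L C : ℝ} (ha : 0 ≤ a) (hR : 1 ≤ R)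
    (hL0 : 0 ≤ L) (hC0 : 0 ≤ C)
    (hsa : ∀ z ∈ Set.Icc 0 a, IsSelfAdjoint (K z))
    (hKR : ∀ z ∈ Set.Icc 0 a, ‖K z‖ ≤ R)
    (hder : ∀ z ∈ Set.Icc 0 a, HasDerivAt K (K' z) z)
    (hsa' : ∀ z ∈ Set.Icc 0 a, IsSelfAdjoint (K' z))
    (hL : ∀ z ∈ Set.Icc 0 a, ‖K' z‖ ≤ L)
    (hN : ∀ z ∈ Set.Icc 0 a, ∀ s, N ψ s ≤ C * ‖s * K z‖ ^ 2)
    (h0 : K 0 = 1) : 0 ≤ K a := by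
  have haI : a ∈ Set.Icc 0 a := ⟨ha, le_refl _⟩
  -- the key estimate
  have key : ∀ ε > 0, ψ ((K a)⁻) ≤ R * (ε * (1 + a * (L * C))) := by
    intro ε hε
    obtain ⟨s, g, κ, hκ, hgd, hs, hg1, hg0, hgκ⟩ := exists_step R hR ε hε
    have hfder : ∀ z ∈ Set.Icc 0 a, HasDerivAt (fun t => ψ (Polynomial.aeval (K t) g))
      (ψ (Polynomial.aeval (K z) (Polynomial.derivative g) * K' z)) z :=
      fun z hz => h.hasDerivAt_poly (hder z hz) g
    have hbound : ∀ z ∈ Set.Icc 0 a,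
        ψ (Polynomial.aeval (K z) (Polynomial.derivative g) * K' z) ≤ L * (C * (ε * κ)) := by
      intro z hz
      set S := Polynomial.aeval (K z) s with hS
      have hSsa : IsSelfAdjoint S := aeval_sa (hsa z hz) s
      have e1 : ψ (Polynomial.aeval (K z) (Polynomial.derivative g) * K' z)
          = ψ (Star.star S * (-K' z) * S) := by
        rw [hgd, hSsa.star_eq, h.comm (S * (-K' z)) S]
        simp [← hS, sq, mul_assoc]
      have e2 : Star.star S * (-K' z) * S ≤ Star.star S * (algebraMap ℝ B L) * S := by
        apply star_left_conjugate_le_conjugate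
        have h1 := (hsa' z hz).neg.le_algebraMap_norm_self
        rw [norm_neg] at h1
        exact h1.trans (algebraMap_mono B (hL z hz))
      have e3 : Star.star S * (algebraMap ℝ B L) * S = L • (Star.star S * S) := by
        rw [Algebra.algebraMap_eq_smul_one]; simp
      have e4 := h.mono e2
      rw [e3, map_smul] at e4
      rw [e1]
      refine e4.trans (mul_le_mul_of_nonneg_left ?_ hL0)
      refine (hN z hz S).trans (mul_le_mul_of_nonneg_left ?_ hC0)
      have e5 : S * K z = Polynomial.aeval (K z) (s * Polynomial.X) := by simp [hS]
      have e6 : ‖S * K z‖ ≤ Real.sqrt (ε * κ) := by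
        rw [e5]
        apply norm_aeval_le (hsa z hz) _ (Real.sqrt_nonneg _) (hKR z hz)
        intro t ht
        apply Real.abs_le_sqrt
        simpa using hs t ht
      calc ‖S * K z‖ ^ 2 ≤ Real.sqrt (ε * κ) ^ 2 := by gcongr
        _ = _ := Real.sq_sqrt (by positivity)
    have hfa : ψ (Polynomial.aeval (K a) g) ≤ ε * κ + (L * (C * (ε * κ))) * a := by
      have h1 := (convex_Icc (0 : ℝ) a).image_sub_le_mul_sub_of_deriv_le
        (f := fun t => ψ (Polynomial.aeval (K t) g)) (C := L * (C * (ε * κ)))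
        (fun z hz => (hfder z hz).continuousAt.continuousWithinAt)
        (fun z hz => (hfder z (interior_subset hz)).differentiableAt.differentiableWithinAt)
        (fun z hz => by rw [(hfder z (interior_subset hz)).deriv]; exact hbound z (interior_subset hz))
        0 ⟨le_refl _, ha⟩ a haI ha
      have h2 : ψ (Polynomial.aeval (K 0) g) = g.eval 1 := by
        rw [h0]
        have : Polynomial.aeval (1 : B) g = algebraMap ℝ B (g.eval 1) := by
          have := Polynomial.aeval_algebraMap_apply_eq_algebraMap_eval (A := B) (1 : ℝ) g
          simpa using this
        rw [this, Algebra.algebraMap_eq_smul_one, map_smul, h.one]; simp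
      simp only [h2] at h1
      linarith
    have hneg : κ • (K a)⁻ ≤ R • Polynomial.aeval (K a) g := by
      have hsaa := hsa a haI
      rw [← cfc_polynomial g (K a), CFC.negPart_def, cfcₙ_eq_cfc (hf0 := by simp),
        ← cfc_smul _ _ _ (by fun_prop), ← cfc_smul _ _ _ (by fun_prop)]
      apply cfc_mono _ (by fun_prop) (by fun_prop)
      intro t ht
      have htR := spec_abs_le (hKR a haI) ht
      simp only [smul_eq_mul]
      rcases le_total t 0 with h1 | h1
      · rw [negPart_eq_neg.2 h1]
        have := hgκ t h1
        have h3 : -t ≤ R := (neg_le_abs t).trans htR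
        nlinarith
      · rw [negPart_eq_zero.2 h1]
        have := hg0 t htR
        simp; positivity
    have h5 := h.mono hneg
    rw [map_smul, map_smul, smul_eq_mul, smul_eq_mul] at h5
    have h6 : κ * ψ ((K a)⁻) ≤ κ * (R * (ε * (1 + a * (L * C)))) := by
      refine h5.trans ((mul_le_mul_of_nonneg_left hfa (by linarith)).trans (le_of_eq (by ring)))
    exact le_of_mul_le_mul_left h6 hκ
  have hnn : 0 ≤ ψ ((K a)⁻) := h.nonneg (CFC.negPart_nonneg _)
  have hz : ψ ((K a)⁻) = 0 := by
    refine le_antisymm ?_ hnn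
    have hD : 0 < R * (1 + a * (L * C)) := by positivity
    apply le_of_forall_pos_le_add
    intro η hη
    have := key (η / (R * (1 + a * (L * C)))) (by positivity)
    rw [zero_add]
    refine this.trans (le_of_eq ?_)
    field_simp
  have h7 := h.eq_zero (CFC.negPart_nonneg _) hz
  exact (CFC.negPart_eq_zero_iff _ (hsa a haI)).1 h7

end RTr
namespace RTr
variable {B : Type*} [CStarAlgebra B] [PartialOrder B] [StarOrderedRing B] {ψ : B →ₗ[ℝ] ℝ}
  {n : ℕ}

/-- Span of the reduced words not starting with `j`. -/
noncomputable def P (X : Fin n → B) (j : Fin n) : Submodule ℝ B :=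
  Submodule.span ℝ {b | ∃ w : List (Fin n), (j :: w).IsChain (· ≠ ·) ∧ b = (w.map X).prod}

/-- Weighted sums of the reduced words not starting with `i`, of length at most `N`. -/
noncomputable def T (X : Fin n → B) (z : ℝ) : ℕ → Fin n → B
  | 0, _ => 1
  | N + 1, i => 1 + z • ∑ j ∈ Finset.univ.erase i, X j * T X z N j

theorem T_succ (X : Fin n → B) (z : ℝ) (N' : ℕ) (i : Fin n) :
    T X z (N' + 1) i = 1 + z • ∑ j ∈ Finset.univ.erase i, X j * T X z N' j := rfl

theorem one_mem_P (X : Fin n → B) (j : Fin n) : (1 : B) ∈ P X j :=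
  Submodule.subset_span ⟨[], by simp, by simp⟩

theorem mul_mem_P (X : Fin n → B) {j l : Fin n} (hjl : j ≠ l) {b : B} (hb : b ∈ P X l) :
    X l * b ∈ P X j := by
  induction hb using Submodule.span_induction with
  | mem b hb =>
    obtain ⟨w, hw, rfl⟩ := hb
    exact Submodule.subset_span ⟨l :: w, List.isChain_cons_cons.2 ⟨hjl, hw⟩, by simp⟩
  | zero => simp
  | add a b _ _ ha hb => rw [mul_add]; exact Submodule.add_mem _ ha hb
  | smul c a _ ha => rw [mul_smul_comm]; exact Submodule.smul_mem _ _ ha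

theorem T_mem_P (X : Fin n → B) (z : ℝ) (N : ℕ) (i : Fin n) : T X z N i ∈ P X i := by
  induction N generalizing i with
  | zero => exact one_mem_P X i
  | succ N ih =>
    refine Submodule.add_mem _ (one_mem_P X i) (Submodule.smul_mem _ _ (Submodule.sum_mem _ ?_))
    intro j hj
    exact mul_mem_P X (Finset.ne_of_mem_erase hj).symm (ih j)

theorem star_word {X : Fin n → B} (hX : ∀ i, IsSelfAdjoint (X i)) (w : List (Fin n)) :
    Star.star (w.map X).prod = (w.reverse.map X).prod := by
  induction w with
  | nil => simp
  | cons a w ih => simp [ih, (hX a).star_eq]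

theorem orth_one {X : Fin n → B}
    (hw : ∀ w : List (Fin n), w ≠ [] → w.IsChain (· ≠ ·) → ψ (w.map X).prod = 0)
    {l : Fin n} {b : B} (hb : b ∈ P X l) : ψ (X l * b) = 0 := by
  induction hb using Submodule.span_induction with
  | mem b hb =>
    obtain ⟨w, hw', rfl⟩ := hb
    simpa using hw (l :: w) (by simp) hw'
  | zero => simp
  | add a b _ _ ha hb => rw [mul_add, map_add, ha, hb, add_zero]
  | smul c a _ ha => rw [mul_smul_comm, map_smul, ha, smul_zero]

theorem orth {X : Fin n → B} (hX : ∀ i, IsSelfAdjoint (X i))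
    (hw : ∀ w : List (Fin n), w ≠ [] → w.IsChain (· ≠ ·) → ψ (w.map X).prod = 0)
    {j l : Fin n} (hjl : j ≠ l) {a b : B} (ha : a ∈ P X j) (hb : b ∈ P X l) :
    ψ (Star.star (X j * a) * (X l * b)) = 0 := by
  induction ha using Submodule.span_induction with
  | mem a ha =>
    obtain ⟨w, hw1, rfl⟩ := ha
    induction hb using Submodule.span_induction with
    | mem b hb =>
      obtain ⟨v, hv, rfl⟩ := hb
      have hc : ((w.reverse ++ [j]) ++ (l :: v)).IsChain (· ≠ ·) := by
        refine List.IsChain.append ?_ hv ?_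
        · rw [← List.reverse_cons, List.isChain_reverse]
          exact hw1.imp fun _ _ h => h.symm
        · intro x hx y hy
          simp at hx hy
          subst hx hy
          exact hjl
      have := hw _ (by simp) hc
      rw [star_mul, star_word hX, (hX j).star_eq]
      simpa [mul_assoc] using this
    | zero => simp
    | add a b _ _ ha hb => rw [mul_add, mul_add, map_add, ha, hb, add_zero]
    | smul c a _ ha => rw [mul_smul_comm, mul_smul_comm, map_smul, ha, smul_zero]
  | zero => simp
  | add a b _ _ ha hb => rw [mul_add, star_add, add_mul, map_add, ha, hb, add_zero]
  | smul c a _ ha =>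
    rw [mul_smul_comm, star_smul, smul_mul_assoc, map_smul, ha, smul_zero]

theorem N_sum_le (h : RTr ψ) {X : Fin n → B} (hX : ∀ i, IsSelfAdjoint (X i))
    (hX1 : ∀ i, ‖X i‖ ≤ 1)
    (hw : ∀ w : List (Fin n), w ≠ [] → w.IsChain (· ≠ ·) → ψ (w.map X).prod = 0)
    (s : Finset (Fin n)) (c : Fin n → B) (hc : ∀ i, c i ∈ P X i) (α z : ℝ) :
    N ψ (α • (1 : B) + z • ∑ j ∈ s, X j * c j) ≤ α ^ 2 + z ^ 2 * ∑ j ∈ s, N ψ (c j) := by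
  set S := ∑ j ∈ s, X j * c j with hS
  have h1 : ψ S = 0 := by
    rw [hS, map_sum]
    exact Finset.sum_eq_zero fun j _ => orth_one hw (hc j)
  have h2 : ψ (Star.star S) = 0 := by rw [h.star, h1]
  have h3 : ψ (Star.star S * S) = ∑ j ∈ s, N ψ (X j * c j) := by
    rw [hS, star_sum, Finset.sum_mul_sum, map_sum]
    refine Finset.sum_congr rfl fun j hj => ?_
    rw [map_sum, Finset.sum_eq_single j]
    · rfl
    · intro l _ hl
      exact orth hX hw hl.symm (hc j) (hc l)
    · exact fun hh => absurd hj hh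
  have h4 : ∑ j ∈ s, N ψ (X j * c j) ≤ ∑ j ∈ s, N ψ (c j) := by
    refine Finset.sum_le_sum fun j _ => (h.N_mul_le _ _).trans ?_
    have : ‖X j‖ ^ 2 ≤ 1 := pow_le_one₀ (norm_nonneg _) (hX1 j)
    nlinarith [h.N_nonneg (c j)]
  have h5 : N ψ (α • (1 : B) + z • S) = α ^ 2 + z ^ 2 * ψ (Star.star S * S) := by
    simp only [N, star_add, star_smul, star_one, star_trivial, mul_add, add_mul, map_add,
      smul_mul_smul_comm, one_mul, mul_one, map_smul, h1, h2, h.one, smul_eq_mul]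
    ring
  rw [h5, h3]
  have := mul_le_mul_of_nonneg_left h4 (sq_nonneg z)
  linarith

theorem N_T_le (h : RTr ψ) {X : Fin n → B} (hX : ∀ i, IsSelfAdjoint (X i))
    (hX1 : ∀ i, ‖X i‖ ≤ 1)
    (hw : ∀ w : List (Fin n), w ≠ [] → w.IsChain (· ≠ ·) → ψ (w.map X).prod = 0)
    {z C : ℝ} (hC : 1 ≤ C) (hz : 1 + z ^ 2 * (((n - 1 : ℕ) : ℝ) * C) ≤ C) (N' : ℕ) (i : Fin n) :
    N ψ (T X z N' i) ≤ C := by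
  induction N' generalizing i with
  | zero => simpa [T, N, h.one] using hC
  | succ N' ih =>
    have h1 := h.N_sum_le hX hX1 hw (Finset.univ.erase i) (T X z N') (T_mem_P X z N') 1 z
    rw [one_smul] at h1
    refine h1.trans (le_trans ?_ hz)
    have : ∑ j ∈ Finset.univ.erase i, N ψ (T X z N' j) ≤ ((n - 1 : ℕ) : ℝ) * C := by
      refine (Finset.sum_le_card_nsmul _ _ C fun j _ => ih j).trans ?_
      simp
    have := mul_le_mul_of_nonneg_left this (sq_nonneg z)
    linarith

theorem N_D_le (h : RTr ψ) {X : Fin n → B} (hX : ∀ i, IsSelfAdjoint (X i))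
    (hX1 : ∀ i, ‖X i‖ ≤ 1)
    (hw : ∀ w : List (Fin n), w ≠ [] → w.IsChain (· ≠ ·) → ψ (w.map X).prod = 0)
    {z : ℝ} (N' : ℕ) (i : Fin n) :
    N ψ (T X z (N' + 1) i - T X z N' i) ≤ (z ^ 2 * ((n - 1 : ℕ) : ℝ)) ^ (N' + 1) := by
  induction N' generalizing i with
  | zero =>
    have h1 := h.N_sum_le hX hX1 hw (Finset.univ.erase i) (fun _ => 1) (one_mem_P X) 0 z
    have e : T X z (0 + 1) i - T X z 0 i
        = (0 : ℝ) • (1 : B) + z • ∑ j ∈ Finset.univ.erase i, X j * 1 := by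
      simp [T]
    rw [e]
    refine h1.trans (le_of_eq ?_)
    simp [N, h.one]
  | succ N' ih =>
    have h1 := h.N_sum_le hX hX1 hw (Finset.univ.erase i)
      (fun j => T X z (N' + 1) j - T X z N' j)
      (fun j => Submodule.sub_mem _ (T_mem_P X z _ j) (T_mem_P X z _ j)) 0 z
    have e : T X z (N' + 1 + 1) i - T X z (N' + 1) i
        = (0 : ℝ) • (1 : B) + z • ∑ j ∈ Finset.univ.erase i,
          X j * (T X z (N' + 1) j - T X z N' j) := by
      rw [T_succ X z (N' + 1) i, T_succ X z N' i]
      simp only [mul_sub, Finset.sum_sub_distrib, smul_sub, zero_smul]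
      abel
    rw [e]
    refine h1.trans ?_
    have : ∑ j ∈ Finset.univ.erase i, N ψ (T X z (N' + 1) j - T X z N' j)
        ≤ ((n - 1 : ℕ) : ℝ) * (z ^ 2 * ((n - 1 : ℕ) : ℝ)) ^ (N' + 1) := by
      refine (Finset.sum_le_card_nsmul _ _ _ fun j _ => ih j).trans ?_
      simp
    have := mul_le_mul_of_nonneg_left this (sq_nonneg z)
    rw [pow_succ _ (N' + 1)]
    linarith

/-- The `L²` inverse of `K` gives a lower bound. -/
theorem N_le_of_K (h : RTr ψ) {X : Fin n → B} (hX : ∀ i, IsSelfAdjoint (X i))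
    (hX1 : ∀ i, ‖X i‖ ≤ 1)
    (hw : ∀ w : List (Fin n), w ≠ [] → w.IsChain (· ≠ ·) → ψ (w.map X).prod = 0)
    {z C : ℝ} (hC : 1 ≤ C) (hz : 1 + z ^ 2 * (((n - 1 : ℕ) : ℝ) * C) ≤ C)
    (hz1 : z ^ 2 * ((n - 1 : ℕ) : ℝ) < 1)
    (R : Fin n → B) (hR : ∀ i, R i * (1 + z • X i) = 1) (s : B) :
    N ψ s ≤ 2 * (1 + z ^ 2 * (n * C)) * ‖s * (∑ i, R i - ((n : ℝ) - 1) • 1)‖ ^ 2 := by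
  set K := ∑ i, R i - ((n : ℝ) - 1) • (1 : B) with hK
  let Y : ℕ → B := fun k => 1 + z • ∑ j, X j * T X z k j
  let D : ℕ → Fin n → B := fun k i => T X z (k + 1) i - T X z k i
  have hNY : ∀ k, N ψ (Y k) ≤ 1 + z ^ 2 * (n * C) := by
    intro k
    have h1 := h.N_sum_le hX hX1 hw Finset.univ (T X z k) (T_mem_P X z k) 1 z
    rw [one_smul] at h1
    refine h1.trans ?_
    have : ∑ j, N ψ (T X z k j) ≤ n * C := by
      refine (Finset.sum_le_card_nsmul _ _ _ fun j _ => h.N_T_le hX hX1 hw hC hz k j).trans ?_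
      simp
    have := mul_le_mul_of_nonneg_left this (sq_nonneg z)
    linarith
  have hYT : ∀ k i, Y k = T X z (k + 1) i + z • (X i * T X z k i) := by
    intro k i
    simp only [Y, T_succ]
    rw [← Finset.add_sum_erase _ _ (Finset.mem_univ i), smul_add]
    abel
  have hKY : ∀ k, K * Y k - 1 = ∑ i, (R i * D k i - D k i) := by
    intro k
    have h1 : ∀ i, R i * Y k = T X z (k + 1) i + (R i * D k i - D k i) := by
      intro i
      have e : Y k = (1 + z • X i) * T X z k i + D k i := by
        rw [hYT k i]; simp only [D, add_mul, one_mul, smul_mul_assoc]; abel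
      rw [e, mul_add, ← mul_assoc, hR, one_mul]; simp only [D]; abel
    have h2 : ∑ i, T X z (k + 1) i = (n : ℝ) • Y k - (Y k - 1) := by
      have e : ∀ i, T X z (k + 1) i = Y k - z • (X i * T X z k i) := by
        intro i; rw [hYT k i]; abel
      rw [Finset.sum_congr rfl fun i _ => e i, Finset.sum_sub_distrib, ← Finset.smul_sum]
      simp only [Y, Finset.sum_const, Finset.card_univ, Fintype.card_fin, add_sub_cancel_left]
      rw [← Nat.cast_smul_eq_nsmul ℝ]
    rw [hK, sub_mul, Finset.sum_mul, Finset.sum_congr rfl fun i _ => h1 i,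
      Finset.sum_add_distrib, h2, smul_mul_assoc, one_mul, sub_smul, one_smul]
    abel
  have hlimD : ∀ i, Filter.Tendsto (fun k => N ψ (D k i)) Filter.atTop (nhds 0) := by
    intro i
    have h1 : Filter.Tendsto (fun k : ℕ => (z ^ 2 * ((n - 1 : ℕ) : ℝ)) ^ (k + 1)) Filter.atTop
        (nhds 0) :=
      (Filter.tendsto_add_atTop_iff_nat 1).2 (tendsto_pow_atTop_nhds_zero_of_lt_one (by positivity) hz1)
    exact squeeze_zero (fun k => h.N_nonneg _) (fun k => h.N_D_le hX hX1 hw k i) h1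
  have hlimE : ∀ i, Filter.Tendsto (fun k => N ψ (R i * D k i - D k i)) Filter.atTop (nhds 0) := by
    intro i
    have h1 := (hlimD i).const_mul (‖R i - 1‖ ^ 2)
    rw [mul_zero] at h1
    refine squeeze_zero (fun k => h.N_nonneg _) (fun k => ?_) h1
    have := h.N_mul_le (R i - 1) (D k i)
    rwa [sub_mul, one_mul] at this
  have hlimS : ∀ t : Finset (Fin n), Filter.Tendsto (fun k => N ψ (∑ i ∈ t, (R i * D k i - D k i)))
      Filter.atTop (nhds 0) := by
    intro t
    induction t using Finset.induction_on with
    | empty => simp [N]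
    | insert a t hat ih =>
      have h1 := ((hlimE a).const_mul 2).add (ih.const_mul 2)
      simp only [mul_zero, add_zero] at h1
      refine squeeze_zero (fun k => h.N_nonneg _) (fun k => ?_) h1
      rw [Finset.sum_insert hat]
      exact h.N_add_le _ _
  have hb : ∀ k, N ψ s ≤ 2 * (1 + z ^ 2 * (n * C)) * ‖s * K‖ ^ 2
      + 2 * ‖s‖ ^ 2 * N ψ (∑ i, (R i * D k i - D k i)) := by
    intro k
    have e : s = (s * K) * Y k + (-s) * (K * Y k - 1) := by
      simp only [mul_sub, mul_one, neg_mul, mul_assoc]; abel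
    have h1 := h.N_add_le ((s * K) * Y k) ((-s) * (K * Y k - 1))
    rw [← e] at h1
    have h2 := h.N_mul_le (s * K) (Y k)
    have h3 := h.N_mul_le (-s) (K * Y k - 1)
    rw [norm_neg, hKY k] at h3
    rw [hKY k] at h1
    have h4 := mul_le_mul_of_nonneg_left (hNY k) (sq_nonneg ‖s * K‖)
    linarith
  have hlim := ((hlimS Finset.univ).const_mul (2 * ‖s‖ ^ 2)).const_add
    (2 * (1 + z ^ 2 * (n * C)) * ‖s * K‖ ^ 2)
  rw [mul_zero, add_zero] at hlim
  exact ge_of_tendsto' hlim hb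

end RTr
namespace RTr
variable {B : Type*} [CStarAlgebra B] [PartialOrder B] [StarOrderedRing B] {ψ : B →ₗ[ℝ] ℝ}
  {n : ℕ}

theorem isUnit_aux {X : B} (hX1 : ‖X‖ ≤ 1) {z : ℝ} (hz0 : 0 ≤ z) (hz : z < 1) :
    IsUnit (1 + z • X) := by
  have : ‖-(z • X)‖ < 1 := by
    rw [norm_neg, norm_smul, Real.norm_of_nonneg hz0]
    nlinarith [norm_nonneg X]
  have h := (Units.oneSub (-(z • X)) this).isUnit
  simpa using h

theorem norm_R_le [Nontrivial B] {X R : B} (hX1 : ‖X‖ ≤ 1) {z a : ℝ} (hz0 : 0 ≤ z) (hza : z ≤ a)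
    (ha : a < 1) (hR : R * (1 + z • X) = 1) : ‖R‖ ≤ 1 / (1 - a) := by
  have e : R = 1 - z • (R * X) := by
    rw [mul_add, mul_one, mul_smul_comm] at hR
    rw [← hR]; abel
  have h1 : ‖R‖ ≤ 1 + z * (‖R‖ * ‖X‖) := by
    calc ‖R‖ = ‖1 - z • (R * X)‖ := by rw [← e]
      _ ≤ ‖(1 : B)‖ + ‖z • (R * X)‖ := norm_sub_le _ _
      _ ≤ 1 + z * (‖R‖ * ‖X‖) := by
        rw [norm_smul, Real.norm_of_nonneg hz0, CStarRing.norm_one]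
        gcongr
        exact norm_mul_le _ _
  rw [le_div_iff₀ (by linarith)]
  have h2 : ‖R‖ * ‖X‖ ≤ ‖R‖ := mul_le_of_le_one_right (norm_nonneg _) hX1
  have h3 : z * (‖R‖ * ‖X‖) ≤ a * ‖R‖ := by
    apply mul_le_mul hza h2 (by positivity) (by linarith)
  linarith

theorem R_le {X R : B} (hX : IsSelfAdjoint X) (hX1 : ‖X‖ ≤ 1) {a : ℝ} (h0 : 0 ≤ a) (ha : a ≤ 1)
    (hR : R * (1 + a • X) = 1) (hR' : (1 + a • X) * R = 1) (hRs : IsSelfAdjoint R) :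
    (1 - a ^ 2) • R ≤ 1 - a • X := by
  have p1 : 0 ≤ 1 - X := by
    have := hX.le_algebraMap_norm_self.trans (algebraMap_mono B hX1)
    simpa using this
  have p2 : 0 ≤ 1 - X * X := by
    have h1 := CStarAlgebra.star_mul_le_algebraMap_norm_sq (a := X)
    have h2 := h1.trans (algebraMap_mono B (pow_le_one₀ (norm_nonneg _) hX1))
    rw [hX.star_eq] at h2
    simpa using h2
  have p3 : 0 ≤ (1 + X) * (1 - X) * (1 + X) := by
    have := star_left_conjugate_nonneg p1 (1 + X)
    rwa [star_add, star_one, hX.star_eq] at this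
  have p4 : 0 ≤ (1 - X * X) * (1 + a • X) := by
    have e : (1 - X * X) * (1 + a • X)
        = (1 - a) • (1 - X * X) + a • ((1 + X) * (1 - X) * (1 + X)) := by
      simp only [mul_add, add_mul, mul_sub, sub_mul, mul_one, one_mul, smul_add, smul_sub,
        sub_smul, one_smul, mul_smul_comm, mul_assoc]
      abel
    rw [e]
    exact add_nonneg (smul_nonneg (by linarith) p2) (smul_nonneg h0 p3)
  have p5 : 0 ≤ R * ((1 - X * X) * (1 + a • X)) * R := by
    have := star_left_conjugate_nonneg p4 R
    rwa [hRs.star_eq] at this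
  have e1 : R * ((1 - X * X) * (1 + a • X)) * R = R * (1 - X * X) := by
    rw [mul_assoc, mul_assoc (1 - X * X), hR', mul_one]
  have e2 : (a ^ 2) • (R * (1 - X * X)) = (1 - a • X) - (1 - a ^ 2) • R := by
    have e3 : (a ^ 2) • (1 - X * X) = (1 + a • X) * (1 - a • X) - (1 - a ^ 2) • (1 : B) := by
      simp only [mul_sub, add_mul, mul_one, one_mul, smul_sub, sub_smul, one_smul,
        ← sq, smul_pow]
      abel
    rw [← mul_smul_comm, e3, mul_sub, ← mul_assoc, hR, one_mul, mul_smul_comm, mul_one]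
  rw [← sub_nonneg, ← e2, ← e1]
  exact smul_nonneg (by positivity) p5

theorem smul_sum_le (h : RTr ψ) {X : Fin n → B} (hX : ∀ i, IsSelfAdjoint (X i))
    (hX1 : ∀ i, ‖X i‖ ≤ 1)
    (hw : ∀ w : List (Fin n), w ≠ [] → w.IsChain (· ≠ ·) → ψ (w.map X).prod = 0)
    (hn : 2 ≤ n) {a : ℝ} (ha0 : 0 ≤ a) (haq : ((n : ℝ) - 1) * a ^ 2 < 1) :
    a • ∑ i, X i ≤ (1 + ((n : ℝ) - 1) * a ^ 2) • (1 : B) := by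
  have := h.nontriv
  have hn2 : (2 : ℝ) ≤ n := by exact_mod_cast hn
  have ha1 : a < 1 := by nlinarith
  have hcast : ((n - 1 : ℕ) : ℝ) = (n : ℝ) - 1 := by
    rw [Nat.cast_sub (by omega)]; simp
  let R : ℝ → Fin n → B := fun z i => Ring.inverse (1 + z • X i)
  have hz1 : ∀ z ∈ Set.Icc 0 a, z < 1 := fun z hz => hz.2.trans_lt ha1
  have hu : ∀ z ∈ Set.Icc 0 a, ∀ i, IsUnit (1 + z • X i) := fun z hz i =>
    isUnit_aux (hX1 i) hz.1 (hz1 z hz)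
  have hR : ∀ z ∈ Set.Icc 0 a, ∀ i, R z i * (1 + z • X i) = 1 := fun z hz i =>
    Ring.inverse_mul_cancel _ (hu z hz i)
  have hR' : ∀ z ∈ Set.Icc 0 a, ∀ i, (1 + z • X i) * R z i = 1 := fun z hz i =>
    Ring.mul_inverse_cancel _ (hu z hz i)
  have hRs : ∀ z ∈ Set.Icc 0 a, ∀ i, IsSelfAdjoint (R z i) := by
    intro z hz i
    have e1 : (1 + z • X i) * Star.star (R z i) = 1 := by
      have := congrArg Star.star (hR z hz i)
      rw [star_mul, star_one, star_add, star_one, star_smul, (hX i).star_eq, star_trivial] at this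
      exact this
    have e2 := hR z hz i
    calc Star.star (R z i) = (R z i * (1 + z • X i)) * Star.star (R z i) := by rw [e2, one_mul]
      _ = R z i := by rw [mul_assoc, e1, mul_one]
  have hRn : ∀ z ∈ Set.Icc 0 a, ∀ i, ‖R z i‖ ≤ 1 / (1 - a) := fun z hz i =>
    norm_R_le (hX1 i) hz.1 hz.2 ha1 (hR z hz i)
  have hRd : ∀ z ∈ Set.Icc 0 a, ∀ i, HasDerivAt (fun t => R t i) (-(R z i * X i * R z i)) z := by
    intro z hz i
    obtain ⟨u, hu'⟩ := hu z hz i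
    have h1 : HasDerivAt (fun t : ℝ => 1 + t • X i) (X i) z := by
      have := ((hasDerivAt_id z).smul_const (X i)).const_add 1
      simpa using this
    have h2 := hasFDerivAt_ringInverse (𝕜 := ℝ) u
    rw [hu'] at h2
    have h3 := h2.comp_hasDerivAt z h1
    have h4 : R z i = ↑u⁻¹ := by simp only [R]; rw [← hu', Ring.inverse_unit]
    rw [h4]
    simpa [Function.comp_def] using h3
  let K : ℝ → B := fun z => ∑ i, R z i - ((n : ℝ) - 1) • (1 : B)
  let K' : ℝ → B := fun z => ∑ i, -(R z i * X i * R z i)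
  have hpos : 0 < 1 - a := by linarith
  set C : ℝ := 1 / (1 - ((n : ℝ) - 1) * a ^ 2) with hC
  have hd : 0 < 1 - ((n : ℝ) - 1) * a ^ 2 := by linarith
  have hC1 : 1 ≤ C := by
    rw [hC, le_div_iff₀ hd]
    nlinarith [mul_nonneg (by linarith : (0:ℝ) ≤ n - 1) (sq_nonneg a)]
  have hCe : 1 + ((n : ℝ) - 1) * a ^ 2 * C = C := by rw [hC]; field_simp; ring
  have hK : 0 ≤ K a := by
    apply h.path_nonneg (K := K) (K' := K') (R := n * (1 / (1 - a)) + n)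
      (L := n * (1 / (1 - a) * 1 * (1 / (1 - a)))) (C := 2 * (1 + a ^ 2 * (n * C))) ha0
    · have : 0 ≤ n * (1 / (1 - a)) := by positivity
      linarith
    · positivity
    · positivity
    · intro z hz
      refine IsSelfAdjoint.sub (isSelfAdjoint_sum _ fun i _ => hRs z hz i) ?_
      simp [IsSelfAdjoint]
    · intro z hz
      refine (norm_sub_le _ _).trans (add_le_add ?_ ?_)
      · refine (norm_sum_le_of_le _ fun i _ => hRn z hz i).trans ?_
        simp
      · rw [norm_smul, CStarRing.norm_one, Real.norm_of_nonneg (by linarith)]; linarith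
    · intro z hz
      exact (HasDerivAt.fun_sum fun i _ => hRd z hz i).sub_const _
    · intro z hz
      refine isSelfAdjoint_sum _ fun i _ => IsSelfAdjoint.neg ?_
      simp [IsSelfAdjoint, (hRs z hz i).star_eq, (hX i).star_eq, mul_assoc]
    · intro z hz
      have : ∀ i ∈ Finset.univ, ‖-(R z i * X i * R z i)‖ ≤ 1 / (1 - a) * 1 * (1 / (1 - a)) := by
        intro i _
        rw [norm_neg]
        refine (norm_mul_le _ _).trans ?_
        refine mul_le_mul ((norm_mul_le _ _).trans ?_) (hRn z hz i) (norm_nonneg _) (by positivity)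
        exact mul_le_mul (hRn z hz i) (hX1 i) (norm_nonneg _) (by positivity)
      refine (norm_sum_le_of_le _ this).trans ?_
      simp
    · intro z hz s
      have hsq : z ^ 2 ≤ a ^ 2 := pow_le_pow_left₀ hz.1 hz.2 2
      have hq0 : (0 : ℝ) ≤ (n : ℝ) - 1 := by linarith
      refine (h.N_le_of_K hX hX1 hw hC1 (z := z) ?_ ?_ (R z) (hR z hz) s).trans ?_
      · rw [hcast]
        have := mul_le_mul_of_nonneg_right hsq (mul_nonneg hq0 (by linarith : 0 ≤ C))
        nlinarith
      · rw [hcast]; nlinarith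
      · gcongr
    · simp [K, R, sub_smul, ← Nat.cast_smul_eq_nsmul ℝ]
  have haI : a ∈ Set.Icc 0 a := ⟨ha0, le_refl _⟩
  have h1 : (1 - a ^ 2) • ∑ i, R a i ≤ ∑ i, (1 - a • X i) := by
    rw [Finset.smul_sum]
    exact Finset.sum_le_sum fun i _ => R_le (hX i) (hX1 i) ha0 ha1.le (hR a haI i) (hR' a haI i)
      (hRs a haI i)
  have h2 : ((1 - a ^ 2) * ((n : ℝ) - 1)) • (1 : B) ≤ (1 - a ^ 2) • ∑ i, R a i := by
    rw [mul_smul]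
    exact smul_le_smul_of_nonneg_left (sub_nonneg.1 hK) (by nlinarith)
  have h3 := h2.trans h1
  rw [Finset.sum_sub_distrib, ← Finset.smul_sum, Finset.sum_const, Finset.card_univ,
    Fintype.card_fin, ← Nat.cast_smul_eq_nsmul ℝ] at h3
  have h4 : a • ∑ i, X i ≤ (n : ℝ) • (1 : B) - ((1 - a ^ 2) * ((n : ℝ) - 1)) • (1 : B) :=
    le_sub_comm.1 h3
  refine h4.trans (le_of_eq ?_)
  rw [← sub_smul]; congr 1; ring

theorem norm_le_of_bounds {A : B} (hA : IsSelfAdjoint A) {c : ℝ} (hc : 0 ≤ c)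
    (h1 : A ≤ c • (1 : B)) (h2 : -A ≤ c • (1 : B)) : ‖A‖ ≤ c := by
  rw [← Algebra.algebraMap_eq_smul_one] at h1 h2
  have h3 : algebraMap ℝ B (-c) ≤ A := by rw [map_neg]; exact neg_le.1 h2
  rw [le_algebraMap_iff_spectrum_le] at h1
  rw [algebraMap_le_iff_le_spectrum] at h3
  rw [← cfc_id ℝ A]
  exact norm_cfc_le hc fun t ht => abs_le.2 ⟨h3 t ht, h1 t ht⟩

theorem norm_sum_le' (h : RTr ψ) {X : Fin n → B} (hX : ∀ i, IsSelfAdjoint (X i))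
    (hX1 : ∀ i, ‖X i‖ ≤ 1)
    (hw : ∀ w : List (Fin n), w ≠ [] → w.IsChain (· ≠ ·) → ψ (w.map X).prod = 0)
    (hn : 2 ≤ n) : ‖∑ i, X i‖ ≤ 2 * Real.sqrt ((n : ℝ) - 1) := by
  have hn2 : (2 : ℝ) ≤ n := by exact_mod_cast hn
  have hwneg : ∀ w : List (Fin n), w ≠ [] → w.IsChain (· ≠ ·) →
      ψ (w.map (fun i => -X i)).prod = 0 := by
    intro w hw0 hw1
    have : ∀ v : List (Fin n),
        (v.map (fun i => -X i)).prod = ((-1 : ℝ) ^ v.length) • (v.map X).prod := by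
      intro v
      induction v with
      | nil => simp
      | cons b v ih => simp [ih, pow_succ]
    rw [this, map_smul, hw w hw0 hw1, smul_zero]
  have key : ∀ a : ℝ, 0 < a → ((n : ℝ) - 1) * a ^ 2 < 1 →
      a * ‖∑ i, X i‖ ≤ 1 + ((n : ℝ) - 1) * a ^ 2 := by
    intro a ha haq
    have h1 := h.smul_sum_le hX hX1 hw hn ha.le haq
    have h2 := h.smul_sum_le (X := fun i => -X i) (fun i => (hX i).neg)
      (fun i => by rw [norm_neg]; exact hX1 i) hwneg hn ha.le haq
    rw [Finset.sum_neg_distrib, smul_neg] at h2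
    have h3 := norm_le_of_bounds (A := a • ∑ i, X i) ?_ ?_ h1 h2
    · rwa [norm_smul, Real.norm_of_nonneg ha.le] at h3
    · have hS : IsSelfAdjoint (∑ i, X i) := isSelfAdjoint_sum _ fun i _ => hX i
      simp only [IsSelfAdjoint, star_smul, star_trivial, hS.star_eq]
    · have : 0 ≤ (n : ℝ) - 1 := by linarith
      positivity
  set q : ℝ := (n : ℝ) - 1 with hq
  have hq1 : 1 ≤ q := by linarith
  set r := Real.sqrt q with hr
  have hr0 : 0 < r := Real.sqrt_pos.2 (by linarith)
  have hrr : r ^ 2 = q := Real.sq_sqrt (by linarith)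
  -- let `a = θ / r` with `θ → 1`
  have key2 : ∀ θ ∈ Set.Ioo (0 : ℝ) 1, θ * ‖∑ i, X i‖ ≤ (1 + θ ^ 2) * r := by
    intro θ hθ
    have e : q * (θ / r) ^ 2 = θ ^ 2 := by rw [← hrr]; field_simp
    have := key (θ / r) (div_pos hθ.1 hr0) (by rw [e]; nlinarith [hθ.1, hθ.2])
    rw [e, div_mul_eq_mul_div, div_le_iff₀ hr0] at this
    exact this
  have hl : Filter.Tendsto (fun θ : ℝ => θ * ‖∑ i, X i‖) (nhdsWithin 1 (Set.Iio 1))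
      (nhds (1 * ‖∑ i, X i‖)) :=
    ((continuous_id.mul continuous_const).tendsto 1).mono_left nhdsWithin_le_nhds
  have hl2 : Filter.Tendsto (fun θ : ℝ => (1 + θ ^ 2) * r) (nhdsWithin 1 (Set.Iio 1))
      (nhds ((1 + 1 ^ 2) * r)) := by
    have : Continuous (fun θ : ℝ => (1 + θ ^ 2) * r) := by fun_prop
    exact (this.tendsto 1).mono_left nhdsWithin_le_nhds
  have := le_of_tendsto_of_tendsto hl hl2 (by
    filter_upwards [Ioo_mem_nhdsLT (show (0 : ℝ) < 1 by norm_num)] with θ hθ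
    exact key2 θ hθ)
  linarith

end RTr
section Doubling

variable {M : Type*} [CStarAlgebra M] [PartialOrder M] [StarOrderedRing M]

/-- The self-adjoint doubling of `x`. -/
noncomputable def dbl (x : M) : CStarMatrix (Fin 2) (Fin 2) M :=
  CStarMatrix.ofMatrix !![0, x; star x, 0]

/-- The real part of the normalized amplified trace. -/
noncomputable def amp (τ : M →ₗ[ℂ] ℂ) : CStarMatrix (Fin 2) (Fin 2) M →ₗ[ℝ] ℝ where
  toFun a := ((τ (a 0 0)).re + (τ (a 1 1)).re) / 2
  map_add' a b := by simp; ring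
  map_smul' c a := by
    have h : ∀ m : M, τ (c • m) = (c : ℂ) * τ m := fun m => by
      rw [← smul_eq_mul, ← map_smul]; rfl
    simp [h]; ring

theorem amp_apply (τ : M →ₗ[ℂ] ℂ) (a : CStarMatrix (Fin 2) (Fin 2) M) :
    amp τ a = ((τ (a 0 0)).re + (τ (a 1 1)).re) / 2 := rfl

theorem mul_fin2 (a b : CStarMatrix (Fin 2) (Fin 2) M) (i j : Fin 2) :
    (a * b) i j = a i 0 * b 0 j + a i 1 * b 1 j := by
  rw [CStarMatrix.mul_apply]; simp [Fin.sum_univ_two]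

theorem RTr_amp (τ : M →ₗ[ℂ] ℂ) (h1 : τ 1 = 1) (hp : ∀ x, 0 ≤ τ (star x * x))
    (ht : ∀ x y, τ (x * y) = τ (y * x)) (hf : ∀ x, τ (star x * x) = 0 → x = 0) :
    RTr (amp τ) := by
  have hp' : ∀ x, 0 ≤ (τ (star x * x)).re := fun x => (Complex.le_def.1 (hp x)).1
  have hi : ∀ x, (τ (star x * x)).im = 0 := fun x => (Complex.le_def.1 (hp x)).2.symm
  have hf' : ∀ x, (τ (star x * x)).re = 0 → x = 0 := fun x hx =>
    hf x (Complex.ext hx (hi x))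
  have hs : ∀ x, (τ (star x)).re = (τ x).re := by
    intro x
    have e := hi (1 + Complex.I • x)
    have e1 := hi x
    simp only [star_add, star_one, star_smul, mul_add, add_mul, one_mul, mul_one, map_add,
      smul_mul_smul_comm, map_smul, smul_eq_mul, Complex.add_im, h1] at e
    simp [e1] at e
    linarith
  have hsm : ∀ a : CStarMatrix (Fin 2) (Fin 2) M, amp τ (star a * a) =
      ((τ (star (a 0 0) * a 0 0)).re + (τ (star (a 1 0) * a 1 0)).re +
      ((τ (star (a 0 1) * a 0 1)).re + (τ (star (a 1 1) * a 1 1)).re)) / 2 := by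
    intro a
    rw [amp_apply, mul_fin2, mul_fin2]
    simp [CStarMatrix.star_apply]
  refine ⟨?_, ?_, ?_, ?_, ?_⟩
  · change ((τ ((1 : CStarMatrix (Fin 2) (Fin 2) M) 0 0)).re +
      (τ ((1 : CStarMatrix (Fin 2) (Fin 2) M) 1 1)).re) / 2 = 1
    simp [h1]
  · intro a
    refine le_of_le_of_eq ?_ (hsm a).symm
    have := hp' (a 0 0)
    have := hp' (a 1 0)
    have := hp' (a 0 1)
    have := hp' (a 1 1)
    linarith
  · intro a ha
    have ha := (hsm a).symm.trans ha
    have e1 := hp' (a 0 0)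
    have e2 := hp' (a 1 0)
    have e3 := hp' (a 0 1)
    have e4 := hp' (a 1 1)
    have f1 := hf' (a 0 0) (by linarith)
    have f2 := hf' (a 1 0) (by linarith)
    have f3 := hf' (a 0 1) (by linarith)
    have f4 := hf' (a 1 1) (by linarith)
    ext i j
    fin_cases i <;> fin_cases j <;> simp [f1, f2, f3, f4]
  · intro a b
    change ((τ ((a * b) 0 0)).re + (τ ((a * b) 1 1)).re) / 2 =
      ((τ ((b * a) 0 0)).re + (τ ((b * a) 1 1)).re) / 2
    simp only [mul_fin2, map_add, Complex.add_re]
    rw [ht (a 0 0), ht (a 0 1), ht (a 1 0), ht (a 1 1)]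
    ring
  · intro a
    change ((τ (star a 0 0)).re + (τ (star a 1 1)).re) / 2 =
      ((τ (a 0 0)).re + (τ (a 1 1)).re) / 2
    simp [CStarMatrix.star_apply, hs]

theorem dbl_sa (x : M) : IsSelfAdjoint (dbl x) := by
  ext i j
  fin_cases i <;> fin_cases j <;> simp [dbl, CStarMatrix.star_apply]

theorem dbl_norm {x : M} (hx : ‖x‖ ≤ 1) : ‖dbl x‖ ≤ 1 := by
  have aux : ∀ y : M, ‖y‖ ≤ 1 → ∃ c : M, star c * c = 1 - star y * y := by
    intro y hy
    have h1 := CStarAlgebra.star_mul_le_algebraMap_norm_sq (a := y)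
    have h2 := h1.trans (algebraMap_mono M (pow_le_one₀ (norm_nonneg _) hy))
    rw [map_one] at h2
    obtain ⟨c, hc⟩ := CStarAlgebra.nonneg_iff_eq_star_mul_self.mp (sub_nonneg.2 h2)
    exact ⟨c, hc.symm⟩
  obtain ⟨c, hc⟩ := aux x hx
  obtain ⟨d, hd⟩ := aux (star x) (by rwa [norm_star])
  rw [star_star] at hd
  let D : CStarMatrix (Fin 2) (Fin 2) M := CStarMatrix.ofMatrix !![d, 0; 0, c]
  have e : 1 - star (dbl x) * dbl x = star D * D := by
    ext i j
    rw [CStarMatrix.sub_apply, mul_fin2, mul_fin2]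
    fin_cases i <;> fin_cases j <;> simp [dbl, D, CStarMatrix.star_apply, hc, hd]
  have h1 : star (dbl x) * dbl x ≤ 1 := by
    rw [← sub_nonneg, e]; exact star_mul_self_nonneg D
  have h2 := (CStarAlgebra.norm_le_one_iff_of_nonneg _ (star_mul_self_nonneg (dbl x))).2 h1
  rw [CStarRing.norm_star_mul_self] at h2
  nlinarith [norm_nonneg (dbl x)]

/-- alternating words on lists -/
noncomputable def aw {n : ℕ} (x : Fin n → M) : Bool → List (Fin n) → M
  | _, [] => 1
  | true, i :: w => x i * aw x false w
  | false, i :: w => star (x i) * aw x true w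

theorem dbl_word {n : ℕ} (x : Fin n → M) (w : List (Fin n)) :
    (Even w.length → (w.map fun i => dbl (x i)).prod 0 0 = aw x true w ∧
      (w.map fun i => dbl (x i)).prod 1 1 = aw x false w ∧
      (w.map fun i => dbl (x i)).prod 0 1 = 0 ∧ (w.map fun i => dbl (x i)).prod 1 0 = 0) ∧
    (¬ Even w.length → (w.map fun i => dbl (x i)).prod 0 1 = aw x true w ∧
      (w.map fun i => dbl (x i)).prod 1 0 = aw x false w ∧
      (w.map fun i => dbl (x i)).prod 0 0 = 0 ∧ (w.map fun i => dbl (x i)).prod 1 1 = 0) := by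
  induction w with
  | nil => simp [aw]
  | cons i w ih =>
    simp only [List.map_cons, List.prod_cons, mul_fin2, List.length_cons, Nat.even_add_one, not_not]
    constructor
    · intro hh
      obtain ⟨a, b, c, d⟩ := ih.2 hh
      simp [dbl, a, b, c, d, aw] at *
    · intro hh
      obtain ⟨a, b, c, d⟩ := ih.1 hh
      simp [dbl, a, b, c, d, aw] at *

theorem aw_eq {n : ℕ} (x : Fin n → M) (m : ℕ) (i : Fin m → Fin n) :
    aw x true (List.ofFn i) = LWord x i ∧ aw x false (List.ofFn i) = LWordStar x i := by
  induction m with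
  | zero => simp [aw, LWord, LWordStar]
  | succ m ih =>
    have := ih (fun s => i s.succ)
    have e : ∀ k : ℕ, ((k + 1) % 2 = 0) ↔ ¬ (k % 2 = 0) := by intro k; omega
    simp only [LWord, LWordStar, List.ofFn_succ, aw, List.prod_cons, this]
    simp only [Fin.val_zero, Nat.zero_mod, if_true, Fin.val_succ, e, ite_not, and_self]

theorem core {n : ℕ} (τ : M → ℂ) (hτ : IsTracialState τ) (hτf : IsFaithful τ)
    (hn : 2 ≤ n)
    (x : Fin n → M) (hx : ∀ i, ‖x i‖ ≤ 1) (hL : IsLFree τ x) :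
    ‖∑ i, x i‖ ≤ 2 * Real.sqrt ((n : ℝ) - 1) := by
  obtain ⟨hlin, hone, hpos, htr⟩ := hτ
  have h0 : τ 0 = 0 := by
    have := hlin 1 0 0
    simpa using this
  let t : M →ₗ[ℂ] ℂ :=
    { toFun := τ
      map_add' := fun a b => by simpa using hlin 1 a b
      map_smul' := fun c a => by simpa [h0] using hlin c a 0 }
  have hR : RTr (amp t) := RTr_amp t hone hpos htr hτf
  have hw : ∀ w : List (Fin n), w ≠ [] → w.IsChain (· ≠ ·) →
      amp t (w.map fun i => dbl (x i)).prod = 0 := by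
    intro w hw0 hwc
    rw [amp_apply]
    by_cases he : Even w.length
    · obtain ⟨a, b, -, -⟩ := (dbl_word x w).1 he
      rw [a, b]
      obtain ⟨k, hk⟩ := he
      have hk2 : w.length = 2 * k := by omega
      have hk1 : 1 ≤ k := by
        have := List.length_pos_iff.2 hw0
        omega
      obtain ⟨i, rfl⟩ : ∃ i : Fin (2 * k) → Fin n, w = List.ofFn i := by
        refine ⟨fun s => w.get (s.cast hk2.symm), ?_⟩
        apply List.ext_get
        · simp [hk2]
        · intro s h1 h2; simp
      have := hL k hk1 i (by
        intro s u hsu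
        rw [List.isChain_iff_getElem] at hwc
        have h3 := hwc s (by simp; omega)
        simp only [List.getElem_ofFn] at h3
        have : u = ⟨(s : ℕ) + 1, by omega⟩ := Fin.ext hsu
        rw [this]
        exact h3)
      rw [(aw_eq x _ i).1, (aw_eq x _ i).2]
      change ((τ _).re + (τ _).re) / 2 = 0
      rw [this.1, this.2]; simp
    · obtain ⟨-, -, a, b⟩ := (dbl_word x w).2 he
      rw [a, b]; simp
  have hmain := hR.norm_sum_le' (fun i => dbl_sa (x i)) (fun i => dbl_norm (hx i)) hw hn
  refine le_trans ?_ hmain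
  have e : ∑ i, x i = (∑ i, dbl (x i)) 0 1 := by
    have : ∀ s : Finset (Fin n), ∑ i ∈ s, x i = (∑ i ∈ s, dbl (x i)) 0 1 := by
      intro s
      induction s using Finset.induction_on with
      | empty => simp
      | insert a s ha ih => rw [Finset.sum_insert ha, Finset.sum_insert ha, ih]; simp [dbl]
    exact this _
  rw [e]
  exact CStarMatrix.norm_entry_le_norm

end Doubling

/-- An L-free family of `n ≥ 2` contractions satisfies
`‖x₁ + ⋯ + xₙ‖ ≤ 2√(n-1)`. -/
theorem norm_sum_le_of_LFree_contractions
    {M : Type*} [NormedRing M] [StarRing M] [CStarRing M] [NormedAlgebra ℂ M]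
    [StarModule ℂ M] [CompleteSpace M]
    (τ : M → ℂ) (hτ : IsTracialState τ) (hτf : IsFaithful τ)
    (n : ℕ) (hn : 2 ≤ n)
    (x : Fin n → M) (hx : ∀ i, ‖x i‖ ≤ 1) (hL : IsLFree τ x) :
    ‖∑ i, x i‖ ≤ 2 * Real.sqrt ((n : ℝ) - 1) := by
  letI : CStarAlgebra M := {}
  letI : PartialOrder M := CStarAlgebra.spectralOrder M
  haveI : StarOrderedRing M := CStarAlgebra.spectralOrderedRing M
  exact core τ hτ hτf hn x hx hL
end
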